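/- Let F be a finite simple graph with e(F) > 1 and m = |F| vertices, and let 0 < p ≤ 1. If F is a regular graph, or a star, or disconnected, then P(F;1/m,…,1/m) (for any labelling of F) and the weaker property P̃(F;1/m,…,1/m) are p-quasi-random properties of graph sequences. -/

import Mathlib

open Filter Finset Asymptotics MeasureTheory

/-- `labCount F G U` is the number of injective graph homomorphisms `φ : F → G`
with `φ i ∈ U i` for every vertex `i` of `F` (the quantity `N(F,G;U₁,…,U_m)`). -/
noncomputable def labCount {m : ℕ} {β : Type} [Fintype β]
    (F : SimpleGraph (Fin m)) (G : SimpleGraph β) (U : Fin m → Finset β) : ℕ :=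
  Nat.card {φ : Fin m → β //
    Function.Injective φ ∧ (∀ i j, F.Adj i j → G.Adj (φ i) (φ j)) ∧ ∀ i, φ i ∈ U i}

/-- `totalCount F G` is the total number of injective graph homomorphisms `F → G`,
the quantity `N(F,G)`. -/
noncomputable def totalCount {m : ℕ} {β : Type} [Fintype β]
    (F : SimpleGraph (Fin m)) (G : SimpleGraph β) : ℕ :=
  Nat.card {φ : Fin m → β //
    Function.Injective φ ∧ ∀ i j, F.Adj i j → G.Adj (φ i) (φ j)}

/-- `symCount F G U` is `Ñ(F,G;U₁,…,U_m) = (1/m!) ∑_σ N(F,G;U_{σ(1)},…,U_{σ(m)})`. -/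
noncomputable def symCount {m : ℕ} {β : Type} [Fintype β]
    (F : SimpleGraph (Fin m)) (G : SimpleGraph β) (U : Fin m → Finset β) : ℝ :=
  ((m.factorial : ℝ))⁻¹ * ∑ σ : Equiv.Perm (Fin m), (labCount F G (fun i => U (σ i)) : ℝ)

/-- `numEdges F` is `e(F)`, the number of edges of `F`. -/
noncomputable def numEdges {m : ℕ} (F : SimpleGraph (Fin m)) : ℕ := Nat.card F.edgeSet

/-- A sequence of graphs `G n` on vertex sets `Fin (V n)` is `p`-quasi-random if, for every
finite simple graph `F`, `N(F,G_n) = p^(e F) |G_n|^(|F|) + o(|G_n|^(|F|))`. -/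
def IsQuasirandom (p : ℝ) (V : ℕ → ℕ) (G : ∀ n, SimpleGraph (Fin (V n))) : Prop :=
  ∀ (m : ℕ) (F : SimpleGraph (Fin m)),
    (fun n => (totalCount F (G n) : ℝ) - p ^ numEdges F * (V n : ℝ) ^ m)
      =o[atTop] (fun n => (V n : ℝ) ^ m)

/-- The property `P(F;α₁,…,α_m)`: `N(F,G_n;U₁,…,U_m) = p^(e F) ∏ |U_i| + o(|G_n|^m)`,
uniformly over all pairwise disjoint `U₁,…,U_m ⊆ V(G_n)` with `|U_i| = ⌊α_i |G_n|⌋`. -/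
def SatisfiesP {m : ℕ} (F : SimpleGraph (Fin m)) (p : ℝ) (α : Fin m → ℝ)
    (V : ℕ → ℕ) (G : ∀ n, SimpleGraph (Fin (V n))) : Prop :=
  ∃ ε : ℕ → ℝ, Tendsto ε atTop (nhds 0) ∧
    ∀ (n : ℕ) (U : Fin m → Finset (Fin (V n))),
      Pairwise (fun i j => Disjoint (U i) (U j)) →
      (∀ i, (U i).card = ⌊α i * (V n : ℝ)⌋₊) →
      |(labCount F (G n) U : ℝ) - p ^ numEdges F * ∏ i, ((U i).card : ℝ)|
        ≤ ε n * (V n : ℝ) ^ m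

/-- The property `P̃(F;α₁,…,α_m)`: as `SatisfiesP` but with the symmetrized count `Ñ`. -/
def SatisfiesPt {m : ℕ} (F : SimpleGraph (Fin m)) (p : ℝ) (α : Fin m → ℝ)
    (V : ℕ → ℕ) (G : ∀ n, SimpleGraph (Fin (V n))) : Prop :=
  ∃ ε : ℕ → ℝ, Tendsto ε atTop (nhds 0) ∧
    ∀ (n : ℕ) (U : Fin m → Finset (Fin (V n))),
      Pairwise (fun i j => Disjoint (U i) (U j)) →
      (∀ i, (U i).card = ⌊α i * (V n : ℝ)⌋₊) →
      |symCount F (G n) U - p ^ numEdges F * ∏ i, ((U i).card : ℝ)|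
        ≤ ε n * (V n : ℝ) ^ m

/-- The property `Pᵘ(F;α₁,…,α_m)`: `P` holds for every labelling of `F`. -/
def SatisfiesPu {m : ℕ} (F : SimpleGraph (Fin m)) (p : ℝ) (α : Fin m → ℝ)
    (V : ℕ → ℕ) (G : ∀ n, SimpleGraph (Fin (V n))) : Prop :=
  ∀ σ : Equiv.Perm (Fin m), SatisfiesP (SimpleGraph.map σ.toEmbedding F) p α V G


/-- `F` is a regular graph: all vertices have the same degree. -/
def IsRegularGraph {m : ℕ} (F : SimpleGraph (Fin m)) : Prop :=
  ∀ v w : Fin m, Nat.card (F.neighborSet v) = Nat.card (F.neighborSet w)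

/-- `F` is a star: some centre vertex is adjacent to exactly the other vertices,
and there are no other edges. -/
def IsStar {m : ℕ} (F : SimpleGraph (Fin m)) : Prop :=
  ∃ c : Fin m, ∀ i j, F.Adj i j ↔ (i = c ∨ j = c) ∧ i ≠ j

lemma exp_sub_one_sub_le_sq_mul {a δ : ℝ} (ha : 0 ≤ a) (h0 : 0 ≤ δ) (h1 : δ ≤ 1) :
    Real.exp (δ * a) - 1 - δ * a ≤ δ ^ 2 * (Real.exp a - 1 - a) := by
  have key : ∀ x : ℝ, HasSum (fun n : ℕ => x ^ (n + 2) / (n + 2).factorial)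
      (Real.exp x - 1 - x) := by
    intro x
    have h := NormedSpace.expSeries_div_hasSum_exp (𝔸 := ℝ) x
    rw [← Real.exp_eq_exp_ℝ] at h
    have := (hasSum_nat_add_iff' 2).2 h
    simpa [Finset.sum_range_succ, sub_sub] using this
  refine hasSum_le (fun n => ?_) (key (δ * a)) ((key a).mul_left (δ ^ 2))
  rw [← mul_div_assoc]
  gcongr
  rw [mul_pow]
  gcongr ?_ * _
  exact pow_le_pow_of_le_one h0 h1 (by omega)

lemma antitoneOn_exp_neg_remainder_div_sq :
    AntitoneOn (fun x : ℝ => (Real.exp (-x) - 1 + x) / x ^ 2) (Set.Ioi 0) := by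
  have hd : ∀ x ∈ Set.Ioi (0 : ℝ), HasDerivAt (fun x : ℝ => (Real.exp (-x) - 1 + x) / x ^ 2)
      (((-Real.exp (-x) + 1) * x ^ 2 - (Real.exp (-x) - 1 + x) * (2 * x)) / (x ^ 2) ^ 2) x := by
    intro x hx
    have hx : 0 < x := hx
    have h1 : HasDerivAt (fun x : ℝ => Real.exp (-x) - 1 + x) (-Real.exp (-x) + 1) x := by
      have := ((Real.hasDerivAt_exp (-x)).comp x (hasDerivAt_neg x))
      simpa using (this.sub_const 1).fun_add (hasDerivAt_id' x)
    have h2 : HasDerivAt (fun x : ℝ => x ^ 2) (2 * x) x := by simpa using hasDerivAt_pow 2 x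
    exact h1.div h2 (by positivity)
  have hg : ∀ x : ℝ, 0 ≤ x → 0 ≤ 2 + x - (2 - x) * Real.exp x := by
    intro x hx
    have hm : MonotoneOn (fun x : ℝ => 2 + x - (2 - x) * Real.exp x) (Set.Ici 0) := by
      apply monotoneOn_of_hasDerivWithinAt_nonneg (convex_Ici 0)
        (f' := fun x => 1 - ((-1) * Real.exp x + (2 - x) * Real.exp x)) (by fun_prop)
      · intro y _
        have h1 : HasDerivAt (fun x : ℝ => 2 + x) 1 y := by
          simpa using (hasDerivAt_id y).const_add 2
        have h2 : HasDerivAt (fun x : ℝ => 2 - x) (-1) y := by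
          simpa using (hasDerivAt_id y).const_sub 2
        exact (h1.sub (h2.mul (Real.hasDerivAt_exp y))).hasDerivWithinAt
      · intro y _
        have h := Real.add_one_le_exp (-y)
        have h2 : Real.exp (-y) * Real.exp y = 1 := by rw [← Real.exp_add]; simp
        nlinarith [Real.exp_pos y]
    simpa using hm (Set.mem_Ici.2 le_rfl) (Set.mem_Ici.2 hx) hx
  apply antitoneOn_of_deriv_nonpos (convex_Ioi 0)
  · exact fun x hx => (hd x hx).continuousAt.continuousWithinAt
  · rw [interior_Ioi]
    exact fun x hx => (hd x hx).differentiableAt.differentiableWithinAt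
  · rw [interior_Ioi]
    intro x hx
    rw [(hd x hx).deriv]
    have hx' : 0 < x := hx
    apply div_nonpos_of_nonpos_of_nonneg _ (by positivity)
    have h := hg x hx'.le
    have h2 : Real.exp (-x) * Real.exp x = 1 := by rw [← Real.exp_add]; simp
    have h3 : 0 ≤ Real.exp (-x) * (2 + x - (2 - x) * Real.exp x) := by positivity
    have h4 : 0 ≤ (2 + x) * Real.exp (-x) - (2 - x) := by
      calc 0 ≤ _ := h3
        _ = (2 + x) * Real.exp (-x) - (2 - x) * (Real.exp (-x) * Real.exp x) := by ring
        _ = _ := by rw [h2]; ring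
    nlinarith

lemma sq_mul_le_exp_neg_remainder {b δ : ℝ} (hb : 0 < b) (h0 : 0 ≤ δ) (h1 : δ ≤ 1) :
    δ ^ 2 * (Real.exp (-b) - 1 + b) ≤ Real.exp (-(δ * b)) - 1 + δ * b := by
  rcases h0.eq_or_lt with rfl | h0
  · simp
  have h := antitoneOn_exp_neg_remainder_div_sq (Set.mem_Ioi.2 (mul_pos h0 hb))
    (Set.mem_Ioi.2 hb) (by nlinarith)
  simp only at h
  rw [div_le_div_iff₀ (by positivity) (by positivity)] at h
  have hb2 : 0 < b ^ 2 := by positivity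
  nlinarith

lemma one_add_mul_log_le {h : ℝ} (h0 : 0 ≤ h) (h1 : h < 1) :
    (1 + h) * Real.log (1 + h) - h ≤ (1 - h) * Real.log (1 - h) + h := by
  have hm : MonotoneOn (fun x : ℝ => (1 - x) * Real.log (1 - x) - (1 + x) * Real.log (1 + x)
      + 2 * x) (Set.Ico 0 1) := by
    have hd : ∀ y ∈ Set.Ico (0 : ℝ) 1, HasDerivAt (fun x : ℝ => (1 - x) * Real.log (1 - x)
        - (1 + x) * Real.log (1 + x) + 2 * x)
        (((-1) * Real.log (1 - y) + (1 - y) * (-1 / (1 - y)))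
          - (1 * Real.log (1 + y) + (1 + y) * (1 / (1 + y))) + 2) y := by
      intro y hy
      have e1 : HasDerivAt (fun x : ℝ => 1 + x) 1 y := by
        simpa using (hasDerivAt_id y).const_add 1
      have e2 : HasDerivAt (fun x : ℝ => 1 - x) (-1) y := by
        simpa using (hasDerivAt_id y).const_sub 1
      have e3 : HasDerivAt (fun x : ℝ => 2 * x) 2 y := by
        simpa using (hasDerivAt_id y).const_mul 2
      have p1 : (1 - y) ≠ 0 := by linarith [hy.2]
      have p2 : (1 + y) ≠ 0 := by linarith [hy.1]
      exact ((e2.mul (e2.log p1)).sub (e1.mul (e1.log p2))).add e3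
    apply monotoneOn_of_hasDerivWithinAt_nonneg (convex_Ico 0 1)
      (fun y hy => (hd y hy).continuousAt.continuousWithinAt)
      (fun y hy => (hd y (interior_subset hy)).hasDerivWithinAt)
    intro y hy
    have hy := interior_subset hy
    have p1 : 0 < 1 - y := by linarith [hy.2]
    have p2 : 0 < 1 + y := by linarith [hy.1]
    have l1 : Real.log (1 - y) ≤ -y := by linarith [Real.log_le_sub_one_of_pos p1]
    have l2 : Real.log (1 + y) ≤ y := by linarith [Real.log_le_sub_one_of_pos p2]
    have q1 : (1 - y) * (-1 / (1 - y)) = -1 := by field_simp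
    have q2 : (1 + y) * (1 / (1 + y)) = 1 := by field_simp
    rw [q1, q2]
    linarith
  have := hm (Set.mem_Ico.2 ⟨le_rfl, one_pos⟩) (Set.mem_Ico.2 ⟨h0, h1⟩) h0
  simp at this
  linarith

lemma false_of_quadratic_comparison {a b X Z P : ℝ} (hX : 1 < X) (hZ : 1 < Z)
    (ha : Real.log X = a) (hb : Real.log Z = b) (hP : P < 2)
    (k1 : X * Z - 1 - 2 * a ≤ P * (X - 1 - a))
    (k2 : P * (Z⁻¹ - 1 + b) ≤ (X * Z)⁻¹ - 1 + 2 * b) : False := by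
  have hX0 : 0 < X := by linarith
  have hZ0 : 0 < Z := by linarith
  have hβ : 0 < X - 1 - a := by
    rw [← ha]; linarith [Real.log_lt_sub_one_of_pos hX0 hX.ne']
  have hα : 0 < Z⁻¹ - 1 + b := by
    have := Real.log_lt_sub_one_of_pos (inv_pos.2 hZ0) (inv_ne_one.2 hZ.ne')
    rw [Real.log_inv, hb] at this
    linarith
  have hE0 : 0 < X * Z := by positivity
  have hQ : X * Z + 1 - 2 * X < 0 := by nlinarith only [k1, mul_pos (sub_pos.2 hP) hβ]
  have k3 : (Z⁻¹ - 1 + b) * (X * Z - 1 - 2 * a) ≤ (X - 1 - a) * ((X * Z)⁻¹ - 1 + 2 * b) :=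
    calc _ ≤ (Z⁻¹ - 1 + b) * (P * (X - 1 - a)) := mul_le_mul_of_nonneg_left k1 hα.le
      _ = (X - 1 - a) * (P * (Z⁻¹ - 1 + b)) := by ring
      _ ≤ _ := mul_le_mul_of_nonneg_left k2 hβ.le
  have k4 : (X - 1 - a) * (X * Z)⁻¹ ≤ Z⁻¹ - 1 + b := by
    have e1 : (X * Z)⁻¹ - 1 + 2 * b
        = 2 * (Z⁻¹ - 1 + b) + (X * Z)⁻¹ * (X * Z + 1 - 2 * X) := by
      field_simp; ring
    rw [e1] at k3
    by_contra! hc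
    have := mul_pos (sub_pos.2 hc) (neg_pos.2 hQ)
    linarith
  have k5 : X - 1 - a ≤ X * (1 - Z + b * Z) := by
    have := mul_le_mul_of_nonneg_right k4 hE0.le
    rw [mul_assoc, inv_mul_cancel₀ hE0.ne', mul_one] at this
    refine this.trans_eq ?_
    field_simp
  obtain ⟨y, hy⟩ : ∃ y, y = X⁻¹ := ⟨_, rfl⟩
  have hy0 : 0 < y := by rw [hy]; exact inv_pos.2 hX0
  have hy1 : y < 1 := by rw [hy]; exact inv_lt_one_of_one_lt₀ hX
  have hXy : X * y = 1 := by rw [hy]; exact mul_inv_cancel₀ hX0.ne'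
  have hZ2 : Z < 2 - y := by
    have := mul_neg_of_neg_of_pos hQ hy0
    have e : (X * Z + 1 - 2 * X) * y = (X * y) * Z + y - 2 * (X * y) := by ring
    rw [e, hXy] at this
    linarith
  have k6 : 1 - y - a * y ≤ 1 - Z + b * Z := by
    have := mul_le_mul_of_nonneg_right k5 hy0.le
    have e : (X - 1 - a) * y = X * y - y - a * y := by ring
    have e' : X * (1 - Z + b * Z) * y = (X * y) * (1 - Z + b * Z) := by ring
    rw [e, e', hXy] at this
    linarith
  have k7 := one_add_mul_log_le (h := 1 - y) (by linarith) (by linarith)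
  have hlogy : Real.log y = -a := by rw [hy, Real.log_inv, ha]
  rw [show 1 - (1 - y) = y by ring, hlogy, show 1 + (1 - y) = 2 - y by ring] at k7
  have hw0 : 0 < 2 - y := by linarith
  have k8 : Real.log (Z / (2 - y)) ≤ Z / (2 - y) - 1 :=
    Real.log_le_sub_one_of_pos (by positivity)
  rw [Real.log_div hZ0.ne' hw0.ne', hb] at k8
  have k9 : (2 - y) * (b - Real.log (2 - y)) ≤ Z - (2 - y) := by
    have := mul_le_mul_of_nonneg_left k8 hw0.le
    refine this.trans_eq ?_
    field_simp
  have hb0 : 0 < b := by rw [← hb]; exact Real.log_pos hZ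
  have k10 := mul_pos hb0 (sub_pos.2 hZ2)
  nlinarith only [k6, k7, k9, k10]

/-- The two exponential identities coming from a two-valued weighting of the vertices of a graph
with normalized degrees `δ` have no common nontrivial solution. -/
lemma no_nontrivial_exp_solution {ι : Type*} [Fintype ι] (δ : ι → ℝ) (h0 : ∀ i, 0 ≤ δ i)
    (h1 : ∀ i, δ i ≤ 1) (hs : ∑ i, δ i = 2) (hne : ∃ i, 0 < δ i ∧ δ i < 1)
    {a b : ℝ} (ha : 0 < a) (hb : 0 < b)
    (h2 : ∑ i, (Real.exp (δ i * a) - 1) = Real.exp (a + b) - 1)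
    (h3 : ∑ i, (Real.exp (-(δ i * b)) - 1) = Real.exp (-(a + b)) - 1) : False := by
  have hP2 : ∑ i, δ i ^ 2 < 2 := by
    rw [← hs]
    obtain ⟨j, hj⟩ := hne
    refine Finset.sum_lt_sum (fun i _ => by nlinarith [h0 i, h1 i]) ⟨j, mem_univ _, by nlinarith⟩
  refine false_of_quadratic_comparison (Real.one_lt_exp_iff.2 ha) (Real.one_lt_exp_iff.2 hb)
    (Real.log_exp a) (Real.log_exp b) hP2 ?_ ?_
  · have : ∑ i, (Real.exp (δ i * a) - 1 - δ i * a)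
        ≤ ∑ i, δ i ^ 2 * (Real.exp a - 1 - a) :=
      Finset.sum_le_sum fun i _ => exp_sub_one_sub_le_sq_mul ha.le (h0 i) (h1 i)
    rw [Finset.sum_sub_distrib, h2, ← Finset.sum_mul, ← Finset.sum_mul, hs, Real.exp_add] at this
    exact this
  · have : ∑ i, δ i ^ 2 * (Real.exp (-b) - 1 + b)
        ≤ ∑ i, (Real.exp (-(δ i * b)) - 1 + δ i * b) :=
      Finset.sum_le_sum fun i _ => sq_mul_le_exp_neg_remainder hb (h0 i) (h1 i)
    rw [Finset.sum_add_distrib, h3, ← Finset.sum_mul, ← Finset.sum_mul, hs, Real.exp_neg,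
      Real.exp_neg, Real.exp_add] at this
    exact this

/-- If the two boundary equations of a two-valued weighting hold, the two pure values agree. -/
lemma pow_eq_pow_of_degree_identities {ι : Type*} [Fintype ι] (d : ι → ℕ) {e : ℕ}
    (hd : ∀ i, d i ≤ e) (hs : ∑ i, d i = 2 * e) (hne : ∃ i, 0 < d i ∧ d i < e)
    {u s t : ℝ} (hu : 0 ≤ u) (hs0 : 0 ≤ s) (ht : 0 ≤ t)
    (h1 : ∑ i, (s ^ d i * t ^ (e - d i) - t ^ e) = u ^ e - t ^ e)
    (h2 : ∑ i, (s ^ d i * u ^ (e - d i) - u ^ e) = t ^ e - u ^ e) : u ^ e = t ^ e := by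
  classical
  wlog hut : t ≤ u generalizing u t
  · exact (this ht hu h2 h1 (le_of_not_ge hut)).symm
  rcases hut.eq_or_lt with rfl | hlt
  · rfl
  exfalso
  have hu0 : 0 < u := lt_of_le_of_lt ht hlt
  have he : e ≠ 0 := by obtain ⟨i, hi⟩ := hne; omega
  have hpow : t ^ e < u ^ e := pow_lt_pow_left₀ hlt ht he
  have hsu : s < u := by
    by_contra! hc
    have : 0 ≤ ∑ i, (s ^ d i * u ^ (e - d i) - u ^ e) := by
      refine Finset.sum_nonneg fun i _ => ?_
      have : u ^ e = u ^ d i * u ^ (e - d i) := by rw [← pow_add]; congr 1; have := hd i; omega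
      rw [this, sub_nonneg]
      gcongr
    linarith
  rcases ht.eq_or_lt with rfl | ht0
  · rw [zero_pow he] at *
    have hz : ∀ i, s ^ d i * (0 : ℝ) ^ (e - d i) = if d i = e then s ^ e else 0 := by
      intro i
      split_ifs with h
      · simp [h]
      · have := hd i
        rw [zero_pow (by omega), mul_zero]
    simp only [hz, sub_zero] at h1
    rw [← Finset.sum_filter, Finset.sum_const, nsmul_eq_mul] at h1
    have hc : (univ.filter fun i => d i = e).card ≤ 1 := by
      by_contra! hc
      obtain ⟨j, hj0, hj⟩ := hne
      have hsub : ∑ i ∈ insert j (univ.filter fun i => d i = e), d i ≤ 2 * e := by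
        rw [← hs]; exact Finset.sum_le_sum_of_subset (subset_univ _)
      rw [Finset.sum_insert (by simp; omega), Finset.sum_congr rfl
        (g := fun _ => e) (fun i hi => by simpa using hi), Finset.sum_const, smul_eq_mul] at hsub
      nlinarith
    have hse : s ^ e < u ^ e := pow_lt_pow_left₀ hsu hs0 he
    have : ((univ.filter fun i => d i = e).card : ℝ) ≤ 1 := by exact_mod_cast hc
    nlinarith [pow_nonneg hs0 e]
  have hst : t < s := by
    by_contra! hc
    have : ∑ i, (s ^ d i * t ^ (e - d i) - t ^ e) ≤ 0 := by
      refine Finset.sum_nonpos fun i _ => ?_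
      have : t ^ e = t ^ d i * t ^ (e - d i) := by rw [← pow_add]; congr 1; have := hd i; omega
      rw [this, sub_nonpos]
      gcongr
    linarith
  have hs1 : 0 < s := ht0.trans hst
  have he' : (0 : ℝ) < e := by positivity
  set a := e * Real.log (s / t) with ha
  set b := e * Real.log (u / s) with hb
  have ha0 : 0 < a := mul_pos he' (Real.log_pos ((one_lt_div ht0).2 hst))
  have hb0 : 0 < b := mul_pos he' (Real.log_pos ((one_lt_div hs1).2 hsu))
  have hab : Real.exp (a + b) = (u / t) ^ e := by
    rw [ha, hb, ← mul_add, ← Real.log_mul (by positivity) (by positivity), Real.exp_nat_mul,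
      Real.exp_log (by positivity)]
    congr 1; field_simp
  have hea : ∀ i, Real.exp ((d i : ℝ) / e * a) = (s / t) ^ d i := by
    intro i
    rw [ha, ← mul_assoc, div_mul_cancel₀ _ he'.ne', Real.exp_nat_mul, Real.exp_log (by positivity)]
  have heb : ∀ i, Real.exp (-((d i : ℝ) / e * b)) = (s / u) ^ d i := by
    intro i
    rw [hb, ← mul_assoc, div_mul_cancel₀ _ he'.ne', Real.exp_neg, Real.exp_nat_mul,
      Real.exp_log (by positivity), ← inv_pow, inv_div]
  refine no_nontrivial_exp_solution (fun i => (d i : ℝ) / e) (fun i => by positivity)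
    (fun i => (div_le_one he').2 (by exact_mod_cast hd i)) ?_ ?_ ha0 hb0 ?_ ?_
  · rw [← Finset.sum_div, ← Nat.cast_sum, hs]; push_cast; field_simp
  · obtain ⟨i, hi0, hi⟩ := hne
    exact ⟨i, by positivity, (div_lt_one he').2 (by exact_mod_cast hi)⟩
  · simp only [hea]
    rw [hab]
    have : ∀ i, s ^ d i * t ^ (e - d i) - t ^ e = t ^ e * ((s / t) ^ d i - 1) := by
      intro i
      have : t ^ e = t ^ d i * t ^ (e - d i) := by rw [← pow_add]; congr 1; have := hd i; omega
      rw [div_pow, mul_sub, mul_one, mul_div_assoc', eq_sub_iff_add_eq, sub_add_cancel,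
        eq_div_iff (by positivity), this]
      ring
    simp only [this] at h1
    rw [← Finset.mul_sum] at h1
    rw [div_pow]
    have ht' : 0 < t ^ e := by positivity
    field_simp
    linarith
  · simp only [heb]
    rw [Real.exp_neg, hab]
    have : ∀ i, s ^ d i * u ^ (e - d i) - u ^ e = u ^ e * ((s / u) ^ d i - 1) := by
      intro i
      have : u ^ e = u ^ d i * u ^ (e - d i) := by rw [← pow_add]; congr 1; have := hd i; omega
      rw [div_pow, mul_sub, mul_one, mul_div_assoc', eq_sub_iff_add_eq, sub_add_cancel,
        eq_div_iff (by positivity), this]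
      ring
    simp only [this] at h2
    rw [← Finset.mul_sum] at h2
    rw [← inv_pow, inv_div, div_pow]
    have ht' : 0 < u ^ e := by positivity
    field_simp
    linarith

/-- The product of the weights `A` over the edges `E`, along the vertex map `x`. -/
def edgeProd {m : ℕ} {α : Type*} (E : Finset (Fin m × Fin m)) (A : α → α → ℝ) (x : Fin m → α) :
    ℝ :=
  ∏ e ∈ E, A (x e.1) (x e.2)

/-- The average of `edgeProd` over all permutations of the vertices. -/
noncomputable def symProd {m : ℕ} {α : Type*} (E : Finset (Fin m × Fin m)) (A : α → α → ℝ)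
    (x : Fin m → α) : ℝ :=
  ((m.factorial : ℝ))⁻¹ * ∑ σ : Equiv.Perm (Fin m), edgeProd E A (fun i => x (σ i))

/-- The number of edges of `E` at the vertex `v`. -/
def edgeDeg {m : ℕ} (E : Finset (Fin m × Fin m)) (v : Fin m) : ℕ :=
  (E.filter fun e => e.1 = v ∨ e.2 = v).card

section Degrees

variable {m : ℕ} {E : Finset (Fin m × Fin m)}

lemma edgeDeg_le (v : Fin m) : edgeDeg E v ≤ E.card := card_filter_le _ _

lemma sum_edgeDeg (hE : ∀ e ∈ E, e.1 < e.2) : ∑ v, edgeDeg E v = 2 * E.card := by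
  simp only [edgeDeg, card_filter]
  rw [sum_comm, mul_comm, ← smul_eq_mul, ← sum_const]
  refine sum_congr rfl fun e he => ?_
  rw [← card_filter]
  have : (univ.filter fun v => e.1 = v ∨ e.2 = v) = {e.1, e.2} := by
    ext v; simp [eq_comm]
  rw [this, card_pair (hE e he).ne]

lemma exists_edgeDeg_between (hE : ∀ e ∈ E, e.1 < e.2) (h1 : 1 < E.card) :
    ∃ v, 0 < edgeDeg E v ∧ edgeDeg E v < E.card := by
  obtain ⟨e, he, f, hf, hef⟩ := one_lt_card.1 h1
  have key : ∀ v, (e.1 = v ∨ e.2 = v) → ¬ (f.1 = v ∨ f.2 = v) →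
      0 < edgeDeg E v ∧ edgeDeg E v < E.card := by
    intro v hv hv'
    refine ⟨card_pos.2 ⟨e, by simp [he, hv]⟩, card_lt_card ?_⟩
    refine ⟨filter_subset _ _, fun h => hv' ?_⟩
    exact (mem_filter.1 (h hf)).2
  by_cases h1 : f.1 = e.1 ∨ f.2 = e.1
  · refine ⟨e.2, key _ (Or.inr rfl) fun h2 => ?_⟩
    have := hE e he
    have := hE f hf
    rcases h1 with h1 | h1 <;> rcases h2 with h2 | h2
    · rw [h1] at h2; exact absurd h2 (hE e he).ne
    · exact hef (Prod.ext h1.symm h2.symm)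
    · rw [h1, h2] at this; exact lt_asymm this (hE e he)
    · rw [h1] at h2; exact absurd h2 (hE e he).ne
  · exact ⟨e.1, key _ (Or.inl rfl) h1⟩

lemma avg_perm_symm_apply (f : Fin m → ℝ) (k : Fin m) :
    ((m.factorial : ℝ))⁻¹ * ∑ σ : Equiv.Perm (Fin m), f (σ.symm k) = (m : ℝ)⁻¹ * ∑ v, f v := by
  have h1 : ∀ k', ∑ σ : Equiv.Perm (Fin m), f (σ.symm k') =
      ∑ σ : Equiv.Perm (Fin m), f (σ.symm k) := by
    intro k'
    refine Fintype.sum_equiv (Equiv.mulLeft (Equiv.swap k k')) _ _ fun σ => ?_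
    simp [Equiv.Perm.mul_def]
  have h2 : (m : ℝ) * ∑ σ : Equiv.Perm (Fin m), f (σ.symm k) = m.factorial * ∑ v, f v := by
    calc (m : ℝ) * ∑ σ : Equiv.Perm (Fin m), f (σ.symm k)
        = ∑ k', ∑ σ : Equiv.Perm (Fin m), f (σ.symm k') := by
          rw [sum_congr rfl fun k' _ => h1 k']; simp
      _ = ∑ σ : Equiv.Perm (Fin m), ∑ v, f v := by
          rw [sum_comm]
          exact sum_congr rfl fun σ _ => Equiv.sum_comp σ.symm f
      _ = _ := by simp [Fintype.card_perm]
  have hm : (m : ℝ) ≠ 0 := by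
    have := k.pos; positivity
  have hf : (m.factorial : ℝ) ≠ 0 := by positivity
  field_simp
  linarith

end Degrees

section SpecialWeights

variable {m : ℕ} {E : Finset (Fin m × Fin m)}

lemma symProd_const {W : Fin m → Fin m → ℝ} {t : ℝ}
    (hE : ∀ e ∈ E, e.1 < e.2) (hW : ∀ i j, i ≠ j → W i j = t) : symProd E W id = t ^ E.card := by
  have : ∀ σ : Equiv.Perm (Fin m), edgeProd E W (fun i => id (σ i)) = t ^ E.card := by
    intro σ
    simp only [edgeProd, id]
    rw [prod_congr rfl (g := fun _ => t) (fun e he => hW _ _ fun h =>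
      (hE e he).ne (σ.injective h)), prod_const]
  rw [symProd, sum_congr rfl fun σ _ => this σ]
  have hf : (m.factorial : ℝ) ≠ 0 := by positivity
  simp [Fintype.card_perm, hf]

lemma symProd_one_special {W : Fin m → Fin m → ℝ} {s t : ℝ} (hE : ∀ e ∈ E, e.1 < e.2) (k : Fin m)
    (hs : ∀ i j, i ≠ j → (i = k ∨ j = k) → W i j = s)
    (ht : ∀ i j, i ≠ j → i ≠ k → j ≠ k → W i j = t) :
    symProd E W id = (m : ℝ)⁻¹ * ∑ v, s ^ edgeDeg E v * t ^ (E.card - edgeDeg E v) := by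
  rw [← avg_perm_symm_apply (fun v => s ^ edgeDeg E v * t ^ (E.card - edgeDeg E v)) k, symProd]
  congr 1
  refine sum_congr rfl fun σ _ => ?_
  rw [edgeProd, ← prod_filter_mul_prod_filter_not E
    (fun e => e.1 = σ.symm k ∨ e.2 = σ.symm k)]
  congr 1
  · rw [edgeDeg, ← prod_const]
    refine prod_congr rfl fun e he => hs _ _ ?_ ?_
    · exact fun h => (hE e (mem_filter.1 he).1).ne (σ.injective h)
    · simpa [Equiv.eq_symm_apply] using (mem_filter.1 he).2
  · have : E.card - edgeDeg E (σ.symm k)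
        = (E.filter fun e => ¬ (e.1 = σ.symm k ∨ e.2 = σ.symm k)).card := by
      rw [edgeDeg, ← card_filter_add_card_filter_not (s := E)
        (fun e => e.1 = σ.symm k ∨ e.2 = σ.symm k)]
      omega
    rw [this, ← prod_const]
    refine prod_congr rfl fun e he => ?_
    have := (mem_filter.1 he).2
    simp only [Equiv.eq_symm_apply, not_or] at this
    exact ht _ _ (fun h => (hE e (mem_filter.1 he).1).ne (σ.injective h)) this.1 this.2

lemma eq_of_sum_pow_mul_pow {κ : Type*} [Fintype κ] (n : κ → ℕ) {c : ℕ} (hn : ∀ i, n i ≤ c)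
    (hpos : ∃ i, 0 < n i) {p q : ℝ} (hp : 0 < p) (hq : 0 ≤ q)
    (h : ∑ i, q ^ n i * p ^ (c - n i) = ∑ _i : κ, p ^ c) : q = p := by
  have hpc : ∀ i, p ^ c = p ^ n i * p ^ (c - n i) := fun i => by
    rw [← pow_add, Nat.add_sub_cancel' (hn i)]
  obtain ⟨j, hj⟩ := hpos
  rcases lt_trichotomy q p with hlt | heq | hlt
  · refine absurd h (ne_of_lt (sum_lt_sum (fun i _ => ?_) ⟨j, mem_univ _, ?_⟩))
    · rw [hpc i]; gcongr
    · rw [hpc j]; gcongr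
  · exact heq
  · refine absurd h (ne_of_gt (sum_lt_sum (fun i _ => ?_) ⟨j, mem_univ _, ?_⟩))
    · rw [hpc i]; gcongr
    · rw [hpc j]; gcongr

lemma eq_of_symProd_two_special {W : Fin m → Fin m → ℝ} {p q : ℝ} (hE : ∀ e ∈ E, e.1 < e.2)
    (hne : E.Nonempty) (hp : 0 < p) (hq : 0 ≤ q) {k l : Fin m} (hkl : k ≠ l) (hkl' : W k l = q)
    (hlk : W l k = q) (ht : ∀ i j, i ≠ j → ¬ (i = k ∧ j = l) → ¬ (i = l ∧ j = k) → W i j = p)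
    (h : symProd E W id = p ^ E.card) : q = p := by
  let hit : Equiv.Perm (Fin m) → Fin m × Fin m → Prop := fun σ e =>
    (σ e.1 = k ∧ σ e.2 = l) ∨ (σ e.1 = l ∧ σ e.2 = k)
  classical
  refine eq_of_sum_pow_mul_pow (fun σ : Equiv.Perm (Fin m) => (E.filter (hit σ)).card)
    (c := E.card) (fun σ => card_filter_le _ _) ?_ hp hq ?_
  · obtain ⟨e, he⟩ := hne
    have he' := (hE e he).ne
    refine ⟨Equiv.swap e.1 k * Equiv.swap (Equiv.swap e.1 k l) e.2, card_pos.2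
      ⟨e, mem_filter.2 ⟨he, Or.inl ⟨?_, ?_⟩⟩⟩⟩
    · rw [Equiv.Perm.mul_apply, Equiv.swap_apply_of_ne_of_ne _ he', Equiv.swap_apply_left]
      intro h
      have := congrArg (Equiv.swap e.1 k) h
      simp at this
      exact hkl this
    · simp
  · have hf : (m.factorial : ℝ) ≠ 0 := by positivity
    have h' : ∑ σ : Equiv.Perm (Fin m), edgeProd E W (fun i => id (σ i))
        = ∑ _σ : Equiv.Perm (Fin m), p ^ E.card := by
      rw [symProd, inv_mul_eq_iff_eq_mul₀ hf] at h
      rw [h]; simp [Fintype.card_perm]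
    rw [← h']
    refine sum_congr rfl fun σ _ => ?_
    rw [edgeProd, ← prod_filter_mul_prod_filter_not E (hit σ)]
    congr 1
    · rw [← prod_const]
      refine prod_congr rfl fun e he => ?_
      rcases (mem_filter.1 he).2 with h | h
      · simp [h.1, h.2, hkl']
      · simp [h.1, h.2, hlk]
    · have : E.card - (E.filter (hit σ)).card = (E.filter fun e => ¬ hit σ e).card := by
        rw [← card_filter_add_card_filter_not (s := E) (hit σ)]
        omega
      rw [this, ← prod_const]
      refine prod_congr rfl fun e he => ?_
      have h := (mem_filter.1 he).2
      simp only [hit, not_or] at h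
      exact (ht _ _ (fun h => (hE e (mem_filter.1 he).1).ne (σ.injective h)) h.1 h.2).symm

end SpecialWeights

lemma exists_seq_of_eventually {ι : Type*} {m : ℕ} (T : Fin m → Filter ι) [∀ i, (T i).NeBot]
    (S : Fin m → ι → Prop) (R : Fin m → Fin m → ι → ι → Prop) (hS : ∀ i, ∀ᶠ x in T i, S i x)
    (hR : ∀ i j, i < j → ∀ᶠ x in T i, ∀ᶠ y in T j, R i j x y) :
    ∃ x : Fin m → ι, (∀ i, S i (x i)) ∧ ∀ i j, i < j → R i j (x i) (x j) := by
  have key : ∀ n ≤ m, ∃ x : Fin m → ι, (∀ i : Fin m, i.val < n → S i (x i)) ∧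
      (∀ i j : Fin m, j.val < n → i < j → R i j (x i) (x j)) ∧
      (∀ i j : Fin m, i.val < n → i < j → ∀ᶠ y in T j, R i j (x i) y) := by
    intro n
    induction n with
    | zero =>
      intro _
      choose x hx using fun i => (hS i).exists
      exact ⟨x, by simp, by simp, by simp⟩
    | succ n ih =>
      intro hn
      obtain ⟨x, h1, h2, h3⟩ := ih (by omega)
      let k : Fin m := ⟨n, by omega⟩
      have e1 : ∀ᶠ y in T k, ∀ i, i < k → R i k (x i) y := by
        rw [eventually_all]
        intro i
        by_cases hi : i < k
        · simpa [hi] using h3 i k hi hi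
        · simp [hi]
      have e2 : ∀ᶠ y in T k, ∀ j, k < j → ∀ᶠ z in T j, R k j y z := by
        rw [eventually_all]
        intro j
        by_cases hj : k < j
        · simpa [hj] using hR k j hj
        · simp [hj]
      obtain ⟨y, hy0, hy1, hy2⟩ := ((hS k).and (e1.and e2)).exists
      have hu : ∀ i : Fin m, i.val < n → Function.update x k y i = x i := fun i hi =>
        Function.update_of_ne (fun h => by simp [h, k] at hi) _ _
      have hcase : ∀ i : Fin m, i.val < n + 1 → i.val < n ∨ i = k := fun i hi => by
        rcases Nat.lt_succ_iff_lt_or_eq.1 hi with h | h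
        · exact Or.inl h
        · exact Or.inr (Fin.ext h)
      refine ⟨Function.update x k y, fun i hi => ?_, fun i j hj hij => ?_, fun i j hi hij => ?_⟩
      · rcases hcase i hi with h | rfl
        · rw [hu i h]; exact h1 i h
        · simpa using hy0
      · rcases hcase j hj with h | rfl
        · rw [hu j h, hu i (lt_trans hij h)]; exact h2 i j h hij
        · rw [hu i hij, Function.update_self]; exact hy1 i hij
      · rcases hcase i hi with h | rfl
        · rw [hu i h]; exact h3 i j h hij
        · simpa using hy2 j hij
  obtain ⟨x, h1, h2, -⟩ := key m le_rfl
  exact ⟨x, fun i => h1 i i.2, fun i j => h2 i j j.2⟩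

section Limits

variable {m : ℕ} {E : Finset (Fin m × Fin m)} {ι : Type*}

lemma symProd_congr {α β : Type*} {A : α → α → ℝ} {B : β → β → ℝ} {x : Fin m → α}
    {y : Fin m → β} (hE : ∀ e ∈ E, e.1 < e.2)
    (h : ∀ i j, i ≠ j → A (x i) (x j) = B (y i) (y j)) : symProd E A x = symProd E B y := by
  rw [symProd, symProd]
  congr 1
  refine sum_congr rfl fun σ _ => prod_congr rfl fun e he => h _ _ fun h => ?_
  exact (hE e he).ne (σ.injective h)

lemma continuous_symProd : Continuous fun W : Fin m → Fin m → ℝ => symProd E W id := by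
  unfold symProd edgeProd
  fun_prop

/-- If the identity `symProd = c + average of L` holds on injective tuples then it holds for the
iterated limits of the weights. -/
lemma symProd_limit (hE : ∀ e ∈ E, e.1 < e.2) {D : ι → ι → ℝ} (hD : ∀ x y, D x y = D y x)
    {L : ι → ℝ} {c : ℝ}
    (h : ∀ x : Fin m → ι, Function.Injective x → symProd E D x = c + (m : ℝ)⁻¹ * ∑ i, L (x i))
    (T : Fin m → Ultrafilter ι) {w : ι → Fin m → ℝ} {W : Fin m → Fin m → ℝ}
    {ℓ : Fin m → ℝ} (hℓ : ∀ i, Tendsto L (T i) (nhds (ℓ i)))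
    (hw : ∀ x i j, i < j → Tendsto (D x) (T j) (nhds (w x j)))
    (hW : ∀ i j, i < j → Tendsto (fun x => w x j) (T i) (nhds (W i j)))
    (hWs : ∀ i j, W i j = W j i)
    (hne : ∀ i j, i < j → ∀ᶠ x in (T i : Filter ι), ∀ᶠ y in (T j : Filter ι), x ≠ y) :
    symProd E W id = c + (m : ℝ)⁻¹ * ∑ i, ℓ i := by
  let C : Set ((Fin m → Fin m → ℝ) × (Fin m → ℝ)) :=
    {A | symProd E A.1 id = c + (m : ℝ)⁻¹ * ∑ i, A.2 i}
  have hC : IsClosed C :=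
    isClosed_eq (continuous_symProd.comp continuous_fst) (by fun_prop)
  suffices (W, ℓ) ∈ C from this
  rw [← hC.closure_eq, Metric.mem_closure_iff]
  intro ε hε
  obtain ⟨x, hx1, hx2⟩ := exists_seq_of_eventually (fun i => (T i : Filter ι))
    (fun i x => dist (ℓ i) (L x) < ε / 2)
    (fun i j x y => x ≠ y ∧ dist (W i j) (D x y) < ε / 2)
    (fun i => by
      simpa only [dist_comm] using (Metric.tendsto_nhds.1 (hℓ i)) (ε / 2) (half_pos hε))
    (fun i j hij => by
      filter_upwards [hne i j hij, Metric.tendsto_nhds.1 (hW i j hij) (ε / 4) (by positivity)]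
        with x hx1 hx2
      filter_upwards [hx1, Metric.tendsto_nhds.1 (hw x i j hij) (ε / 4) (by positivity)]
        with y hy1 hy2
      refine ⟨hy1, ?_⟩
      rw [dist_comm]
      calc _ ≤ dist (D x y) (w x j) + dist (w x j) (W i j) := dist_triangle _ _ _
        _ < ε / 4 + ε / 4 := add_lt_add hy2 hx2
        _ = ε / 2 := by ring)
  have hinj : Function.Injective x := by
    intro i j hij
    by_contra hne
    rcases lt_or_gt_of_ne hne with h | h
    · exact (hx2 i j h).1 hij
    · exact (hx2 j i h).1 hij.symm
  let A : Fin m → Fin m → ℝ := fun i j => if i = j then W i j else D (x i) (x j)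
  refine ⟨(A, fun i => L (x i)), ?_, ?_⟩
  · change symProd E A id = c + (m : ℝ)⁻¹ * ∑ i, L (x i)
    rw [← h x hinj]
    exact symProd_congr hE fun i j hij => by simp [A, hij]
  · rw [Prod.dist_eq]
    refine lt_of_le_of_lt (max_le ?_ ?_) (half_lt_self hε)
    · refine (dist_pi_le_iff (half_pos hε).le).2 fun i => (dist_pi_le_iff (half_pos hε).le).2
        fun j => ?_
      rcases lt_trichotomy i j with h | h | h
      · simpa [A, h.ne] using (hx2 i j h).2.le
      · simp [A, h, (half_pos hε).le]
      · simpa [A, h.ne', hWs i j, hD (x i)] using (hx2 j i h).2.le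
    · exact (dist_pi_le_iff (half_pos hε).le).2 fun i => (hx1 i).le

lemma Ultrafilter.exists_tendsto_of_mem_Icc (U : Ultrafilter ι) {f : ι → ℝ} {a b : ℝ}
    (hf : ∀ x, f x ∈ Set.Icc a b) : ∃ l ∈ Set.Icc a b, Tendsto f U (nhds l) := by
  obtain ⟨l, hl, h⟩ := isCompact_Icc.ultrafilter_le_nhds (U.map f)
    (by
      rw [Ultrafilter.coe_map, le_principal_iff]
      exact mem_map.2 (mem_of_superset univ_mem fun x _ => hf x))
  exact ⟨l, hl, h⟩

lemma eventually_ne_of_le_cofinite {U : Filter ι} (hU : U ≤ cofinite) (x : ι) :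
    ∀ᶠ y in U, x ≠ y := by
  have : ∀ᶠ y in cofinite, y ≠ x := by simp
  exact (this.filter_mono hU).mono fun y hy => hy.symm

variable (hE : ∀ e ∈ E, e.1 < e.2) (h1 : 1 < E.card) {D : ι → ι → ℝ}
  (hD : ∀ x y, D x y = D y x) (hD01 : ∀ x y, D x y ∈ Set.Icc 0 1)

include hE h1 hD hD01

/-- Along nonprincipal ultrafilters the correction term `L` has only one limit. -/
lemma limit_correction_unique {L : ι → ℝ} {c : ℝ}
    (h : ∀ x : Fin m → ι, Function.Injective x → symProd E D x = c + (m : ℝ)⁻¹ * ∑ i, L (x i))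
    {U V : Ultrafilter ι} (hU : (U : Filter ι) ≤ cofinite) (hV : (V : Filter ι) ≤ cofinite)
    {a b : ℝ} (ha : Tendsto L U (nhds a)) (hb : Tendsto L V (nhds b)) : a = b := by
  have hm : 1 < m := by
    obtain ⟨v, hv⟩ := exists_edgeDeg_between hE h1
    obtain ⟨e, he⟩ := card_pos.1 hv.1
    have := hE e (mem_filter.1 he).1
    omega
  have hm0 : (m : ℝ) ≠ 0 := by positivity
  choose wU hwU hwU' using fun x => U.exists_tendsto_of_mem_Icc (hD01 x)
  choose wV hwV hwV' using fun x => V.exists_tendsto_of_mem_Icc (hD01 x)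
  obtain ⟨u, hu, hu'⟩ := U.exists_tendsto_of_mem_Icc hwU
  obtain ⟨s, hs, hs'⟩ := U.exists_tendsto_of_mem_Icc hwV
  obtain ⟨t, ht, ht'⟩ := V.exists_tendsto_of_mem_Icc hwV
  have hfirst : ∀ j : Fin m, ∀ i, i < j → j ≠ ⟨0, by omega⟩ := by
    intro j i hij h; rw [h] at hij; exact absurd hij (by simp [Fin.lt_def])
  have hlast : ∀ i : Fin m, ∀ j, i < j → i ≠ ⟨m - 1, by omega⟩ := by
    intro i j hij h; rw [h] at hij; have := j.2; simp [Fin.lt_def] at hij; omega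
  have eU : u ^ E.card = c + a := by
    rw [← symProd_const (E := E) (W := fun _ _ => u) hE fun _ _ _ => rfl]
    rw [symProd_limit hE hD h (fun _ => U) (w := fun x _ => wU x) (ℓ := fun _ => a)
      (fun _ => ha) (fun x _ _ _ => hwU' x) (fun _ _ _ => hu') (fun _ _ => rfl)
      (fun _ _ _ => Eventually.of_forall fun x => eventually_ne_of_le_cofinite hU x)]
    simp [hm0]
  have eV : t ^ E.card = c + b := by
    rw [← symProd_const (E := E) (W := fun _ _ => t) hE fun _ _ _ => rfl]
    rw [symProd_limit hE hD h (fun _ => V) (w := fun x _ => wV x) (ℓ := fun _ => b)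
      (fun _ => hb) (fun x _ _ _ => hwV' x) (fun _ _ _ => ht') (fun _ _ => rfl)
      (fun _ _ _ => Eventually.of_forall fun x => eventually_ne_of_le_cofinite hV x)]
    simp [hm0]
  have sum_special : ∀ (k : Fin m) (x y : ℝ), ∑ i, (if i = k then x else y) = x + (m - 1) * y := by
    intro k x y
    rw [← add_sum_erase _ _ (mem_univ k), sum_congr rfl (g := fun _ => y)
      (fun i hi => by simp [(mem_erase.1 hi).1])]
    simp [Nat.cast_sub hm.le]
  have e1 : ∑ v, (s ^ edgeDeg E v * t ^ (E.card - edgeDeg E v) - t ^ E.card)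
      = u ^ E.card - t ^ E.card := by
    let k : Fin m := ⟨0, by omega⟩
    have hW := symProd_one_special (E := E) (s := s) (t := t)
      (W := fun i j => if i = k ∨ j = k then s else t) hE k (fun i j _ h => by simp [h])
      (fun i j _ h h' => by simp [h, h'])
    rw [symProd_limit hE hD h
      (fun i => if i = k then U else V) (w := fun x _ => wV x)
      (ℓ := fun i => if i = k then a else b) ?_ ?_ ?_ ?_ ?_, sum_special] at hW
    · rw [sum_sub_distrib, eU, eV]
      simp only [sum_const, card_univ, Fintype.card_fin, nsmul_eq_mul]
      field_simp at hW
      rw [← hW]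
      rw [eV] at *
      ring
    · intro i; split_ifs <;> assumption
    · intro x i j hij; simpa [k, hfirst j i hij] using hwV' x
    · intro i j hij
      have := hfirst j i hij
      by_cases hi : i = k
      · simpa [hi] using hs'
      · simpa [hi, k, this] using ht'
    · intro i j; simp [or_comm]
    · intro i j _
      refine Eventually.of_forall fun x => ?_
      split_ifs
      · exact eventually_ne_of_le_cofinite hU x
      · exact eventually_ne_of_le_cofinite hV x
  have e2 : ∑ v, (s ^ edgeDeg E v * u ^ (E.card - edgeDeg E v) - u ^ E.card)
      = t ^ E.card - u ^ E.card := by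
    let k : Fin m := ⟨m - 1, by omega⟩
    have hW := symProd_one_special (E := E) (s := s) (t := u)
      (W := fun i j => if i = k ∨ j = k then s else u) hE k (fun i j _ h => by simp [h])
      (fun i j _ h h' => by simp [h, h'])
    rw [symProd_limit hE hD h
      (fun i => if i = k then V else U) (w := fun x j => if j = k then wV x else wU x)
      (ℓ := fun i => if i = k then b else a) ?_ ?_ ?_ ?_ ?_, sum_special] at hW
    · rw [sum_sub_distrib, eU, eV]
      simp only [sum_const, card_univ, Fintype.card_fin, nsmul_eq_mul]
      field_simp at hW
      rw [← hW]
      rw [eV] at *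
      ring
    · intro i; split_ifs <;> assumption
    · intro x i j hij
      split_ifs
      · exact hwV' x
      · exact hwU' x
    · intro i j hij
      have := hlast i j hij
      by_cases hj : j = k
      · simpa [hj, k, this] using hs'
      · simpa [hj, k, this] using hu'
    · intro i j; simp [or_comm]
    · intro i j _
      refine Eventually.of_forall fun x => ?_
      split_ifs
      · exact eventually_ne_of_le_cofinite hV x
      · exact eventually_ne_of_le_cofinite hU x
  have := pow_eq_pow_of_degree_identities (edgeDeg E) (fun i => edgeDeg_le i) (sum_edgeDeg hE)
    (exists_edgeDeg_between hE h1) hu.1 hs.1 ht.1 e1 e2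
  linarith

end Limits

section Compactness

variable {m : ℕ} {E : Finset (Fin m × Fin m)} {ι : Type*} 

/-- A symmetric array on an infinite set whose symmetrized products are all `p ^ e` is
constant off the diagonal. -/
lemma eq_const_of_symProd_eq [Infinite ι] {D : ι → ι → ℝ} (hE : ∀ e ∈ E, e.1 < e.2)
    (hne : E.Nonempty) (hD : ∀ x y, D x y = D y x) (hD01 : ∀ x y, D x y ∈ Set.Icc 0 1) {p : ℝ}
    (hp : 0 < p) (h : ∀ x : Fin m → ι, Function.Injective x → symProd E D x = p ^ E.card)
    {a b : ι} (hab : a ≠ b) : D a b = p := by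
  obtain ⟨e₀, he₀⟩ := hne
  have hm : 1 < m := by have := hE e₀ he₀; omega
  have hm0 : (m : ℝ) ≠ 0 := by positivity
  have h' : ∀ x : Fin m → ι, Function.Injective x →
      symProd E D x = p ^ E.card + (m : ℝ)⁻¹ * ∑ i, (fun _ => (0 : ℝ)) (x i) := by
    simpa using h
  let U : Ultrafilter ι := hyperfilter ι
  have hU : (U : Filter ι) ≤ cofinite := hyperfilter_le_cofinite
  have hL : ∀ V : Ultrafilter ι, Tendsto (fun _ : ι => (0 : ℝ)) V (nhds 0) :=
    fun V => tendsto_const_nhds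
  choose w hw hw' using fun x => U.exists_tendsto_of_mem_Icc (hD01 x)
  obtain ⟨u, hu, hu'⟩ := U.exists_tendsto_of_mem_Icc hw
  have hup : u = p := by
    have : u ^ E.card = p ^ E.card := by
      rw [← symProd_const (E := E) (W := fun _ _ => u) hE fun _ _ _ => rfl]
      rw [symProd_limit hE hD h' (fun _ => U) (w := fun x _ => w x) (ℓ := fun _ => 0)
        (fun _ => hL _) (fun x _ _ _ => hw' x) (fun _ _ _ => hu') (fun _ _ => rfl)
        (fun _ _ _ => Eventually.of_forall fun x => eventually_ne_of_le_cofinite hU x)]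
      simp
    exact (pow_left_inj₀ hu.1 hp.le (card_pos.2 ⟨e₀, he₀⟩).ne').1 this
  subst hup
  have hpos : ∀ j : Fin m, ∀ i, i < j → j.val ≠ 0 := by
    intro j i hij h; simp [Fin.lt_def, h] at hij
  have hwp : ∀ a, w a = u := by
    intro a
    let k : Fin m := ⟨0, by omega⟩
    have hW := symProd_one_special (E := E) (s := w a) (t := u)
      (W := fun i j => if i = k ∨ j = k then w a else u) hE k (fun i j _ h => by simp [h])
      (fun i j _ h h' => by simp [h, h'])
    rw [symProd_limit hE hD h' (fun i => if i = k then pure a else U) (w := fun x _ => w x)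
      (ℓ := fun i => 0) (fun _ => hL _) ?_ ?_ ?_ ?_] at hW
    · refine eq_of_sum_pow_mul_pow (edgeDeg E) (c := E.card) (fun v => edgeDeg_le v)
        ⟨e₀.1, card_pos.2 ⟨e₀, by simp [he₀]⟩⟩ hp (hw a).1 ?_
      simp only [sum_const, smul_zero, mul_zero, add_zero] at hW
      rw [eq_inv_mul_iff_mul_eq₀ hm0] at hW
      simp [← hW]
    · intro x i j hij
      have : j ≠ k := fun h => hpos j i hij (by rw [h])
      simpa [this] using hw' x
    · intro i j hij
      have : j ≠ k := fun h => hpos j i hij (by rw [h])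
      by_cases hi : i = k
      · simpa [hi] using tendsto_pure_nhds _ _
      · simpa [hi, this] using hu'
    · intro i j; simp [or_comm]
    · intro i j hij
      have : j ≠ k := fun h => hpos j i hij (by rw [h])
      refine Eventually.of_forall fun x => ?_
      simpa [this] using eventually_ne_of_le_cofinite hU x
  let k : Fin m := ⟨0, by omega⟩
  let l : Fin m := ⟨1, by omega⟩
  have hkl : k ≠ l := by simp [k, l]
  refine eq_of_symProd_two_special (E := E) hE ⟨e₀, he₀⟩ hp (hD01 a b).1 hkl
    (W := fun i j => if (i = k ∧ j = l) ∨ (i = l ∧ j = k) then D a b else u) (by simp) (by simp)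
    (fun i j _ h h' => by simp only [h, h', or_self, if_false]) ?_
  rw [symProd_limit hE hD h' (fun i => if i = k then pure a else if i = l then pure b else U)
      (w := fun x j => if j = l then D x b else w x) (ℓ := fun i => 0) (fun _ => hL _) ?_ ?_ ?_ ?_]
  · simp
  · intro x i j hij
    have hj : j ≠ k := fun h => hpos j i hij (by rw [h])
    by_cases hjl : j = l
    · simpa [hjl, hkl.symm] using tendsto_pure_nhds _ _
    · simpa [hj, hjl] using hw' x
  · intro i j hij
    have hj : j ≠ k := fun h => hpos j i hij (by rw [h])
    by_cases hjl : j = l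
    · have hi : i = k := by
        rw [hjl] at hij; ext; simp [Fin.lt_def, l] at hij; simp [hij, k]
      simpa [hjl, hi] using tendsto_pure_nhds (fun x => D x b) a
    · simp [hj, hjl, hwp]
  · intro i j; simp only [or_comm, and_comm]
  · intro i j hij
    have hj : j ≠ k := fun h => hpos j i hij (by rw [h])
    by_cases hjl : j = l
    · have hi : i = k := by
        rw [hjl] at hij; ext; simp [Fin.lt_def, l] at hij; simp [hij, k]
      simpa [hjl, hi, hkl.symm] using hab
    · refine Eventually.of_forall fun x => ?_
      simpa [hj, hjl] using eventually_ne_of_le_cofinite hU x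

/-- Pointwise ultralimit of a sequence of arrays satisfying the identity on longer and longer
initial segments. -/
lemma exists_limit_array {c C : ℝ} {d : ℕ → ℕ → ℕ → ℝ} {L : ℕ → ℕ → ℝ}
    (hd : ∀ r x y, d r x y = d r y x) (hd01 : ∀ r x y, d r x y ∈ Set.Icc 0 1)
    (hL : ∀ r x, |L r x| ≤ C)
    (h : ∀ r (x : Fin m → ℕ), Function.Injective x → (∀ i, x i < r) →
      |symProd E (d r) x - c - (m : ℝ)⁻¹ * ∑ i, L r (x i)| ≤ 1 / (r + 1)) :
    ∃ (D : ℕ → ℕ → ℝ) (M : ℕ → ℝ), (∀ x y, D x y = D y x) ∧ (∀ x y, D x y ∈ Set.Icc 0 1) ∧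
      (∀ x, |M x| ≤ C) ∧
      (∀ x : Fin m → ℕ, Function.Injective x → symProd E D x = c + (m : ℝ)⁻¹ * ∑ i, M (x i)) ∧
      (∀ x y, Tendsto (fun r => d r x y) (hyperfilter ℕ) (nhds (D x y))) ∧
      (∀ x, Tendsto (fun r => L r x) (hyperfilter ℕ) (nhds (M x))) := by
  choose D hD hD' using fun x y =>
    (hyperfilter ℕ).exists_tendsto_of_mem_Icc (fun r => hd01 r x y)
  choose M hM hM' using fun x =>
    (hyperfilter ℕ).exists_tendsto_of_mem_Icc (fun r => abs_le.1 (hL r x))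
  refine ⟨D, M, fun x y => ?_, hD, fun x => abs_le.2 (hM x), fun x hx => ?_, hD', hM'⟩
  · refine tendsto_nhds_unique (hD' x y) ?_
    simpa only [hd _ x y] using hD' y x
  · have hle : ((hyperfilter ℕ : Ultrafilter ℕ) : Filter ℕ) ≤ atTop := by
      rw [← Nat.cofinite_eq_atTop]; exact hyperfilter_le_cofinite
    have h1 : Tendsto (fun r => symProd E (d r) x - c - (m : ℝ)⁻¹ * ∑ i, L r (x i))
        (hyperfilter ℕ) (nhds (symProd E D x - c - (m : ℝ)⁻¹ * ∑ i, M (x i))) := by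
      refine Tendsto.sub (Tendsto.sub_const ?_ c) (Tendsto.const_mul _ ?_)
      · unfold symProd edgeProd
        exact Tendsto.const_mul _ (tendsto_finsetSum _ fun σ _ =>
          tendsto_finsetProd _ fun e _ => hD' _ _)
      · exact tendsto_finsetSum _ fun i _ => hM' _
    have h2 : Tendsto (fun r => symProd E (d r) x - c - (m : ℝ)⁻¹ * ∑ i, L r (x i))
        (hyperfilter ℕ) (nhds 0) := by
      refine squeeze_zero_norm' ?_ (tendsto_one_div_add_atTop_nhds_zero_nat.mono_left hle)
      obtain ⟨B, hB⟩ := (Set.finite_range x).bddAbove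
      filter_upwards [(eventually_gt_atTop B).filter_mono hle] with r hr
      exact h r x hx fun i => lt_of_le_of_lt (hB ⟨i, rfl⟩) hr
    have := tendsto_nhds_unique h1 h2
    linarith

lemma exists_no_alternating_correction (hE : ∀ e ∈ E, e.1 < e.2) (h1 : 1 < E.card) (c C : ℝ)
    {δ : ℝ} (hδ : 0 < δ) : ∃ r : ℕ, ∃ η > 0, ∀ (d : ℕ → ℕ → ℝ) (L : ℕ → ℝ),
      (∀ x y, d x y = d y x) → (∀ x y, d x y ∈ Set.Icc 0 1) → (∀ x, |L x| ≤ C) →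
      (∀ x : Fin m → ℕ, Function.Injective x → (∀ i, x i < r) →
        |symProd E d x - c - (m : ℝ)⁻¹ * ∑ i, L (x i)| ≤ η) →
      ¬ ((∀ i < r, Even i → δ ≤ L i) ∧ (∀ i < r, Odd i → L i ≤ -δ)) := by
  by_contra! H
  choose d L hd hd01 hL h hev hodd using fun r : ℕ => H r (1 / (r + 1)) (by positivity)
  obtain ⟨D, M, hD, hD01, hMC, hDM, -, hM⟩ := exists_limit_array hd hd01 hL h
  have hlt : ∀ i, ∀ᶠ r in (hyperfilter ℕ : Filter ℕ), i < r := fun i =>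
    (eventually_gt_atTop i).filter_mono
      (by rw [← Nat.cofinite_eq_atTop]; exact hyperfilter_le_cofinite)
  have hMe : ∀ i, Even i → δ ≤ M i := fun i hi =>
    ge_of_tendsto (hM i) ((hlt i).mono fun r hr => hev r i hr hi)
  have hMo : ∀ i, Odd i → M i ≤ -δ := fun i hi =>
    le_of_tendsto (hM i) ((hlt i).mono fun r hr => hodd r i hr hi)
  let U : Ultrafilter ℕ := (hyperfilter ℕ).map (fun i => 2 * i)
  let V : Ultrafilter ℕ := (hyperfilter ℕ).map (fun i => 2 * i + 1)
  have hU : (U : Filter ℕ) ≤ cofinite :=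
    le_trans (Filter.map_mono hyperfilter_le_cofinite)
      (Function.Injective.tendsto_cofinite fun a b h => by simpa using h)
  have hV : (V : Filter ℕ) ≤ cofinite :=
    le_trans (Filter.map_mono hyperfilter_le_cofinite)
      (Function.Injective.tendsto_cofinite fun a b h => by simpa using h)
  obtain ⟨a, -, ha⟩ := U.exists_tendsto_of_mem_Icc fun i => abs_le.1 (hMC i)
  obtain ⟨b, -, hb⟩ := V.exists_tendsto_of_mem_Icc fun i => abs_le.1 (hMC i)
  have hab := limit_correction_unique hE h1 hD hD01 hDM hU hV ha hb
  have h1 : δ ≤ a := ge_of_tendsto ha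
    (Filter.eventually_map.2 (Eventually.of_forall fun i => hMe _ (even_two_mul i)))
  have h2 : b ≤ -δ := le_of_tendsto hb
    (Filter.eventually_map.2 (Eventually.of_forall fun i => hMo _ (odd_two_mul_add_one i)))
  linarith

lemma exists_weight_close (hE : ∀ e ∈ E, e.1 < e.2) (hne : E.Nonempty) {p : ℝ} (hp : 0 < p)
    {δ : ℝ} (hδ : 0 < δ) : ∃ r : ℕ, ∃ η > 0, ∀ d : ℕ → ℕ → ℝ,
      (∀ x y, d x y = d y x) → (∀ x y, d x y ∈ Set.Icc 0 1) →
      (∀ x : Fin m → ℕ, Function.Injective x → (∀ i, x i < r) →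
        |symProd E d x - p ^ E.card| ≤ η) → |d 0 1 - p| ≤ δ := by
  by_contra! H
  choose d hd hd01 h hfar using fun r : ℕ => H r (1 / (r + 1)) (by positivity)
  obtain ⟨D, M, hD, hD01, hMC, hDM, hdD, -⟩ := exists_limit_array (L := fun _ _ => 0) (C := 0)
    (c := p ^ E.card) hd hd01 (by simp) (by simpa using h)
  have hM0 : ∀ x, M x = 0 := fun x => by simpa using hMC x
  have h01 := eq_const_of_symProd_eq hE hne hD hD01 hp (by simpa [hM0] using hDM)
    (a := 0) (b := 1) (by norm_num)
  have : δ ≤ |D 0 1 - p| := ge_of_tendsto ((hdD 0 1).sub_const p).abs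
    (Eventually.of_forall fun r => (hfar r).le)
  rw [h01] at this
  simp at this
  linarith

end Compactness

section SlotElimination

lemma sum_piFinset_cons {ι : Type*} {n : ℕ} (X : Finset ι) (R : Fin n → Finset ι)
    (g : (Fin (n + 1) → ι) → ℝ) :
    ∑ x ∈ Fintype.piFinset (Fin.cons X R : Fin (n + 1) → Finset ι), g x
      = ∑ c ∈ X, ∑ r ∈ Fintype.piFinset R, g (Fin.cons c r) := by
  rw [← sum_product']
  refine (sum_nbij' (fun x : ι × (Fin n → ι) => (Fin.cons x.1 x.2 : Fin (n + 1) → ι))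
    (fun x => (x 0, Fin.tail x)) ?_ ?_ ?_ ?_ ?_).symm
  · intro x hx
    rw [mem_product] at hx
    exact Fin.cons_mem_piFinset_cons.2 hx
  · intro x hx
    rw [Fin.mem_piFinset_iff_zero_tail] at hx
    exact mem_product.2 hx
  · intro x _; simp
  · intro x _; simp
  · intro x _; rfl

lemma eq_zero_of_sum_subsets_eq_zero {ι : Type*} [DecidableEq ι] {k : ℕ} (hk : 1 ≤ k)
    {Y : Finset ι} (hY : k + 1 ≤ Y.card)
    {G : ι → ℝ} (h : ∀ S ⊆ Y, S.card = k → ∑ c ∈ S, G c = 0) {c : ι} (hc : c ∈ Y) : G c = 0 := by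
  have hconst : ∀ c' ∈ Y, G c' = G c := by
    intro c' hc'
    rcases eq_or_ne c' c with rfl | hne
    · rfl
    have h2 : k - 1 ≤ ((Y.erase c).erase c').card := by
      rw [card_erase_of_mem (mem_erase.2 ⟨hne, hc'⟩), card_erase_of_mem hc]; omega
    obtain ⟨S, hS, hSc⟩ := exists_subset_card_eq h2
    have hcS : c ∉ S := fun h => by simpa using hS h
    have hcS' : c' ∉ S := fun h => by simpa using hS h
    have hSY : S ⊆ Y := fun x hx => mem_of_mem_erase (mem_of_mem_erase (hS hx))
    have e1 := h (insert c S) (insert_subset hc hSY) (by rw [card_insert_of_notMem hcS]; omega)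
    have e2 := h (insert c' S) (insert_subset hc' hSY) (by rw [card_insert_of_notMem hcS']; omega)
    rw [sum_insert hcS] at e1
    rw [sum_insert hcS'] at e2
    linarith
  obtain ⟨S, hS, hSc⟩ := exists_subset_card_eq (show k ≤ Y.card by omega)
  have := h S hS hSc
  rw [sum_congr rfl fun x hx => hconst x (hS hx), sum_const, hSc, nsmul_eq_mul] at this
  have hk0 : (k : ℝ) ≠ 0 := by positivity
  simpa [hk0] using this

lemma card_biUnion_of_card_eq {ι : Type*} [DecidableEq ι] {n k : ℕ} {R : Fin n → Finset ι}
    (hR : Pairwise fun i j => Disjoint (R i) (R j)) (hk : ∀ i, (R i).card = k) :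
    (univ.biUnion R).card = n * k := by
  rw [card_biUnion fun i _ j _ hij => hR hij]
  simp [hk]

lemma pairwise_disjoint_cons {ι : Type*} {n : ℕ} {X : Finset ι} {R : Fin n → Finset ι}
    (hX : ∀ i, Disjoint X (R i)) (hR : Pairwise fun i j => Disjoint (R i) (R j)) :
    Pairwise fun i j => Disjoint ((Fin.cons X R : Fin (n + 1) → Finset ι) i)
      ((Fin.cons X R : Fin (n + 1) → Finset ι) j) := by
  intro i j
  refine Fin.cases ?_ (fun i => ?_) i <;> refine Fin.cases ?_ (fun j => ?_) j <;> intro hij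
  · exact absurd rfl hij
  · simpa using hX j
  · simpa using (hX i).symm
  · simpa using hR fun h => hij (by rw [h])

variable {ι : Type*} [Fintype ι] [DecidableEq ι]

/-- A function of `n` distinct points outside `Z` whose sums over disjoint `k`-sets vanish
is itself zero. -/
lemma eq_zero_of_sum_piFinset_eq_zero {k : ℕ} (hk : 1 ≤ k) : ∀ {n : ℕ} (Z : Finset ι)
    (_ : Z.card + n * k + 1 ≤ Fintype.card ι) (g : (Fin n → ι) → ℝ)
    (_ : ∀ R : Fin n → Finset ι, (Pairwise fun i j => Disjoint (R i) (R j)) →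
      (∀ i, (R i).card = k) → (∀ i, Disjoint (R i) Z) → ∑ x ∈ Fintype.piFinset R, g x = 0)
    {x : Fin n → ι} (_ : Function.Injective x) (_ : ∀ i, x i ∉ Z), g x = 0 := by
  intro n
  induction n with
  | zero =>
    intro Z _ g h x _ _
    have := h (fun _ => ∅) (fun i => i.elim0) (fun i => i.elim0) (fun i => i.elim0)
    have hx : Fintype.piFinset (fun _ : Fin 0 => (∅ : Finset ι)) = {x} := by
      ext y; simp [eq_iff_true_of_subsingleton]
    rwa [hx, sum_singleton] at this
  | succ n ih =>
    intro Z hZ g h x hx hxZ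
    rw [← Fin.cons_self_tail x]
    refine ih (insert (x 0) Z) ?_ (fun r => g (Fin.cons (x 0) r)) ?_ ?_ ?_
    · rw [card_insert_of_notMem (hxZ 0)]
      nlinarith
    · intro R hR hRk hRZ
      refine eq_zero_of_sum_subsets_eq_zero hk (Y := univ \ (Z ∪ univ.biUnion R))
        (G := fun c => ∑ r ∈ Fintype.piFinset R, g (Fin.cons c r)) ?_ ?_ ?_
      · rw [card_sdiff_of_subset (subset_univ _), card_univ]
        have := card_union_le Z (univ.biUnion R)
        rw [card_biUnion_of_card_eq hR hRk] at this
        have : (n + 1) * k = n * k + k := by ring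
        omega
      · intro S hS hSk
        rw [← sum_piFinset_cons]
        have hS' : ∀ c ∈ S, c ∉ Z ∧ ∀ i, c ∉ R i := by
          intro c hc; simpa using hS hc
        refine h _ (pairwise_disjoint_cons (fun i => ?_) hR) (fun i => ?_) (fun i => ?_)
        · exact disjoint_left.2 fun c hc => (hS' c hc).2 i
        · refine Fin.cases ?_ (fun i => ?_) i
          · simpa using hSk
          · simpa using hRk i
        · refine Fin.cases ?_ (fun i => ?_) i
          · simpa using disjoint_left.2 fun c hc => (hS' c hc).1
          · simpa using disjoint_of_subset_right (subset_insert _ _) (hRZ i)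
      · simp only [Finset.mem_sdiff, mem_univ, true_and, mem_union, mem_biUnion, not_or, not_exists]
        exact ⟨hxZ 0, fun i hi => disjoint_left.1 (hRZ i) hi (mem_insert_self _ _)⟩
    · exact hx.comp (Fin.succ_injective n)
    · intro i
      simp only [Fin.tail, mem_insert, not_or]
      exact ⟨fun h => Fin.succ_ne_zero i (hx h), hxZ _⟩

/-- A function on tuples unchanged by replacing one entry by a fresh point is constant. -/
lemma eq_of_update_eq {n : ℕ} (Z : Finset ι) (hZ : Z.card + 3 * n ≤ Fintype.card ι)
    (g : (Fin n → ι) → ℝ)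
    (h : ∀ x : Fin n → ι, Function.Injective x → (∀ i, x i ∉ Z) → ∀ j b, b ∉ Z → (∀ i, x i ≠ b) →
      g (Function.update x j b) = g x) {x y : Fin n → ι} (hx : Function.Injective x)
    (hxZ : ∀ i, x i ∉ Z) (hy : Function.Injective y) (hyZ : ∀ i, y i ∉ Z) : g x = g y := by
  have key : ∀ x z : Fin n → ι, Function.Injective x → (∀ i, x i ∉ Z) → Function.Injective z →
      (∀ i, z i ∉ Z) → (∀ i j, x i ≠ z j) → g z = g x := by
    intro x z hx hxZ hz hzZ hxz
    have step : ∀ t ≤ n, g (fun i => if i.val < t then z i else x i) = g x := by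
      intro t
      induction t with
      | zero => intro _; simp
      | succ t ih =>
        intro ht
        rw [← ih (by omega)]
        rw [← h (fun i => if i.val < t then z i else x i) ?_ ?_ ⟨t, by omega⟩ (z ⟨t, by omega⟩)
          (hzZ _) ?_]
        · congr 1
          ext i
          by_cases hi : i = ⟨t, by omega⟩
          · subst hi; simp
          · rw [Function.update_of_ne hi]
            have : i.val ≠ t := fun h => hi (Fin.ext h)
            simp only [Nat.lt_succ_iff_lt_or_eq, this, or_false]
        · intro i j hij
          dsimp only at hij
          split_ifs at hij
          · exact hz hij
          · exact absurd hij.symm (hxz _ _)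
          · exact absurd hij (hxz _ _)
          · exact hx hij
        · intro i; split_ifs
          · exact hzZ i
          · exact hxZ i
        · intro i; split_ifs with hi
          · intro h; have := hz h; rw [this] at hi; simp at hi
          · exact hxz _ _
    simpa using step n le_rfl
  have hcard : n ≤ (univ \ (Z ∪ (univ.image x ∪ univ.image y))).card := by
    rw [card_sdiff_of_subset (subset_univ _), card_univ]
    have h1 := card_union_le Z (univ.image x ∪ univ.image y)
    have h2 := card_union_le (univ.image x) (univ.image y)
    have h3 : (univ.image x).card ≤ n := card_image_le.trans (by simp)
    have h4 : (univ.image y).card ≤ n := card_image_le.trans (by simp)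
    omega
  obtain ⟨S, hS, hSn⟩ := exists_subset_card_eq hcard
  let z : Fin n → ι := fun i => (S.equivFinOfCardEq hSn).symm i
  have hz : Function.Injective z :=
    Subtype.val_injective.comp (S.equivFinOfCardEq hSn).symm.injective
  have hzS : ∀ i, z i ∉ Z ∧ (∀ j, x j ≠ z i) ∧ ∀ j, y j ≠ z i := by
    intro i
    have := hS (show z i ∈ S from ((S.equivFinOfCardEq hSn).symm i).2)
    simpa using this
  rw [← key x z hx hxZ hz (fun i => (hzS i).1) (fun i j => (hzS j).2.1 i),
    ← key y z hy hyZ hz (fun i => (hzS i).1) (fun i j => (hzS j).2.2 i)]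

end SlotElimination

lemma exists_disjoint_subsets_card_eq {ι : Type*} [DecidableEq ι] (S : Finset ι) (n k : ℕ)
    (h : n * k ≤ S.card) : ∃ U : Fin n → Finset ι, (∀ i, U i ⊆ S) ∧
      (Pairwise fun i j => Disjoint (U i) (U j)) ∧ ∀ i, (U i).card = k := by
  induction n generalizing S with
  | zero => exact ⟨fun _ => ∅, fun i => i.elim0, fun i => i.elim0, fun i => i.elim0⟩
  | succ n ih =>
    have hk : (n + 1) * k = n * k + k := by ring
    obtain ⟨X, hX, hXk⟩ := exists_subset_card_eq (show k ≤ S.card by omega)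
    obtain ⟨U, h1, h2, h3⟩ := ih (S \ X) (by rw [card_sdiff_of_subset hX]; omega)
    refine ⟨Fin.cons X U, fun i => ?_, pairwise_disjoint_cons (fun i => ?_) h2, fun i => ?_⟩
    · refine Fin.cases ?_ (fun i => ?_) i
      · simpa using hX
      · simpa using (h1 i).trans sdiff_subset
    · exact disjoint_of_subset_right (h1 i) disjoint_sdiff
    · refine Fin.cases ?_ (fun i => ?_) i
      · simpa using hXk
      · simpa using h3 i

lemma sum_piFinset_update {ι κ : Type*} [Fintype κ] [DecidableEq κ] (U : κ → Finset ι) (i : κ)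
    (ψ : (κ → ι) → ℝ) : ∑ x ∈ Fintype.piFinset U, ∑ a ∈ U i, ψ (Function.update x i a)
      = (U i).card * ∑ x ∈ Fintype.piFinset U, ψ x := by
  have hmem : ∀ x ∈ Fintype.piFinset U, ∀ a ∈ U i,
      Function.update x i a ∈ Fintype.piFinset U := by
    intro x hx a ha
    rw [Fintype.mem_piFinset] at hx ⊢
    intro j
    rcases eq_or_ne j i with rfl | h
    · simpa using ha
    · simpa [h] using hx j
  have h : ∑ x ∈ Fintype.piFinset U ×ˢ U i, ψ (Function.update x.1 i x.2)
      = ∑ x ∈ Fintype.piFinset U ×ˢ U i, ψ x.1 := by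
    refine sum_nbij' (fun x => (Function.update x.1 i x.2, x.1 i))
      (fun x => (Function.update x.1 i x.2, x.1 i)) ?_ ?_ ?_ ?_ ?_
    · intro x hx
      rw [mem_product] at hx ⊢
      exact ⟨hmem _ hx.1 _ hx.2, Fintype.mem_piFinset.1 hx.1 i⟩
    · intro x hx
      rw [mem_product] at hx ⊢
      exact ⟨hmem _ hx.1 _ hx.2, Fintype.mem_piFinset.1 hx.1 i⟩
    · intro x _
      simp
    · intro x _
      simp
    · intro x _
      rfl
  rw [← sum_product', h, sum_product, mul_sum]
  simp

lemma sum_piFinset_apply {ι κ : Type*} [Fintype κ] [DecidableEq κ] (U : κ → Finset ι) (i : κ)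
    (φ : ι → ℝ) : ((U i).card : ℝ) * ∑ x ∈ Fintype.piFinset U, φ (x i)
      = (∏ j, ((U j).card : ℝ)) * ∑ a ∈ U i, φ a := by
  rw [← sum_piFinset_update U i fun x => φ (x i)]
  simp

section AdditiveStructure

variable {ι : Type*} [Fintype ι] [DecidableEq ι] {n k : ℕ}

lemma eq_of_cons_eq (Z : Finset ι) (hZ : Z.card + 3 * (n + 1) ≤ Fintype.card ι)
    (g : (Fin (n + 1) → ι) → ℝ) (hsymm : ∀ (σ : Equiv.Perm (Fin (n + 1))) x, g (x ∘ σ) = g x)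
    (h : ∀ (t : Fin n → ι) c b, Function.Injective t → (∀ i, t i ∉ Z) → (∀ i, t i ≠ c) →
      (∀ i, t i ≠ b) → c ∉ Z → b ∉ Z → c ≠ b → g (Fin.cons b t) = g (Fin.cons c t))
    {x y : Fin (n + 1) → ι} (hx : Function.Injective x)
    (hxZ : ∀ i, x i ∉ Z) (hy : Function.Injective y) (hyZ : ∀ i, y i ∉ Z) : g x = g y := by
  refine eq_of_update_eq Z hZ g (fun x hx hxZ j b hb hxb => ?_) hx hxZ hy hyZ
  obtain ⟨x', hx'⟩ : ∃ x', x' = x ∘ Equiv.swap 0 j := ⟨_, rfl⟩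
  have hinj : Function.Injective x' := by rw [hx']; exact hx.comp (Equiv.swap 0 j).injective
  have hne : ∀ i : Fin n, x' i.succ ≠ x' 0 := fun i h => Fin.succ_ne_zero i (hinj h)
  have e1 : Function.update x j b ∘ Equiv.swap 0 j = Fin.cons b (Fin.tail x') := by
    ext i
    refine Fin.cases ?_ (fun i => ?_) i
    · simp
    · rw [Function.comp_apply, Function.update_of_ne, Fin.cons_succ, Fin.tail, hx']
      · rfl
      · intro h
        have := congrArg (Equiv.swap 0 j) h
        simp at this
  rw [← hsymm (Equiv.swap 0 j) (Function.update x j b), e1, ← hsymm (Equiv.swap 0 j) x, ← hx',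
    ← Fin.cons_self_tail x', Fin.tail_cons]
  have hZ' : ∀ i, x' i ∉ Z := fun i => by rw [hx']; exact hxZ _
  have hb' : ∀ i, x' i ≠ b := fun i => by rw [hx']; exact hxb _
  exact h (Fin.tail x') (x' 0) b (hinj.comp (Fin.succ_injective n)) (fun i => hZ' _) hne
    (fun i => hb' _) (hZ' 0) hb (hb' 0)

omit [Fintype ι] [DecidableEq ι] in
lemma comp_perm_cons (σ : Equiv.Perm (Fin n)) (a : ι) (y : Fin n → ι) :
    ∃ τ : Equiv.Perm (Fin (n + 1)), (Fin.cons a (y ∘ σ) : Fin (n + 1) → ι)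
      = (Fin.cons a y : Fin (n + 1) → ι) ∘ τ := by
  refine ⟨Equiv.Perm.decomposeFin.symm (0, σ), ?_⟩
  ext i
  refine Fin.cases ?_ (fun i => ?_) i
  · simp
  · simp

variable {ν : (Fin (n + 2) → ι) → ℝ}
  (hsymm : ∀ (σ : Equiv.Perm (Fin (n + 2))) x, ν (x ∘ σ) = ν x)
  (hcard : Fintype.card ι = (n + 2) * k) (hk : 3 ≤ k)
  (hsum : ∀ U : Fin (n + 2) → Finset ι, (Pairwise fun i j => Disjoint (U i) (U j)) →
    (∀ i, (U i).card = k) → ∑ x ∈ Fintype.piFinset U, ν x = 0)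

include hsymm hcard hk hsum

lemma second_difference_eq_zero {a a' b b' : ι} (haa : a ≠ a') (hbb : b ≠ b') (hab : a ≠ b)
    (hab' : a ≠ b') (ha'b : a' ≠ b) (ha'b' : a' ≠ b') {r : Fin n → ι} (hr : Function.Injective r)
    (hrZ : ∀ i, r i ∉ ({a, a', b, b'} : Finset ι)) :
    ν (Fin.cons a (Fin.cons b r)) - ν (Fin.cons a' (Fin.cons b r))
      - ν (Fin.cons a (Fin.cons b' r)) + ν (Fin.cons a' (Fin.cons b' r)) = 0 := by
  have hZ : ({a, a', b, b'} : Finset ι).card = 4 := by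
    rw [card_insert_of_notMem, card_insert_of_notMem, card_pair hbb] <;> simp [*]
  refine eq_zero_of_sum_piFinset_eq_zero (k := k) (by omega) ({a, a', b, b'} : Finset ι)
    (by rw [hZ, hcard]; nlinarith)
    (fun r => ν (Fin.cons a (Fin.cons b r)) - ν (Fin.cons a' (Fin.cons b r))
      - ν (Fin.cons a (Fin.cons b' r)) + ν (Fin.cons a' (Fin.cons b' r))) ?_ hr hrZ
  intro R hR hRk hRZ
  obtain ⟨f, hf⟩ : ∃ f : ι → ι → ℝ, f = fun x y =>
    ∑ r ∈ Fintype.piFinset R, ν (Fin.cons x (Fin.cons y r)) := ⟨_, rfl⟩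
  have hfs : ∀ x y, f x y = f y x := by
    intro x y
    rw [hf]
    refine sum_congr rfl fun r _ => ?_
    rw [← hsymm (Equiv.swap 0 1)]
    congr 1
    ext i
    refine Fin.cases ?_ (fun i => Fin.cases ?_ (fun i => ?_) i) i
    · simp
    · rw [Function.comp_apply, Fin.succ_zero_eq_one, Equiv.swap_apply_right]
      rfl
    · rw [Function.comp_apply, Equiv.swap_apply_of_ne_of_ne] <;> simp [Fin.ext_iff]
  have hfsum : ∀ X Y : Finset ι, Disjoint X Y → X.card = k → Y.card = k →
      (∀ i, Disjoint X (R i)) → (∀ i, Disjoint Y (R i)) → ∑ x ∈ X, ∑ y ∈ Y, f x y = 0 := by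
    intro X Y hXY hX hY hXR hYR
    have := hsum (Fin.cons X (Fin.cons Y R))
      (pairwise_disjoint_cons (fun i => Fin.cases (by simpa using hXY)
        (fun i => by simpa using hXR i) i) (pairwise_disjoint_cons hYR hR))
      (fun i => Fin.cases (by simpa using hX) (fun i => Fin.cases (by simpa using hY)
        (fun i => by simpa using hRk i) i) i)
    rw [sum_piFinset_cons] at this
    simp only [sum_piFinset_cons] at this
    rw [hf]; exact this
  have hfree : 2 * (k - 2) ≤ (univ \ (({a, a', b, b'} : Finset ι) ∪ univ.biUnion R)).card := by
    rw [card_sdiff_of_subset (subset_univ _), card_univ, hcard]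
    have := card_union_le ({a, a', b, b'} : Finset ι) (univ.biUnion R)
    rw [card_biUnion_of_card_eq hR hRk, hZ] at this
    have : (n + 2) * k = n * k + 2 * k := by ring
    omega
  obtain ⟨W, hW, hWd, hWk⟩ := exists_disjoint_subsets_card_eq _ 2 (k - 2) hfree
  have hW' : ∀ i, ∀ x ∈ W i, x ∉ ({a, a', b, b'} : Finset ι) ∧ ∀ j, x ∉ R j := by
    intro i x hx
    have := hW i hx
    rw [Finset.mem_sdiff, mem_union, mem_biUnion] at this
    simpa using this
  obtain ⟨A, hA⟩ : ∃ A, A = W 0 := ⟨_, rfl⟩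
  obtain ⟨B, hB⟩ : ∃ B, B = W 1 := ⟨_, rfl⟩
  have hAZ : ∀ x ∈ A, x ∉ ({a, a', b, b'} : Finset ι) := fun x hx => (hW' 0 x (hA ▸ hx)).1
  have hBZ : ∀ x ∈ B, x ∉ ({a, a', b, b'} : Finset ι) := fun x hx => (hW' 1 x (hB ▸ hx)).1
  have hAR : ∀ j, ∀ x ∈ A, x ∉ R j := fun j x hx => (hW' 0 x (hA ▸ hx)).2 j
  have hBR : ∀ j, ∀ x ∈ B, x ∉ R j := fun j x hx => (hW' 1 x (hB ▸ hx)).2 j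
  have hAB : Disjoint A B := by rw [hA, hB]; exact hWd (by simp)
  have hAk : A.card = k - 2 := by rw [hA]; exact hWk 0
  have hBk : B.card = k - 2 := by rw [hB]; exact hWk 1
  have hzR : ∀ z ∈ ({a, a', b, b'} : Finset ι), ∀ j, z ∉ R j := fun z hz j h =>
    disjoint_left.1 (hRZ j) h hz
  have expand : ∀ x y z w, x ∈ ({a, a', b, b'} : Finset ι) → y ∈ ({a, a', b, b'} : Finset ι) →
      z ∈ ({a, a', b, b'} : Finset ι) → w ∈ ({a, a', b, b'} : Finset ι) → x ≠ y → z ≠ w →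
      x ≠ z → x ≠ w → y ≠ z → y ≠ w →
      f x z + f x w + f y z + f y w + ∑ c ∈ B, f x c + ∑ c ∈ B, f y c + ∑ c ∈ A, f z c
        + ∑ c ∈ A, f w c + ∑ x ∈ A, ∑ y ∈ B, f x y = 0 := by
    intro x y z w hx hy hz hw hxy hzw hxz hxw hyz hyw
    have hyA : y ∉ A := fun h => hAZ _ h hy
    have hxA : x ∉ insert y A := by
      rw [mem_insert, not_or]; exact ⟨hxy, fun h => hAZ _ h hx⟩
    have hwB : w ∉ B := fun h => hBZ _ h hw
    have hzB : z ∉ insert w B := by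
      rw [mem_insert, not_or]; exact ⟨hzw, fun h => hBZ _ h hz⟩
    have hxB : x ∉ B := fun h => hBZ _ h hx
    have hyB : y ∉ B := fun h => hBZ _ h hy
    have hzA : z ∉ A := fun h => hAZ _ h hz
    have hwA : w ∉ A := fun h => hAZ _ h hw
    have := hfsum (insert x (insert y A)) (insert z (insert w B)) (by
        simp only [disjoint_insert_left, disjoint_insert_right, mem_insert, not_or]
        exact ⟨⟨hxz.symm, hyz.symm, hzA⟩, ⟨hxw.symm, hyw.symm, hwA⟩, hxB, hyB, hAB⟩)
        (by rw [card_insert_of_notMem hxA, card_insert_of_notMem hyA]; omega)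
        (by rw [card_insert_of_notMem hzB, card_insert_of_notMem hwB]; omega)
        (fun j => by
          simp only [disjoint_insert_left]
          exact ⟨hzR x hx j, hzR y hy j, disjoint_left.2 (hAR j)⟩)
        (fun j => by
          simp only [disjoint_insert_left]
          exact ⟨hzR z hz j, hzR w hw j, disjoint_left.2 (hBR j)⟩)
    simp only [sum_insert hxA, sum_insert hyA, sum_insert hzB, sum_insert hwB,
      sum_add_distrib] at this
    simp only [hfs _ z, hfs _ w] at this
    simp only [hfs _ z, hfs _ w]
    linarith
  have e1 := expand a b' a' b (by simp) (by simp) (by simp) (by simp) hab' ha'b haa hab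
    ha'b'.symm hbb.symm
  have e2 := expand a' b' a b (by simp) (by simp) (by simp) (by simp) ha'b' hab haa.symm ha'b
    hab'.symm hbb.symm
  have e3 := expand a b a' b' (by simp) (by simp) (by simp) (by simp) hab ha'b' haa hab'
    ha'b.symm hbb
  have e4 := expand a' b a b' (by simp) (by simp) (by simp) (by simp) ha'b hab' haa.symm ha'b'
    hab.symm hbb
  have : f a b - f a' b - f a b' + f a' b' = 0 := by
    rw [hfs b' a', hfs b' b] at e1
    rw [hfs b' a, hfs b' b, hfs a' a] at e2
    rw [hfs b a'] at e3
    rw [hfs b a, hfs a' a] at e4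
    linarith
  rw [hf] at this
  simpa [sum_add_distrib, sum_sub_distrib] using this

/-- A symmetric function all of whose balanced sums vanish is additive over the entries of
injective tuples. -/
lemma exists_additive_of_balanced_sum_eq_zero :
    ∃ h : ι → ℝ, ∑ a, h a = 0 ∧ ∀ x : Fin (n + 2) → ι, Function.Injective x →
      ν x = ∑ i, h (x i) := by
  have hdiff : ∀ a a', ∀ y y' : Fin (n + 1) → ι, Function.Injective y → Function.Injective y' →
      (∀ i, y i ∉ ({a, a'} : Finset ι)) → (∀ i, y' i ∉ ({a, a'} : Finset ι)) →
      ν (Fin.cons a y) - ν (Fin.cons a' y) = ν (Fin.cons a y') - ν (Fin.cons a' y') := by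
    intro a a' y y' hy hy' hya hya'
    rcases eq_or_ne a a' with rfl | haa
    · simp
    refine eq_of_cons_eq {a, a'} (by rw [card_pair haa, hcard]; nlinarith)
      (fun y => ν (Fin.cons a y) - ν (Fin.cons a' y)) ?_ ?_ hy hya hy' hya'
    · intro σ x
      obtain ⟨τ, hτ⟩ := comp_perm_cons σ a x
      obtain ⟨τ', hτ'⟩ := comp_perm_cons σ a' x
      rw [hτ, hτ', hsymm, hsymm]
    · intro t c b ht htZ htc htb hc hb hcb
      simp only [mem_insert, mem_singleton, not_or] at htZ hc hb
      have := second_difference_eq_zero hsymm hcard hk hsum (a := a) (a' := a') (b := b) (b' := c)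
        haa hcb.symm (Ne.symm hb.1) (Ne.symm hc.1) (Ne.symm hb.2) (Ne.symm hc.2) ht
        (fun i => by simp [htZ i, htb i, htc i])
      linarith
  have hfresh : ∀ a b c : ι, ∃ y : Fin (n + 1) → ι, Function.Injective y ∧
      ∀ i, y i ∉ ({a, b, c} : Finset ι) := by
    intro a b c
    have : n + 1 ≤ (univ \ ({a, b, c} : Finset ι)).card := by
      rw [card_sdiff_of_subset (subset_univ _), card_univ, hcard]
      have := card_le_three (a := a) (b := b) (c := c)
      have : (n + 2) * 3 ≤ (n + 2) * k := Nat.mul_le_mul_left _ hk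
      omega
    obtain ⟨S, hS, hSn⟩ := exists_subset_card_eq this
    refine ⟨fun i => (S.equivFinOfCardEq hSn).symm i,
      Subtype.val_injective.comp (S.equivFinOfCardEq hSn).symm.injective, fun i => ?_⟩
    exact (Finset.mem_sdiff.1 (hS ((S.equivFinOfCardEq hSn).symm i).2)).2
  have hne : Nonempty ι := by
    rw [← Fintype.card_pos_iff, hcard]; positivity
  obtain ⟨o⟩ := hne
  choose y hyi hy using fun a => hfresh a o o
  let h₀ : ι → ℝ := fun a => ν (Fin.cons a (y a)) - ν (Fin.cons o (y a))
  have hh₀ : ∀ a a' (t : Fin (n + 1) → ι), Function.Injective t →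
      (∀ i, t i ∉ ({a, a'} : Finset ι)) →
      ν (Fin.cons a t) - ν (Fin.cons a' t) = h₀ a - h₀ a' := by
    intro a a' t ht hta
    obtain ⟨z, hz, hza⟩ := hfresh a a' o
    simp only [mem_insert, mem_singleton, not_or] at hza hy
    rw [hdiff a a' t z ht hz hta (fun i => by simp [hza i])]
    have e1 := hdiff a o (y a) z (hyi a) hz (fun i => by simp [hy a i]) fun i => by simp [hza i]
    have e2 := hdiff a' o (y a') z (hyi a') hz (fun i => by simp [hy a' i]) fun i => by simp [hza i]
    simp only [h₀]
    linarith
  have hconst : ∀ x x' : Fin (n + 2) → ι, Function.Injective x → Function.Injective x' →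
      ν x - ∑ i, h₀ (x i) = ν x' - ∑ i, h₀ (x' i) := by
    intro x x' hx hx'
    refine eq_of_cons_eq (n := n + 1) ∅ ?_ (fun x => ν x - ∑ i, h₀ (x i)) ?_ ?_ hx (by simp) hx'
      (by simp)
    · rw [card_empty, hcard]; nlinarith
    · intro σ x
      rw [hsymm]
      congr 1
      exact Equiv.sum_comp σ fun i => h₀ (x i)
    · intro t c b ht _ htc htb _ _ _
      have := hh₀ b c t ht fun i => by simp [htb i, htc i]
      simp only [Fin.sum_univ_succ (n := n + 1), Fin.cons_zero, Fin.cons_succ]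
      linarith
  obtain ⟨U, -, hUd, hUk⟩ := exists_disjoint_subsets_card_eq (univ : Finset ι) (n + 2) k
    (by rw [card_univ, hcard])
  have hinj : ∀ x ∈ Fintype.piFinset U, Function.Injective x := by
    intro x hx i j hij
    by_contra hne
    rw [Fintype.mem_piFinset] at hx
    exact disjoint_left.1 (hUd hne) (hx i) (hij ▸ hx j)
  obtain ⟨x₀, hx₀⟩ : (Fintype.piFinset U).Nonempty :=
    Fintype.piFinset_nonempty.2 fun i => card_pos.1 (by rw [hUk]; omega)
  obtain ⟨c, hc⟩ : ∃ c, c = ν x₀ - ∑ i, h₀ (x₀ i) := ⟨_, rfl⟩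
  have hn : ((n : ℝ) + 2) ≠ 0 := by positivity
  have hν : ∀ x : Fin (n + 2) → ι, Function.Injective x →
      ν x = ∑ i, (h₀ (x i) + c / (n + 2)) := by
    intro x hx
    have := hconst x x₀ hx (hinj x₀ hx₀)
    rw [← hc] at this
    rw [sum_add_distrib]
    simp
    field_simp
    linarith
  refine ⟨fun a => h₀ a + c / (n + 2), ?_, hν⟩
  have hzero := hsum U hUd hUk
  rw [sum_congr rfl fun x hx => hν x (hinj x hx), sum_comm] at hzero
  have hk0 : (k : ℝ) ≠ 0 := by positivity
  have hU : univ.biUnion U = univ := by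
    rw [← card_eq_iff_eq_univ, card_biUnion_of_card_eq hUd hUk, hcard]
  rw [← hU, sum_biUnion fun i _ j _ hij => hUd hij]
  have hslot : ∀ i, (k : ℝ) * ∑ x ∈ Fintype.piFinset U, (h₀ (x i) + c / (n + 2))
      = k ^ (n + 2) * ∑ a ∈ U i, (h₀ a + c / (n + 2)) := by
    intro i
    have := sum_piFinset_apply U i fun a => h₀ a + c / (n + 2)
    simpa [hUk] using this
  have := congrArg (fun t => (k : ℝ) * t) hzero
  simp only [mul_sum _ _ (k : ℝ), mul_zero] at this
  simp only [← mul_sum, hslot] at this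
  exact (mul_eq_zero.1 this).resolve_left (pow_ne_zero _ hk0)

end AdditiveStructure

/-- Quantitative form of `exists_additive_of_balanced_sum_eq_zero`. -/
lemma exists_additive_near_of_balanced_sum_le {ι : Type*} [Fintype ι] [DecidableEq ι] {n k : ℕ}
    (hcard : Fintype.card ι = (n + 2) * k) (hk : 3 ≤ k) :
    ∃ C : ℝ, 0 < C ∧ ∀ (μ : (Fin (n + 2) → ι) → ℝ) (θ : ℝ), 0 ≤ θ →
      (∀ (σ : Equiv.Perm (Fin (n + 2))) x, μ (x ∘ σ) = μ x) →
      (∀ U : Fin (n + 2) → Finset ι, (Pairwise fun i j => Disjoint (U i) (U j)) →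
        (∀ i, (U i).card = k) → |∑ x ∈ Fintype.piFinset U, μ x| ≤ θ) →
      ∃ h : ι → ℝ, ∑ a, h a = 0 ∧ ∀ x : Fin (n + 2) → ι, Function.Injective x →
        |μ x - ∑ i, h (x i)| ≤ C * θ := by
  let B := {U : Fin (n + 2) → Finset ι // (Pairwise fun i j => Disjoint (U i) (U j)) ∧
    ∀ i, (U i).card = k}
  have : Fintype B := Fintype.ofFinite _
  let T : ((Fin (n + 2) → ι) → ℝ) →ₗ[ℝ]
      (B → ℝ) × (Equiv.Perm (Fin (n + 2)) → (Fin (n + 2) → ι) → ℝ) :=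
    { toFun := fun μ => (fun U => ∑ x ∈ Fintype.piFinset U.1, μ x,
        fun σ x => μ (x ∘ σ) - μ x)
      map_add' := by
        intro μ μ'
        ext <;> simp [sum_add_distrib]
        ring
      map_smul' := by
        intro c μ
        ext <;> simp [mul_sum]
        ring }
  obtain ⟨R, hR⟩ := LinearMap.exists_rightInverse_of_surjective T.rangeRestrict
    T.range_rangeRestrict
  obtain ⟨R', hR'⟩ : ∃ R', R' = LinearMap.toContinuousLinearMap R := ⟨_, rfl⟩
  refine ⟨‖R'‖ + 1, by positivity, fun μ θ hθ hsymm hsum => ?_⟩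
  obtain ⟨ν, hν⟩ : ∃ ν, ν = μ - R (T.rangeRestrict μ) := ⟨_, rfl⟩
  have hTν : T ν = 0 := by
    have h1 : T.rangeRestrict (R (T.rangeRestrict μ)) = T.rangeRestrict μ :=
      LinearMap.congr_fun hR _
    have h2 : T (R (T.rangeRestrict μ)) = T μ := congrArg Subtype.val h1
    rw [hν, map_sub, h2, sub_self]
  obtain ⟨h, hh, hx⟩ := exists_additive_of_balanced_sum_eq_zero (ν := ν)
    (fun σ x => by
      have := congrFun (congrFun (congrArg Prod.snd hTν) σ) x
      simpa [T, sub_eq_zero] using this) hcard hk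
    (fun U h1 h2 => by
      have := congrFun (congrArg Prod.fst hTν) ⟨U, h1, h2⟩
      simpa [T] using this)
  refine ⟨h, hh, fun x hxi => ?_⟩
  rw [← hx x hxi, hν, Pi.sub_apply, sub_sub_cancel]
  have hT : ‖T.rangeRestrict μ‖ ≤ θ := by
    change ‖T μ‖ ≤ θ
    refine max_le ((pi_norm_le_iff_of_nonneg hθ).2 fun U => ?_)
      ((pi_norm_le_iff_of_nonneg hθ).2 fun σ => (pi_norm_le_iff_of_nonneg hθ).2 fun x => ?_)
    · exact hsum U.1 U.2.1 U.2.2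
    · simpa [T, hsymm σ x] using hθ
  calc |R (T.rangeRestrict μ) x| ≤ ‖R (T.rangeRestrict μ)‖ := by
        rw [← Real.norm_eq_abs]
        exact norm_le_pi_norm (R (T.rangeRestrict μ)) x
    _ = ‖R' (T.rangeRestrict μ)‖ := by rw [hR']; rfl
    _ ≤ ‖R'‖ * ‖T.rangeRestrict μ‖ := R'.le_opNorm _
    _ ≤ (‖R'‖ + 1) * θ := by gcongr; linarith

section Counting

variable {m : ℕ} {β : Type*}

lemma edgeProd_zero_or_one {κ : Type*} (E : Finset (κ × κ)) {A : β → β → ℝ}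
    (hA : ∀ x y, A x y = 0 ∨ A x y = 1) (x : κ → β) :
    ∏ e ∈ E, A (x e.1) (x e.2) = 0 ∨ ∏ e ∈ E, A (x e.1) (x e.2) = 1 := by
  by_cases h : ∃ e ∈ E, A (x e.1) (x e.2) = 0
  · obtain ⟨e, he, h⟩ := h
    exact Or.inl (prod_eq_zero he h)
  · push Not at h
    exact Or.inr (prod_eq_one fun e he => (hA _ _).resolve_left (h e he))

lemma abs_sum_sub_mul_prod_le [DecidableEq β] {E : Finset (Fin m × Fin m)}
    (hE : ∀ e ∈ E, e.1 < e.2)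
    {A : β → β → ℝ} (hA : ∀ x y, A x y = 0 ∨ A x y = 1) {e : Fin m × Fin m} (he : e.1 < e.2)
    (heE : e ∉ E) (d θ : ℝ) (U : Fin m → Finset β)
    (hcut : ∀ S ⊆ U e.1, ∀ T ⊆ U e.2, |∑ x ∈ S, ∑ y ∈ T, (A x y - d)| ≤ θ) :
    ((U e.1).card : ℝ) * (U e.2).card * |∑ x ∈ Fintype.piFinset U,
      (A (x e.1) (x e.2) - d) * ∏ e' ∈ E, A (x e'.1) (x e'.2)| ≤ θ * ∏ i, ((U i).card : ℝ) := by
  obtain ⟨i, j⟩ := e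
  have hij : i ≠ j := he.ne
  dsimp only at hcut ⊢
  obtain ⟨ψ, hψ⟩ : ∃ ψ : (Fin m → β) → ℝ, ψ = fun x =>
    (A (x i) (x j) - d) * ∏ e' ∈ E, A (x e'.1) (x e'.2) := ⟨_, rfl⟩
  have hpoint : ∀ x, |∑ a ∈ U i, ∑ b ∈ U j,
      ψ (Function.update (Function.update x i a) j b)| ≤ θ := by
    intro x
    obtain ⟨P, hP⟩ : ∃ P : β → ℝ, P = fun a => ∏ e ∈ E with ¬(e.1 = j ∨ e.2 = j),
      A (Function.update x i a e.1) (Function.update x i a e.2) := ⟨_, rfl⟩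
    obtain ⟨Q, hQ⟩ : ∃ Q : β → ℝ, Q = fun b => ∏ e ∈ E with (e.1 = j ∨ e.2 = j),
      A (Function.update x j b e.1) (Function.update x j b e.2) := ⟨_, rfl⟩
    have hP01 : ∀ a, P a = 0 ∨ P a = 1 := fun a => by
      rw [hP]; exact edgeProd_zero_or_one _ hA _
    have hQ01 : ∀ a, Q a = 0 ∨ Q a = 1 := fun a => by
      rw [hQ]; exact edgeProd_zero_or_one _ hA _
    have hsplit : ∀ a b, ψ (Function.update (Function.update x i a) j b)
        = (A a b - d) * (Q b * P a) := by
      intro a b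
      rw [hψ, hP, hQ]
      simp only [Function.update_self, Function.update_of_ne hij]
      rw [← prod_filter_mul_prod_filter_not E (fun e => e.1 = j ∨ e.2 = j)]
      congr 2
      · refine prod_congr rfl fun e' he' => ?_
        rw [mem_filter] at he'
        have hlt := hE _ he'.1
        have h1 : e'.1 ≠ i := by
          intro h
          rcases he'.2 with h' | h'
          · exact hij (h ▸ h')
          · exact heE (by rw [← h, ← h']; exact he'.1)
        have h2 : e'.2 ≠ i := by
          intro h
          rcases he'.2 with h' | h'
          · rw [h, h'] at hlt; exact lt_asymm hlt he
          · exact hij (h ▸ h')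
        rw [Function.update_comm hij]
        simp only [Function.update_of_ne h1, Function.update_of_ne h2]
      · refine prod_congr rfl fun e' he' => ?_
        rw [mem_filter, not_or] at he'
        simp only [Function.update_of_ne he'.2.1, Function.update_of_ne he'.2.2]
    have := hcut {a ∈ U i | P a = 1} (filter_subset _ _) {b ∈ U j | Q b = 1} (filter_subset _ _)
    rw [sum_filter] at this
    simp only [sum_filter] at this
    convert this using 2
    refine sum_congr rfl fun a _ => ?_
    rcases hP01 a with h | h
    · simp [hsplit, h]
    · rw [if_pos h]
      refine sum_congr rfl fun b _ => ?_
      rcases hQ01 b with h' | h' <;> simp [hsplit, h, h']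
  have hswap : ((U i).card : ℝ) * (U j).card * ∑ x ∈ Fintype.piFinset U, ψ x
      = ∑ x ∈ Fintype.piFinset U, ∑ a ∈ U i, ∑ b ∈ U j,
        ψ (Function.update (Function.update x i a) j b) := by
    rw [sum_piFinset_update U i fun x => ∑ b ∈ U j, ψ (Function.update x j b),
      sum_piFinset_update, mul_assoc]
  have hcard : (∏ i, ((U i).card : ℝ)) = ((Fintype.piFinset U).card : ℝ) := by
    rw [Fintype.card_piFinset]; push_cast; rfl
  calc ((U i).card : ℝ) * (U j).card * |∑ x ∈ Fintype.piFinset U,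
        (A (x i) (x j) - d) * ∏ e' ∈ E, A (x e'.1) (x e'.2)|
      = |((U i).card : ℝ) * (U j).card * ∑ x ∈ Fintype.piFinset U, ψ x| := by
        simp only [hψ, abs_mul, Nat.abs_cast]
    _ ≤ ∑ x ∈ Fintype.piFinset U, θ := by
        rw [hswap]
        exact (abs_sum_le_sum_abs _ _).trans (sum_le_sum fun x _ => hpoint x)
    _ = θ * ∏ i, ((U i).card : ℝ) := by
        rw [hcard, sum_const, nsmul_eq_mul, mul_comm]

/-- Counting lemma for sets of equal size. -/
lemma abs_sum_edgeProd_sub_le [DecidableEq β] {E : Finset (Fin m × Fin m)}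
    (hE : ∀ e ∈ E, e.1 < e.2)
    {A : β → β → ℝ} (hA : ∀ x y, A x y = 0 ∨ A x y = 1) {d : Fin m × Fin m → ℝ}
    (hd : ∀ e, d e ∈ Set.Icc (0 : ℝ) 1) {θ : ℝ} {q : ℕ} {U : Fin m → Finset β}
    (hU : ∀ i, (U i).card = q)
    (hcut : ∀ e ∈ E, ∀ S ⊆ U e.1, ∀ T ⊆ U e.2, |∑ x ∈ S, ∑ y ∈ T, (A x y - d e)| ≤ θ) :
    (q : ℝ) ^ 2 * |∑ x ∈ Fintype.piFinset U, edgeProd E A x - (∏ e ∈ E, d e) * (q : ℝ) ^ m|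
      ≤ E.card * θ * (q : ℝ) ^ m := by
  induction E using Finset.induction_on with
  | empty => simp [edgeProd, Fintype.card_piFinset, hU]
  | insert e E he ih =>
    have ih := ih (fun e' he' => hE e' (mem_insert_of_mem he'))
      (fun e' he' => hcut e' (mem_insert_of_mem he'))
    have key := abs_sum_sub_mul_prod_le (fun e' he' => hE e' (mem_insert_of_mem he')) hA
      (hE e (mem_insert_self _ _)) he (d e) θ U (hcut e (mem_insert_self _ _))
    simp only [hU, prod_const, card_univ, Fintype.card_fin] at key
    have hsum : ∑ x ∈ Fintype.piFinset U, edgeProd (insert e E) A x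
        - (∏ e ∈ insert e E, d e) * (q : ℝ) ^ m
        = ∑ x ∈ Fintype.piFinset U, (A (x e.1) (x e.2) - d e) * ∏ e' ∈ E, A (x e'.1) (x e'.2)
          + d e * (∑ x ∈ Fintype.piFinset U, edgeProd E A x - (∏ e ∈ E, d e) * (q : ℝ) ^ m) := by
      simp only [edgeProd, prod_insert he, sub_mul, sum_sub_distrib, ← mul_sum]
      ring
    rw [hsum, card_insert_of_notMem he]
    push_cast
    have hde := hd e
    have h1 := abs_add_le (∑ x ∈ Fintype.piFinset U,
      (A (x e.1) (x e.2) - d e) * ∏ e' ∈ E, A (x e'.1) (x e'.2))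
      (d e * (∑ x ∈ Fintype.piFinset U, edgeProd E A x - (∏ e ∈ E, d e) * (q : ℝ) ^ m))
    rw [abs_mul (d e), abs_of_nonneg hde.1] at h1
    have h2 := mul_le_of_le_one_left (abs_nonneg (∑ x ∈ Fintype.piFinset U, edgeProd E A x
      - (∏ e ∈ E, d e) * (q : ℝ) ^ m)) hde.2
    have h3 := mul_le_mul_of_nonneg_left (h1.trans (add_le_add_right h2 _)) (sq_nonneg (q : ℝ))
    linarith

end Counting

/-- The adjacency indicator of `G` as a real-valued kernel. -/
noncomputable def adjIndicator {β : Type*} (G : SimpleGraph β) (x y : β) : ℝ :=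
  open Classical in if G.Adj x y then 1 else 0

/-- The edges of `F`, each listed once with increasing endpoints. -/
noncomputable def edgePairs {m : ℕ} (F : SimpleGraph (Fin m)) : Finset (Fin m × Fin m) :=
  open Classical in {e | e.1 < e.2 ∧ F.Adj e.1 e.2}

/-- The discrepancy form of quasi-randomness. -/
def CutUniform (p : ℝ) (V : ℕ → ℕ) (G : ∀ n, SimpleGraph (Fin (V n))) : Prop :=
  ∀ δ > 0, ∀ᶠ n in atTop, ∀ S T : Finset (Fin (V n)),
    |∑ x ∈ S, ∑ y ∈ T, (adjIndicator (G n) x y - p)| ≤ δ * (V n : ℝ) ^ 2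

section Kernels

variable {m : ℕ} {β : Type} (F : SimpleGraph (Fin m)) (G : SimpleGraph β)

lemma adjIndicator_zero_or_one (x y : β) : adjIndicator G x y = 0 ∨ adjIndicator G x y = 1 := by
  rw [adjIndicator]; split_ifs <;> simp

lemma mem_edgePairs {e : Fin m × Fin m} : e ∈ edgePairs F ↔ e.1 < e.2 ∧ F.Adj e.1 e.2 := by
  simp [edgePairs]

lemma lt_of_mem_edgePairs : ∀ e ∈ edgePairs F, e.1 < e.2 := fun _ he => ((mem_edgePairs F).1 he).1

lemma card_edgePairs : (edgePairs F).card = numEdges F := by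
  classical
  rw [numEdges, Nat.card_eq_fintype_card, ← SimpleGraph.edgeFinset_card]
  refine card_bij (fun e _ => s(e.1, e.2)) ?_ ?_ ?_
  · intro e he
    simpa using ((mem_edgePairs F).1 he).2
  · intro e he e' he' h
    have h1 := lt_of_mem_edgePairs F e he
    have h2 := lt_of_mem_edgePairs F e' he'
    rw [Sym2.eq_iff] at h
    rcases h with h | h
    · exact Prod.ext h.1 h.2
    · rw [h.1, h.2] at h1
      exact absurd h1 (lt_asymm h2)
  · intro e he
    induction e with
    | _ a b =>
      rw [SimpleGraph.mem_edgeFinset, SimpleGraph.mem_edgeSet] at he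
      rcases lt_or_gt_of_ne he.ne with h | h
      · exact ⟨(a, b), (mem_edgePairs F).2 ⟨h, he⟩, rfl⟩
      · exact ⟨(b, a), (mem_edgePairs F).2 ⟨h, he.symm⟩, Sym2.eq_swap⟩

lemma edgeProd_adjIndicator (φ : Fin m → β) [Decidable (∀ i j, F.Adj i j → G.Adj (φ i) (φ j))] :
    edgeProd (edgePairs F) (adjIndicator G) φ
      = if ∀ i j, F.Adj i j → G.Adj (φ i) (φ j) then 1 else 0 := by
  rw [edgeProd]
  split_ifs with h
  · refine prod_eq_one fun e he => ?_
    rw [adjIndicator, if_pos (h _ _ ((mem_edgePairs F).1 he).2)]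
  · push Not at h
    obtain ⟨i, j, hij, hG⟩ := h
    rcases lt_or_gt_of_ne hij.ne with hlt | hlt
    · refine prod_eq_zero ((mem_edgePairs F (e := (i, j))).2 ⟨hlt, hij⟩) ?_
      rw [adjIndicator, if_neg hG]
    · refine prod_eq_zero ((mem_edgePairs F (e := (j, i))).2 ⟨hlt, hij.symm⟩) ?_
      rw [adjIndicator, if_neg fun h => hG h.symm]

lemma edgeProd_adjIndicator_mem_Icc (φ : Fin m → β) :
    edgeProd (edgePairs F) (adjIndicator G) φ ∈ Set.Icc (0 : ℝ) 1 := by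
  classical
  rw [edgeProd_adjIndicator]
  split_ifs <;> simp

lemma injective_of_mem_piFinset {κ ι : Type*} [Fintype κ] [DecidableEq κ] {U : κ → Finset ι}
    (hU : Pairwise fun i j => Disjoint (U i) (U j)) {x : κ → ι} (hx : x ∈ Fintype.piFinset U) :
    Function.Injective x := by
  intro i j hij
  by_contra hne
  rw [Fintype.mem_piFinset] at hx
  exact disjoint_left.1 (hU hne) (hx i) (hij ▸ hx j)

lemma labCount_eq_sum [Fintype β] {U : Fin m → Finset β}
    (hU : Pairwise fun i j => Disjoint (U i) (U j)) :
    (labCount F G U : ℝ) = ∑ x ∈ Fintype.piFinset U, edgeProd (edgePairs F) (adjIndicator G) x := by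
  classical
  simp only [edgeProd_adjIndicator]
  rw [sum_boole, labCount, Nat.card_eq_fintype_card, Fintype.card_subtype]
  congr 2
  ext x
  simp only [mem_filter, mem_univ, true_and, Fintype.mem_piFinset]
  refine ⟨fun h => ⟨h.2.2, h.2.1⟩, fun h => ⟨?_, h.2, h.1⟩⟩
  exact injective_of_mem_piFinset hU (Fintype.mem_piFinset.2 h.1)

lemma card_not_injective_le [Fintype β] [DecidableEq β] :
    ((univ.filter fun x : Fin m → β => ¬ Function.Injective x).card : ℝ) * Fintype.card β
      ≤ m ^ 2 * (Fintype.card β : ℝ) ^ m := by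
  have hpair : ∀ e ∈ univ.filter (fun e : Fin m × Fin m => e.1 ≠ e.2),
      ((univ.filter fun x : Fin m → β => x e.1 = x e.2).card : ℝ) * Fintype.card β
        = (Fintype.card β : ℝ) ^ m := by
    intro e he
    have hne : e.2 ≠ e.1 := (mem_filter.1 he).2.symm
    have := sum_piFinset_update (fun _ : Fin m => (univ : Finset β)) e.1
      fun x => if x e.1 = x e.2 then (1 : ℝ) else 0
    simp only [Function.update_self, Function.update_of_ne hne, sum_ite_eq', mem_univ, if_true,
      Fintype.piFinset_univ, sum_boole, card_univ] at this
    rw [mul_comm, ← this]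
    simp
  have hsub : (univ.filter fun x : Fin m → β => ¬ Function.Injective x)
      ⊆ (univ.filter (fun e : Fin m × Fin m => e.1 ≠ e.2)).biUnion
        fun e => univ.filter fun x : Fin m → β => x e.1 = x e.2 := by
    intro x hx
    rw [mem_filter, Function.not_injective_iff] at hx
    obtain ⟨-, i, j, h, hij⟩ := hx
    exact mem_biUnion.2 ⟨(i, j), by simpa using hij, by simpa using h⟩
  calc _ ≤ ((∑ e : Fin m × Fin m with e.1 ≠ e.2,
        (univ.filter fun x : Fin m → β => x e.1 = x e.2).card : ℕ) : ℝ) * Fintype.card β := by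
        gcongr
        exact (card_le_card hsub).trans card_biUnion_le
    _ = ∑ e : Fin m × Fin m with e.1 ≠ e.2, (Fintype.card β : ℝ) ^ m := by
        push_cast
        rw [sum_mul]
        exact sum_congr rfl hpair
    _ ≤ _ := by
        rw [sum_const, nsmul_eq_mul]
        gcongr
        have : (univ.filter fun e : Fin m × Fin m => e.1 ≠ e.2).card ≤ m ^ 2 := by
          refine (card_filter_le _ _).trans ?_
          simp [sq]
        exact_mod_cast this

lemma abs_totalCount_sub_sum_le [Fintype β] :
    |(totalCount F G : ℝ) - ∑ x, edgeProd (edgePairs F) (adjIndicator G) x| * Fintype.card β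
      ≤ m ^ 2 * (Fintype.card β : ℝ) ^ m := by
  classical
  refine le_trans ?_ (card_not_injective_le (m := m) (β := β))
  gcongr
  have hcount : (totalCount F G : ℝ) = ∑ x : Fin m → β with Function.Injective x,
      edgeProd (edgePairs F) (adjIndicator G) x := by
    simp only [edgeProd_adjIndicator]
    rw [sum_boole, totalCount, Nat.card_eq_fintype_card, Fintype.card_subtype, filter_filter]
  rw [hcount, ← sum_filter_add_sum_filter_not univ fun x : Fin m → β => Function.Injective x,
    sub_add_cancel_left, abs_neg]
  refine (abs_sum_le_sum_abs _ _).trans ?_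
  rw [card_eq_sum_ones]
  push_cast
  refine sum_le_sum fun x _ => ?_
  have := edgeProd_adjIndicator_mem_Icc F G x
  rw [abs_of_nonneg this.1]
  exact this.2

end Kernels

lemma exists_tendsto_zero_of_eventually {P : ℕ → ℝ → Prop}
    (hmono : ∀ n a b, a ≤ b → P n a → P n b) (hex : ∀ n, ∃ a, 0 ≤ a ∧ P n a)
    (h : ∀ δ > 0, ∀ᶠ n in atTop, P n δ) :
    ∃ ε : ℕ → ℝ, Tendsto ε atTop (nhds 0) ∧ ∀ n, P n (ε n) := by
  have hbdd : ∀ n, BddBelow {a | 0 ≤ a ∧ P n a} := fun n => ⟨0, fun a ha => ha.1⟩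
  have h0 : ∀ n, 0 ≤ sInf {a | 0 ≤ a ∧ P n a} := fun n => le_csInf (hex n) fun a ha => ha.1
  refine ⟨fun n => sInf {a | 0 ≤ a ∧ P n a} + 1 / ((n : ℝ) + 1), ?_, fun n => ?_⟩
  · have h1 : Tendsto (fun n => sInf {a | 0 ≤ a ∧ P n a}) atTop (nhds 0) := by
      rw [Metric.tendsto_atTop']
      intro δ hδ
      obtain ⟨N, hN⟩ := eventually_atTop.1 (h (δ / 2) (by positivity))
      refine ⟨N, fun n hn => ?_⟩
      rw [Real.dist_0_eq_abs, abs_of_nonneg (h0 n)]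
      have : sInf {a | 0 ≤ a ∧ P n a} ≤ δ / 2 :=
        csInf_le (hbdd n) ⟨by positivity, hN n hn.le⟩
      linarith
    simpa using h1.add tendsto_one_div_add_atTop_nhds_zero_nat
  · obtain ⟨a, ha, hlt⟩ := exists_lt_of_csInf_lt (hex n)
      (show sInf {a | 0 ≤ a ∧ P n a} < sInf {a | 0 ≤ a ∧ P n a} + 1 / ((n : ℝ) + 1) by
        have : (0 : ℝ) < 1 / ((n : ℝ) + 1) := by positivity
        linarith)
    exact hmono n a _ hlt.le ha.2

section Equivalences

variable {m : ℕ} {p : ℝ} {V : ℕ → ℕ} {G : ∀ n, SimpleGraph (Fin (V n))}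

/-- Counting from the cut condition inside sets of equal size. -/
lemma abs_sum_edgeProd_sub_pow_le (F : SimpleGraph (Fin m)) (hp0 : 0 ≤ p) (hp1 : p ≤ 1) {N q : ℕ}
    {H : SimpleGraph (Fin N)} {U : Fin m → Finset (Fin N)} (hU : ∀ i, (U i).card = q) {θ : ℝ}
    (hcut : ∀ S T : Finset (Fin N), |∑ x ∈ S, ∑ y ∈ T, (adjIndicator H x y - p)| ≤ θ) :
    (q : ℝ) ^ 2 * |∑ x ∈ Fintype.piFinset U, edgeProd (edgePairs F) (adjIndicator H) x
      - p ^ numEdges F * (q : ℝ) ^ m| ≤ numEdges F * θ * (q : ℝ) ^ m := by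
  have := abs_sum_edgeProd_sub_le (lt_of_mem_edgePairs F) (adjIndicator_zero_or_one H)
    (d := fun _ => p) (fun _ => ⟨hp0, hp1⟩) hU (θ := θ) fun e _ S _ T _ => hcut S T
  rwa [prod_const, card_edgePairs] at this

lemma CutUniform.isQuasirandom (hp0 : 0 ≤ p) (hp1 : p ≤ 1) (hV : Tendsto V atTop atTop)
    (h : CutUniform p V G) : IsQuasirandom p V G := by
  intro m F
  rw [isLittleO_iff]
  intro c hc
  obtain ⟨K, hK⟩ := exists_nat_gt (2 * (m : ℝ) ^ 2 / c)
  filter_upwards [h (c / (2 * (numEdges F + 1))) (by positivity),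
    hV.eventually_ge_atTop (K + 1)] with n hn hnK
  have hn0 : (0 : ℝ) < V n := by exact_mod_cast (by omega : 0 < V n)
  have hKn : (K : ℝ) ≤ V n := by exact_mod_cast (by omega : K ≤ V n)
  have h1 := abs_sum_edgeProd_sub_pow_le F hp0 hp1 (U := fun _ => univ) (q := V n) (by simp) hn
  have h2 := abs_totalCount_sub_sum_le F (G n)
  rw [Fintype.card_fin] at h2
  rw [Fintype.piFinset_univ] at h1
  obtain ⟨t, ht⟩ : ∃ s, s = ∑ x, edgeProd (edgePairs F) (adjIndicator (G n)) x := ⟨_, rfl⟩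
  rw [← ht] at h1 h2
  have h3 : |t - p ^ numEdges F * (V n : ℝ) ^ m| ≤ c / 2 * (V n : ℝ) ^ m := by
    have : (V n : ℝ) ^ 2 * |t - p ^ numEdges F * (V n : ℝ) ^ m|
        ≤ (V n : ℝ) ^ 2 * (c / 2 * (V n : ℝ) ^ m) := by
      refine h1.trans ?_
      have : (numEdges F : ℝ) * (c / (2 * (numEdges F + 1))) ≤ c / 2 := by
        rw [mul_div_assoc', div_le_div_iff₀ (by positivity) (by positivity)]
        nlinarith
      calc (numEdges F : ℝ) * (c / (2 * (numEdges F + 1)) * (V n : ℝ) ^ 2) * (V n : ℝ) ^ m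
          = (numEdges F : ℝ) * (c / (2 * (numEdges F + 1))) * ((V n : ℝ) ^ 2 * (V n : ℝ) ^ m) := by
            ring
        _ ≤ c / 2 * ((V n : ℝ) ^ 2 * (V n : ℝ) ^ m) := by gcongr
        _ = _ := by ring
    exact le_of_mul_le_mul_left this (by positivity)
  have h4 : |(totalCount F (G n) : ℝ) - t| ≤ c / 2 * (V n : ℝ) ^ m := by
    have : |(totalCount F (G n) : ℝ) - t| * V n ≤ c / 2 * (V n : ℝ) ^ m * V n := by
      refine h2.trans ?_
      rw [div_lt_iff₀ hc] at hK
      have : (m : ℝ) ^ 2 ≤ c / 2 * V n := by nlinarith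
      calc (m : ℝ) ^ 2 * (V n : ℝ) ^ m ≤ c / 2 * V n * (V n : ℝ) ^ m := by gcongr
        _ = _ := by ring
    exact le_of_mul_le_mul_right this hn0
  rw [Real.norm_eq_abs, Real.norm_eq_abs, abs_of_nonneg (by positivity : (0 : ℝ) ≤ (V n : ℝ) ^ m)]
  have h5 := abs_add_le ((totalCount F (G n) : ℝ) - t) (t - p ^ numEdges F * (V n : ℝ) ^ m)
  rw [sub_add_sub_cancel] at h5
  linarith

lemma CutUniform.satisfiesP (F : SimpleGraph (Fin m)) (hp0 : 0 ≤ p) (hp1 : p ≤ 1)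
    (hm : 0 < m) (hV : Tendsto V atTop atTop) (h : CutUniform p V G) :
    SatisfiesP F p (fun _ => 1 / (m : ℝ)) V G := by
  refine exists_tendsto_zero_of_eventually (P := fun n ε => ∀ U : Fin m → Finset (Fin (V n)),
      Pairwise (fun i j => Disjoint (U i) (U j)) →
      (∀ i, (U i).card = ⌊1 / (m : ℝ) * (V n : ℝ)⌋₊) →
      |(labCount F (G n) U : ℝ) - p ^ numEdges F * ∏ i, ((U i).card : ℝ)|
        ≤ ε * (V n : ℝ) ^ m) ?_ ?_ ?_
  · intro n a b hab ha U hU hc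
    exact (ha U hU hc).trans (by gcongr)
  · intro n
    refine ⟨1, zero_le_one, fun U hU hc => ?_⟩
    rw [labCount_eq_sum F (G n) hU, one_mul]
    have hprod : ∏ i, ((U i).card : ℝ) ≤ (V n : ℝ) ^ m := by
      calc ∏ i, ((U i).card : ℝ) ≤ ∏ _i : Fin m, (V n : ℝ) :=
            prod_le_prod (fun i _ => by positivity) fun i _ => by
              exact_mod_cast (card_le_univ (U i)).trans_eq (Fintype.card_fin _)
        _ = _ := by simp
    have h1 : ∑ x ∈ Fintype.piFinset U, edgeProd (edgePairs F) (adjIndicator (G n)) x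
        ≤ ∏ i, ((U i).card : ℝ) := by
      calc _ ≤ ∑ x ∈ Fintype.piFinset U, (1 : ℝ) :=
            sum_le_sum fun x _ => (edgeProd_adjIndicator_mem_Icc F (G n) x).2
        _ = _ := by simp [Fintype.card_piFinset]
    have h2 : 0 ≤ ∑ x ∈ Fintype.piFinset U, edgeProd (edgePairs F) (adjIndicator (G n)) x :=
      sum_nonneg fun x _ => (edgeProd_adjIndicator_mem_Icc F (G n) x).1
    have h3 : 0 ≤ p ^ numEdges F * ∏ i, ((U i).card : ℝ) := by positivity
    have h4 : p ^ numEdges F * ∏ i, ((U i).card : ℝ) ≤ ∏ i, ((U i).card : ℝ) :=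
      mul_le_of_le_one_left (by positivity) (pow_le_one₀ hp0 hp1)
    rw [abs_le]
    constructor <;> linarith
  · intro δ hδ
    filter_upwards [h (δ / (4 * m ^ 2 * (numEdges F + 1))) (by positivity),
      hV.eventually_ge_atTop (2 * m)] with n hn hnm U hU hc
    have hm' : (0 : ℝ) < m := by exact_mod_cast hm
    have hnm' : 2 * (m : ℝ) ≤ V n := by exact_mod_cast hnm
    obtain ⟨q, hq⟩ : ∃ q, q = ⌊1 / (m : ℝ) * (V n : ℝ)⌋₊ := ⟨_, rfl⟩
    rw [← hq] at hc
    have hqn : (V n : ℝ) ≤ 2 * m * q := by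
      have := Nat.lt_floor_add_one (1 / (m : ℝ) * (V n : ℝ))
      rw [← hq, one_div, inv_mul_lt_iff₀ hm'] at this
      linarith
    have hqn' : (q : ℝ) ≤ V n := by
      rw [← hc ⟨0, hm⟩]
      exact_mod_cast (card_le_univ _).trans_eq (Fintype.card_fin _)
    have hn0 : (0 : ℝ) < V n := by linarith
    have hq0 : (0 : ℝ) < q := by
      by_contra hcon
      have : (q : ℝ) = 0 := le_antisymm (not_lt.1 hcon) (by positivity)
      rw [this] at hqn
      linarith
    have h1 := abs_sum_edgeProd_sub_pow_le F hp0 hp1 hc hn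
    rw [labCount_eq_sum F (G n) hU]
    simp only [hc, prod_const, card_univ, Fintype.card_fin]
    refine le_of_mul_le_mul_left (h1.trans ?_) (by positivity : (0 : ℝ) < (q : ℝ) ^ 2)
    have e1 : (numEdges F : ℝ) * (δ / (4 * m ^ 2 * (numEdges F + 1))) ≤ δ / (4 * m ^ 2) := by
      rw [mul_div_assoc', div_le_div_iff₀ (by positivity) (by positivity)]
      nlinarith [mul_pos hδ (pow_pos hm' 2)]
    have e2 : (V n : ℝ) ^ 2 ≤ 4 * m ^ 2 * q ^ 2 := by
      calc (V n : ℝ) ^ 2 ≤ (2 * m * q) ^ 2 := by gcongr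
        _ = _ := by ring
    calc (numEdges F : ℝ) * (δ / (4 * m ^ 2 * (numEdges F + 1)) * (V n : ℝ) ^ 2) * (q : ℝ) ^ m
        = (numEdges F : ℝ) * (δ / (4 * m ^ 2 * (numEdges F + 1))) * (V n : ℝ) ^ 2 * (q : ℝ) ^ m := by
          ring
      _ ≤ δ / (4 * m ^ 2) * (4 * m ^ 2 * q ^ 2) * (V n : ℝ) ^ m := by gcongr
      _ = (q : ℝ) ^ 2 * (δ * (V n : ℝ) ^ m) := by field_simp

lemma numEdges_map (σ : Equiv.Perm (Fin m)) (F : SimpleGraph (Fin m)) :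
    numEdges (SimpleGraph.map σ.toEmbedding F) = numEdges F := by
  rw [numEdges, numEdges]
  exact (Nat.card_congr (SimpleGraph.Iso.map σ F).mapEdgeSet).symm

lemma labCount_map {β : Type} [Fintype β] (σ : Equiv.Perm (Fin m)) (F : SimpleGraph (Fin m))
    (H : SimpleGraph β) (U : Fin m → Finset β) :
    labCount (SimpleGraph.map σ.toEmbedding F) H U = labCount F H fun i => U (σ i) := by
  refine Nat.card_congr (Equiv.subtypeEquiv (Equiv.arrowCongr σ.symm (Equiv.refl β)) fun φ => ?_)
  have hadj : ∀ i j, (SimpleGraph.map σ.toEmbedding F).Adj (σ i) (σ j) ↔ F.Adj i j := fun i j =>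
    SimpleGraph.map_adj_apply (f := σ.toEmbedding)
  change _ ↔ Function.Injective (φ ∘ σ) ∧ (∀ i j, F.Adj i j → H.Adj (φ (σ i)) (φ (σ j))) ∧
    ∀ i, φ (σ i) ∈ U (σ i)
  rw [EquivLike.injective_comp]
  refine and_congr_right fun _ => and_congr ⟨fun h i j hij => h _ _ ((hadj i j).2 hij),
    fun h i j hij => ?_⟩ ⟨fun h i => h _, fun h i => by simpa using h (σ.symm i)⟩
  have := h (σ.symm i) (σ.symm j) ((hadj _ _).1 (by simpa using hij))
  simpa using this

lemma SatisfiesPu.satisfiesPt {F : SimpleGraph (Fin m)}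
    (h : SatisfiesPu F p (fun _ => 1 / (m : ℝ)) V G) :
    SatisfiesPt F p (fun _ => 1 / (m : ℝ)) V G := by
  choose ε hε h using h
  refine ⟨fun n => ((m.factorial : ℝ))⁻¹ * ∑ σ, ε σ n, ?_, fun n U hU hc => ?_⟩
  · simpa using (tendsto_finsetSum univ fun σ _ => hε σ).const_mul ((m.factorial : ℝ))⁻¹
  have hσ := fun σ => h σ n U hU hc
  simp only [labCount_map, numEdges_map] at hσ
  have hfac : (m.factorial : ℝ) ≠ 0 := by positivity
  have e1 : symCount F (G n) U - p ^ numEdges F * ∏ i, ((U i).card : ℝ)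
      = ((m.factorial : ℝ))⁻¹ * ∑ σ : Equiv.Perm (Fin m),
        ((labCount F (G n) (fun i => U (σ i)) : ℝ) - p ^ numEdges F * ∏ i, ((U i).card : ℝ)) := by
    rw [symCount, sum_sub_distrib, mul_sub, sum_const, card_univ, Fintype.card_perm,
      Fintype.card_fin, nsmul_eq_mul, inv_mul_cancel_left₀ hfac]
  rw [e1, abs_mul, abs_of_nonneg (by positivity), mul_assoc, sum_mul]
  gcongr
  exact (abs_sum_le_sum_abs _ _).trans (sum_le_sum fun σ _ => hσ σ)

end Equivalences

/-- The edges of a four-cycle with sides `{0, 1}` and `{2, 3}`. -/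
def fourCycle : Finset (Fin 4 × Fin 4) := {(0, 2), (0, 3), (1, 2), (1, 3)}

lemma lt_of_mem_fourCycle : ∀ e ∈ fourCycle, e.1 < e.2 := by decide

lemma sum_edgeProd_fourCycle {β : Type*} [Fintype β] (D : β → β → ℝ) :
    ∑ z, edgeProd fourCycle D z
      = ∑ x, ∑ x', ∑ y, ∑ y', D x y * (D x y' * (D x' y * D x' y')) := by
  have hcons : ∀ (n : ℕ) (g : (Fin (n + 1) → β) → ℝ), ∑ z, g z = ∑ c, ∑ r, g (Fin.cons c r) := by
    intro n g
    rw [← (Fin.consEquiv fun _ => β).sum_comp, Fintype.sum_prod_type]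
    rfl
  rw [hcons]
  refine sum_congr rfl fun x _ => ?_
  rw [hcons]
  refine sum_congr rfl fun x' _ => ?_
  rw [hcons]
  refine sum_congr rfl fun y _ => ?_
  rw [hcons]
  refine sum_congr rfl fun y' _ => ?_
  rw [Fintype.sum_unique, edgeProd, fourCycle, prod_insert (by decide), prod_insert (by decide),
    prod_insert (by decide), prod_singleton]
  rfl

lemma sum_sum_pow_four_le {β : Type*} [Fintype β] (D : β → β → ℝ) (S T : Finset β) :
    (∑ x ∈ S, ∑ y ∈ T, D x y) ^ 4
      ≤ (Fintype.card β : ℝ) ^ 4 * ∑ z, edgeProd fourCycle D z := by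
  have hcs : ∀ (X : Finset β) (f : β → ℝ),
      (∑ x ∈ X, f x) ^ 2 ≤ Fintype.card β * ∑ x, f x ^ 2 := by
    intro X f
    refine (sq_sum_le_card_mul_sum_sq).trans ?_
    have h1 : ∑ x ∈ X, f x ^ 2 ≤ ∑ x, f x ^ 2 :=
      sum_le_sum_of_subset_of_nonneg (subset_univ _) fun _ _ _ => sq_nonneg _
    have h2 : (X.card : ℝ) ≤ Fintype.card β := by exact_mod_cast card_le_univ X
    have h3 : 0 ≤ ∑ x ∈ X, f x ^ 2 := sum_nonneg fun _ _ => sq_nonneg _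
    gcongr
  obtain ⟨s, hs⟩ : ∃ s, s = ∑ x ∈ S, ∑ y ∈ T, D x y := ⟨_, rfl⟩
  have h1 : s ^ 2 ≤ Fintype.card β * ∑ y ∈ T, ∑ y' ∈ T, ∑ x, D x y * D x y' := by
    rw [hs]
    refine (hcs S _).trans_eq ?_
    congr 1
    simp_rw [sq, sum_mul_sum]
    rw [sum_comm]
    exact sum_congr rfl fun y _ => sum_comm
  have h2 : (∑ y ∈ T, ∑ y' ∈ T, ∑ x, D x y * D x y') ^ 2
      ≤ Fintype.card β * (Fintype.card β * ∑ y, ∑ y', (∑ x, D x y * D x y') ^ 2) := by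
    refine (hcs T _).trans ?_
    refine mul_le_mul_of_nonneg_left ?_ (by positivity)
    rw [mul_sum]
    exact sum_le_sum fun y _ => hcs T _
  have h3 : ∑ y, ∑ y', (∑ x, D x y * D x y') ^ 2 = ∑ z, edgeProd fourCycle D z := by
    rw [sum_edgeProd_fourCycle]
    simp_rw [sq, sum_mul_sum]
    have e : ∀ y, ∑ y', ∑ x, ∑ x', D x y * D x y' * (D x' y * D x' y')
        = ∑ x, ∑ x', ∑ y', D x y * (D x y' * (D x' y * D x' y')) := by
      intro y
      rw [sum_comm]
      refine sum_congr rfl fun x _ => ?_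
      rw [sum_comm]
      exact sum_congr rfl fun x' _ => sum_congr rfl fun y' _ => by ring
    rw [sum_congr rfl fun y _ => e y, sum_comm]
    exact sum_congr rfl fun x _ => sum_comm
  rw [← hs, ← h3]
  calc s ^ 4 = (s ^ 2) ^ 2 := by ring
    _ ≤ (Fintype.card β * ∑ y ∈ T, ∑ y' ∈ T, ∑ x, D x y * D x y') ^ 2 := by gcongr
    _ = (Fintype.card β : ℝ) ^ 2 * (∑ y ∈ T, ∑ y' ∈ T, ∑ x, D x y * D x y') ^ 2 := by ring
    _ ≤ (Fintype.card β : ℝ) ^ 2 * (Fintype.card β *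
        (Fintype.card β * ∑ y, ∑ y', (∑ x, D x y * D x y') ^ 2)) := by gcongr
    _ = _ := by ring

section Equivalences

variable {m : ℕ} {p : ℝ} {V : ℕ → ℕ} {G : ∀ n, SimpleGraph (Fin (V n))}

lemma IsQuasirandom.tendsto_sum_edgeProd (hV : Tendsto V atTop atTop) (h : IsQuasirandom p V G)
    {E : Finset (Fin m × Fin m)} (hE : ∀ e ∈ E, e.1 < e.2) :
    Tendsto (fun n => (∑ z, edgeProd E (adjIndicator (G n)) z) / (V n : ℝ) ^ m) atTop
      (nhds (p ^ E.card)) := by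
  let F : SimpleGraph (Fin m) := SimpleGraph.fromRel fun i j => (i, j) ∈ E
  have hFE : edgePairs F = E := by
    ext e
    rw [mem_edgePairs, SimpleGraph.fromRel_adj]
    refine ⟨fun h => ?_, fun h => ⟨hE e h, (hE e h).ne, Or.inl h⟩⟩
    rcases h.2.2 with h' | h'
    · exact h'
    · exact absurd (hE _ h') (lt_asymm h.1)
  have h1 := (h m F).tendsto_div_nhds_zero
  have h2 : Tendsto (fun n => ((∑ z, edgeProd E (adjIndicator (G n)) z) - totalCount F (G n))
      / (V n : ℝ) ^ m) atTop (nhds 0) := by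
    have hinv : Tendsto (fun n => (m : ℝ) ^ 2 / (V n : ℝ)) atTop (nhds 0) :=
      (tendsto_natCast_atTop_atTop.comp hV).const_div_atTop _
    refine squeeze_zero_norm' ?_ hinv
    filter_upwards [hV.eventually_gt_atTop 0] with n hn
    have hn0 : (0 : ℝ) < V n := by exact_mod_cast hn
    have := abs_totalCount_sub_sum_le F (G n)
    rw [hFE, Fintype.card_fin, abs_sub_comm] at this
    rw [norm_div, Real.norm_eq_abs, Real.norm_eq_abs, abs_of_pos (pow_pos hn0 m),
      div_le_div_iff₀ (by positivity) hn0]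
    exact this
  have h3 := (h1.add h2).add_const (p ^ E.card)
  rw [zero_add, zero_add] at h3
  refine h3.congr' ?_
  filter_upwards [hV.eventually_gt_atTop 0] with n hn
  have hn0 : (V n : ℝ) ^ m ≠ 0 := by positivity
  rw [← card_edgePairs, hFE]
  field_simp
  ring

lemma IsQuasirandom.cutUniform (hV : Tendsto V atTop atTop) (h : IsQuasirandom p V G) :
    CutUniform p V G := by
  intro δ hδ
  have hlim : Tendsto (fun n => (∑ z, edgeProd fourCycle (fun x y => adjIndicator (G n) x y - p) z)
      / (V n : ℝ) ^ 4) atTop (nhds 0) := by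
    have hexp : ∀ n, ∑ z, edgeProd fourCycle (fun x y => adjIndicator (G n) x y - p) z
        = ∑ E ∈ fourCycle.powerset, (-p) ^ (fourCycle \ E).card *
          ∑ z, edgeProd E (adjIndicator (G n)) z := by
      intro n
      simp_rw [edgeProd, sub_eq_add_neg, prod_add, prod_const]
      rw [sum_comm]
      refine sum_congr rfl fun E _ => ?_
      rw [mul_sum]
      exact sum_congr rfl fun z _ => mul_comm _ _
    have hsum := tendsto_finsetSum fourCycle.powerset fun E hE =>
      (h.tendsto_sum_edgeProd hV (E := E) fun e he =>
        lt_of_mem_fourCycle e (mem_powerset.1 hE he)).const_mul ((-p) ^ (fourCycle \ E).card)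
    have hzero : ∑ E ∈ fourCycle.powerset, (-p) ^ (fourCycle \ E).card * p ^ E.card = 0 := by
      have := prod_add (fun _ : Fin 4 × Fin 4 => p) (fun _ => -p) fourCycle
      simp only [prod_const, add_neg_cancel] at this
      rw [zero_pow (by decide)] at this
      rw [this]
      exact sum_congr rfl fun _ _ => mul_comm _ _
    rw [hzero] at hsum
    refine hsum.congr fun n => ?_
    rw [hexp, sum_div]
    exact sum_congr rfl fun E _ => by ring
  filter_upwards [hlim.eventually_lt_const (pow_pos hδ 4), hV.eventually_gt_atTop 0]
    with n hn hn0 S T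
  have hn0' : (0 : ℝ) < V n := by exact_mod_cast hn0
  rw [div_lt_iff₀ (by positivity)] at hn
  have h1 := sum_sum_pow_four_le (fun x y => adjIndicator (G n) x y - p) S T
  rw [Fintype.card_fin] at h1
  refine le_of_pow_le_pow_left₀ (n := 4) (by norm_num) (by positivity) ?_
  rw [Even.pow_abs (by decide)]
  calc _ ≤ _ := h1
    _ ≤ (V n : ℝ) ^ 4 * (δ ^ 4 * (V n : ℝ) ^ 4) := by gcongr
    _ = _ := by ring

end Equivalences

section Greedy

variable {ι : Type*} [Fintype ι] [DecidableEq ι]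

/-- Greedy extension of a sequence avoiding a sparse symmetric relation. -/
lemma exists_extension_avoiding {Bad : ι → ι → Prop} [DecidableRel Bad]
    (hsymm : ∀ a b, Bad a b → Bad b a) {D : ℝ} (hD : 0 ≤ D)
    {r s : ℕ} (hsr : s ≤ r) (x : ℕ → ι)
    (hx : ∀ i < s, ((univ.filter fun b => Bad (x i) b).card : ℝ) ≤ D)
    (hxx : ∀ i < s, ∀ j < s, i ≠ j → ¬ Bad (x i) (x j)) (Y : ℕ → Finset ι)
    (hY : ∀ i, ∀ a ∈ Y i, ((univ.filter fun b => Bad a b).card : ℝ) ≤ D)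
    (hYc : ∀ i, r * D < (Y i).card) :
    ∃ z : ℕ → ι, (∀ i < s, z i = x i) ∧ (∀ i, s ≤ i → i < r → z i ∈ Y i) ∧
      ∀ i < r, ∀ j < r, i ≠ j → ¬ Bad (z i) (z j) := by
  have key : ∀ t, s ≤ t → t ≤ r → ∃ z : ℕ → ι, (∀ i < s, z i = x i) ∧
      (∀ i, s ≤ i → i < t → z i ∈ Y i) ∧ ∀ i < t, ∀ j < t, i ≠ j → ¬ Bad (z i) (z j) := by
    intro t hst
    induction t, hst using Nat.le_induction with
    | base => exact fun _ => ⟨x, fun _ _ => rfl, fun i h1 h2 => by omega, hxx⟩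
    | succ t hst ih =>
      intro htr
      obtain ⟨z, hz1, hz2, hz3⟩ := ih (by omega)
      have hdeg : ∀ i < t, ((univ.filter fun b => Bad (z i) b).card : ℝ) ≤ D := by
        intro i hi
        by_cases h : i < s
        · rw [hz1 i h]; exact hx i h
        · exact hY i _ (hz2 i (not_lt.1 h) hi)
      obtain ⟨a, ha, hat⟩ : ∃ a ∈ Y t, ∀ i < t, ¬ Bad (z i) a := by
        by_contra! hcon
        have hsub : Y t ⊆ (range t).biUnion fun i => univ.filter fun b => Bad (z i) b := by
          intro a ha
          obtain ⟨i, hi, hb⟩ := hcon a ha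
          exact mem_biUnion.2 ⟨i, mem_range.2 hi, mem_filter.2 ⟨mem_univ _, hb⟩⟩
        have h1 : ((Y t).card : ℝ)
            ≤ ∑ i ∈ range t, ((univ.filter fun b => Bad (z i) b).card : ℝ) := by
          exact_mod_cast (card_le_card hsub).trans card_biUnion_le
        have h2 : ∑ i ∈ range t, ((univ.filter fun b => Bad (z i) b).card : ℝ) ≤ t * D := by
          calc _ ≤ ∑ i ∈ range t, D := sum_le_sum fun i hi => hdeg i (mem_range.1 hi)
            _ = _ := by simp
        have h3 : (t : ℝ) * D ≤ r * D := by
          gcongr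
          omega
        linarith [hYc t]
      refine ⟨Function.update z t a, fun i hi => ?_, fun i h1 h2 => ?_, fun i hi j hj hij => ?_⟩
      · rw [Function.update_of_ne (by omega)]; exact hz1 i hi
      · rcases eq_or_ne i t with rfl | h
        · simpa using ha
        · rw [Function.update_of_ne h]; exact hz2 i h1 (by omega)
      · rcases eq_or_ne i t with rfl | h <;> rcases eq_or_ne j i with rfl | h'
        · exact absurd rfl hij
        · rw [Function.update_self, Function.update_of_ne h']
          exact fun hb => hat j (by omega) (hsymm _ _ hb)
        · exact absurd rfl hij
        · rw [Function.update_of_ne h]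
          rcases eq_or_ne j t with rfl | h''
          · rw [Function.update_self]
            exact hat i (by omega)
          · rw [Function.update_of_ne h'']
            exact hz3 i (by omega) j (by omega) hij
  exact key r hsr le_rfl

end Greedy

section Averaging

variable {ι : Type*} [Fintype ι]

lemma card_filter_lt_card_mul_le {κ : Type*} [Fintype κ] (R : ι → κ → Prop)
    [∀ a, DecidablePred (R a)] (t : ℝ) [DecidablePred fun a =>
      t < ((univ.filter fun b => R a b).card : ℝ)] [DecidablePred fun e : ι × κ => R e.1 e.2] :
    ((univ.filter fun a => t < ((univ.filter fun b => R a b).card : ℝ)).card : ℝ) * t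
      ≤ (univ.filter fun e : ι × κ => R e.1 e.2).card := by
  have h : ((univ.filter fun e : ι × κ => R e.1 e.2).card : ℝ)
      = ∑ a, ((univ.filter fun b => R a b).card : ℝ) := by
    simp only [← sum_boole]
    rw [Fintype.sum_prod_type]
    exact sum_congr rfl fun x _ => sum_congr rfl fun y _ => by congr
  rw [h, ← nsmul_eq_mul, ← sum_const]
  calc _ ≤ ∑ a with t < ((univ.filter fun b => R a b).card : ℝ),
        ((univ.filter fun b => R a b).card : ℝ) :=
        sum_le_sum fun a ha => (mem_filter.1 ha).2.le
    _ ≤ _ := sum_le_sum_of_subset_of_nonneg (subset_univ _) fun _ _ _ => by positivity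

lemma sum_abs_le_of_sum_eq_zero {L : ι → ℝ} (h0 : ∑ a, L a = 0) {C δ τ : ℝ} (hC : 0 ≤ C)
    (hδ : 0 ≤ δ) (hL : ∀ a, L a ≤ C) [DecidablePred fun a => δ ≤ L a]
    (hcard : ((univ.filter fun a => δ ≤ L a).card : ℝ) ≤ τ * Fintype.card ι) :
    ∑ a, |L a| ≤ 2 * (δ + C * τ) * Fintype.card ι := by
  have hpos : ∑ a, max (L a) 0 ≤ (δ + C * τ) * Fintype.card ι := by
    calc ∑ a, max (L a) 0 ≤ ∑ a, (δ + C * if δ ≤ L a then 1 else 0) := by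
          refine sum_le_sum fun a _ => ?_
          split_ifs with h
          · exact max_le (by linarith [hL a]) (by linarith)
          · exact max_le (by linarith) (by linarith)
      _ = Fintype.card ι * δ + C * (univ.filter fun a => δ ≤ L a).card := by
          rw [sum_add_distrib, ← mul_sum, sum_boole]
          simp
      _ ≤ Fintype.card ι * δ + C * (τ * Fintype.card ι) := by gcongr
      _ = _ := by ring
  have habs : ∀ a, |L a| = 2 * max (L a) 0 - L a := by
    intro a
    rcases le_total 0 (L a) with h | h
    · rw [abs_of_nonneg h, max_eq_left h]; ring
    · rw [abs_of_nonpos h, max_eq_right h]; ring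
  simp only [habs]
  rw [sum_sub_distrib, ← mul_sum, h0]
  linarith

lemma card_filter_lt_mul_le (f : ι → ℝ) (hf : ∀ a, 0 ≤ f a) (t : ℝ)
    [DecidablePred fun a => t < f a] :
    ((univ.filter fun a => t < f a).card : ℝ) * t ≤ ∑ a, f a := by
  rw [← nsmul_eq_mul, ← sum_const]
  calc _ ≤ ∑ a with t < f a, f a := sum_le_sum fun a ha => (mem_filter.1 ha).2.le
    _ ≤ _ := sum_le_sum_of_subset_of_nonneg (subset_univ _) fun a _ _ => hf a

end Averaging

/-- If the symmetrised products of a bounded symmetric array are, off a sparse relation, nearly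
`p ^ e` plus an averaged correction of mean zero, then most entries of the array are close
to `p`. -/
lemma exists_most_weights_close {m : ℕ} (hm : 0 < m) {E : Finset (Fin m × Fin m)}
    (hE : ∀ e ∈ E, e.1 < e.2)
    (h1 : 1 < E.card) {p : ℝ} (hp : 0 < p) {δ : ℝ} (hδ : 0 < δ) (hδ1 : δ ≤ 1) {C : ℝ} (hC : 0 < C) :
    ∃ ε > 0, ∃ η > 0, ∀ (ι : Type) [Fintype ι] [DecidableEq ι] (Bad : ι → ι → Prop)
      [DecidableRel Bad] (d : ι → ι → ℝ) (L : ι → ℝ),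
      (∀ a b, Bad a b → Bad b a) → (∀ a, Bad a a) →
      ((univ.filter fun e : ι × ι => Bad e.1 e.2).card : ℝ) ≤ ε * (Fintype.card ι : ℝ) ^ 2 →
      (∀ x y, d x y = d y x) → (∀ x y, d x y ∈ Set.Icc 0 1) → ∑ a, L a = 0 → (∀ a, |L a| ≤ C) →
      (∀ b : Fin m → ι, (∀ i j, i ≠ j → ¬ Bad (b i) (b j)) →
        |symProd E d b - p ^ E.card - (m : ℝ)⁻¹ * ∑ i, L (b i)| ≤ η) →
      ∀ Far : Finset (ι × ι), (∀ e ∈ Far, δ < |d e.1 e.2 - p|) →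
        (Far.card : ℝ) ≤ δ * (Fintype.card ι : ℝ) ^ 2 := by
  obtain ⟨r₂, ηw, hηw, hweight⟩ := exists_weight_close hE (card_pos.1 (by omega)) hp hδ
  obtain ⟨δ', hδ'⟩ : ∃ δ', δ' = ηw / 2 * (δ / 8) / 4 := ⟨_, rfl⟩
  obtain ⟨τ, hτ⟩ : ∃ τ, τ = ηw / 2 * (δ / 8) / (4 * C) := ⟨_, rfl⟩
  have hδ'0 : 0 < δ' := by rw [hδ']; positivity
  have hτ0 : 0 < τ := by rw [hτ]; positivity
  obtain ⟨r₁, η₁, hη₁, hcorr⟩ := exists_no_alternating_correction hE h1 (p ^ E.card) C hδ'0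
  obtain ⟨s, hs⟩ : ∃ s, s = min (min (τ / (2 * (r₁ + 1))) (1 / (4 * (r₂ + 1)))) (δ / 8) := ⟨_, rfl⟩
  have hs0 : 0 < s := by rw [hs]; positivity
  have hs1 : s * (r₁ + 1) < τ := by
    have : s ≤ τ / (2 * (r₁ + 1)) := by
      rw [hs]; exact (min_le_left _ _).trans (min_le_left _ _)
    rw [le_div_iff₀ (by positivity)] at this
    linarith
  have hs2 : s * (r₂ + 1) < 1 / 2 := by
    have : s ≤ 1 / (4 * (r₂ + 1)) := by
      rw [hs]; exact (min_le_left _ _).trans (min_le_right _ _)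
    rw [le_div_iff₀ (by positivity)] at this
    linarith
  have hs3 : s ≤ δ / 8 := by rw [hs]; exact min_le_right _ _
  refine ⟨s ^ 2, by positivity, min η₁ (ηw / 2), by positivity, ?_⟩
  intro ι _ _ Bad _ d L hsymm hrefl hbad hd hd01 hL0 hLC hid Far hFar
  rcases isEmpty_or_nonempty ι with hι | hι
  · rw [Far.eq_empty_of_isEmpty]
    simp
  obtain ⟨N, hN⟩ : ∃ N : ℝ, N = Fintype.card ι := ⟨_, rfl⟩
  have hN0 : 0 < N := by rw [hN]; exact_mod_cast Fintype.card_pos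
  rw [← hN] at hbad ⊢
  obtain ⟨A, hA⟩ : ∃ A : Finset ι, A = univ.filter fun a =>
    s * N < ((univ.filter fun b => Bad a b).card : ℝ) := ⟨_, rfl⟩
  have hAc : (A.card : ℝ) ≤ s * N := by
    have := card_filter_lt_card_mul_le Bad (s * N)
    rw [← hA] at this
    have h : (A.card : ℝ) * (s * N) ≤ s * N * (s * N) := by
      refine this.trans (hbad.trans_eq ?_); ring
    exact le_of_mul_le_mul_right h (by positivity)
  have hAdeg : ∀ a ∉ A, ((univ.filter fun b => Bad a b).card : ℝ) ≤ s * N := by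
    intro a ha
    rw [hA, mem_filter, not_and, not_lt] at ha
    exact ha (mem_univ a)
  have hsd : ∀ X : Finset ι, (X.card : ℝ) - s * N ≤ (X \ A).card := by
    intro X
    have : (X.card : ℝ) ≤ (X \ A).card + A.card := by
      have := card_le_card_sdiff_add_card (s := X) (t := A)
      exact_mod_cast this
    linarith
  have hone : ((univ.filter fun a => δ' ≤ L a).card : ℝ) ≤ τ * N ∨
      ((univ.filter fun a => δ' ≤ -L a).card : ℝ) ≤ τ * N := by
    by_contra! hcon
    obtain ⟨z, -, hz, hzb⟩ := exists_extension_avoiding hsymm (D := s * N) (by positivity)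
      (Nat.zero_le r₁) (fun _ => hι.some) (by simp) (by simp)
      (fun i => if Even i then (univ.filter fun a => δ' ≤ L a) \ A
        else (univ.filter fun a => δ' ≤ -L a) \ A)
      (fun i a ha => hAdeg a (by
        split_ifs at ha <;> exact (Finset.mem_sdiff.1 ha).2))
      (fun i => by
        have := mul_lt_mul_of_pos_right hs1 hN0
        split_ifs
        · linarith [hsd (univ.filter fun a => δ' ≤ L a)]
        · linarith [hsd (univ.filter fun a => δ' ≤ -L a)])
    refine hcorr (fun i j => d (z i) (z j)) (fun i => L (z i)) (fun _ _ => hd _ _)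
      (fun _ _ => hd01 _ _) (fun _ => hLC _) (fun x hx hxr => ?_) ⟨fun i hi he => ?_,
        fun i hi ho => ?_⟩
    · exact (hid (fun i => z (x i)) fun i j hij => hzb _ (hxr i) _ (hxr j)
        fun h => hij (hx h)).trans (min_le_left _ _)
    · have := hz i (Nat.zero_le i) hi
      rw [if_pos he, Finset.mem_sdiff, mem_filter] at this
      exact this.1.2
    · have := hz i (Nat.zero_le i) hi
      rw [if_neg (Nat.not_even_iff_odd.2 ho), Finset.mem_sdiff, mem_filter] at this
      linarith [this.1.2]
  have hsumL : ∑ a, |L a| ≤ 2 * (δ' + C * τ) * N := by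
    rw [hN] at hone ⊢
    rcases hone with h | h
    · exact sum_abs_le_of_sum_eq_zero hL0 hC.le hδ'0.le (fun a => (abs_le.1 (hLC a)).2) h
    · have := sum_abs_le_of_sum_eq_zero (L := fun a => -L a) (by simp [hL0]) hC.le hδ'0.le
        (fun a => by linarith [(abs_le.1 (hLC a)).1]) h
      simpa using this
  obtain ⟨B, hB⟩ : ∃ B : Finset ι, B = univ.filter fun a => ηw / 2 < |L a| := ⟨_, rfl⟩
  have hBc : (B.card : ℝ) ≤ δ / 8 * N := by
    have h := card_filter_lt_mul_le (fun a => |L a|) (fun a => abs_nonneg _) (ηw / 2)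
    rw [← hB] at h
    have e : 2 * (δ' + C * τ) = δ / 8 * (ηw / 2) := by
      rw [hδ', hτ]; field_simp; ring
    rw [e] at hsumL
    have : (B.card : ℝ) * (ηw / 2) ≤ δ / 8 * N * (ηw / 2) := by linarith
    exact le_of_mul_le_mul_right this (by positivity)
  have hBL : ∀ a ∉ B, |L a| ≤ ηw / 2 := by
    intro a ha
    rw [hB, mem_filter, not_and, not_lt] at ha
    exact ha (mem_univ a)
  obtain ⟨Z, hZ⟩ : ∃ Z, Z = A ∪ B := ⟨_, rfl⟩
  have hZc : (Z.card : ℝ) ≤ (s + δ / 8) * N := by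
    have : (Z.card : ℝ) ≤ A.card + B.card := by rw [hZ]; exact_mod_cast card_union_le A B
    linarith
  have hZn : ∀ a ∉ Z, a ∉ A ∧ a ∉ B := fun a ha => by rwa [hZ, mem_union, not_or] at ha
  have hmR : (0 : ℝ) < m := by exact_mod_cast hm
  have hclose : ∀ a ∉ Z, ∀ b ∉ Z, ¬ Bad a b → |d a b - p| ≤ δ := by
    intro a ha b hb hab
    obtain ⟨z, hz0, hz, hzb⟩ := exists_extension_avoiding hsymm (D := s * N) (by positivity)
      (s := 2) (le_add_self : 2 ≤ r₂ + 2) (fun i => if i = 0 then a else b)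
      (fun i _ => by
        split_ifs
        · exact hAdeg a (hZn a ha).1
        · exact hAdeg b (hZn b hb).1)
      (fun i hi j hj hij => by
        interval_cases i <;> interval_cases j
        · exact absurd rfl hij
        · simpa using hab
        · simpa using fun h => hab (hsymm _ _ h)
        · exact absurd rfl hij) (fun _ => univ \ Z)
      (fun i c hc => hAdeg c (hZn c (Finset.mem_sdiff.1 hc).2).1)
      (fun i => by
        rw [cast_card_sdiff (subset_univ Z), card_univ, ← hN]
        have h1 := mul_lt_mul_of_pos_right hs2 hN0
        have h2 : s * N ≤ δ / 8 * N := by gcongr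
        have h3 : δ / 8 * N ≤ 1 / 8 * N := by gcongr
        push_cast
        nlinarith)
    have hzZ : ∀ i < r₂ + 2, |L (z i)| ≤ ηw / 2 := by
      intro i hi
      by_cases h : i < 2
      · rw [hz0 i h]
        split_ifs
        · exact hBL a (hZn a ha).2
        · exact hBL b (hZn b hb).2
      · exact hBL _ (hZn _ (Finset.mem_sdiff.1 (hz i (not_lt.1 h) hi)).2).2
    have := hweight (fun i j => d (z i) (z j)) (fun _ _ => hd _ _) (fun _ _ => hd01 _ _)
      fun x hx hxr => by
        have h1 := hid (fun i => z (x i)) fun i j hij => hzb _ ((hxr i).trans (by omega)) _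
          ((hxr j).trans (by omega)) fun h => hij (hx h)
        have h2 : |(m : ℝ)⁻¹ * ∑ i, L (z (x i))| ≤ ηw / 2 := by
          rw [abs_mul, abs_of_pos (by positivity), inv_mul_le_iff₀ hmR]
          calc _ ≤ ∑ i, |L (z (x i))| := abs_sum_le_sum_abs _ _
            _ ≤ ∑ _i : Fin m, ηw / 2 := sum_le_sum fun i _ => hzZ _ ((hxr i).trans (by omega))
            _ = _ := by simp
        have h3 := min_le_right η₁ (ηw / 2)
        change |symProd E d (fun i => z (x i)) - p ^ E.card| ≤ ηw
        have h4 := abs_add_le (symProd E d (fun i => z (x i)) - p ^ E.card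
          - (m : ℝ)⁻¹ * ∑ i, L (z (x i))) ((m : ℝ)⁻¹ * ∑ i, L (z (x i)))
        rw [sub_add_cancel] at h4
        linarith
    simpa [hz0] using this
  have hsub : Far ⊆ (Z ×ˢ univ ∪ univ ×ˢ Z) ∪ univ.filter fun e : ι × ι => Bad e.1 e.2 := by
    intro e he
    by_contra hcon
    simp only [mem_union, mem_product, mem_univ, and_true, true_and, mem_filter, not_or] at hcon
    exact absurd (hFar e he) (not_lt.2 (hclose _ hcon.1.1 _ hcon.1.2 hcon.2))
  have hFc : (Far.card : ℝ) ≤ Z.card * N + N * Z.card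
      + (univ.filter fun e : ι × ι => Bad e.1 e.2).card := by
    rw [hN]
    have := (card_le_card hsub).trans ((card_union_le _ _).trans
      (Nat.add_le_add_right (card_union_le _ _) _))
    rw [card_product, card_product, card_univ] at this
    exact_mod_cast this
  calc (Far.card : ℝ) ≤ _ := hFc
    _ ≤ (s + δ / 8) * N * N + N * ((s + δ / 8) * N) + s ^ 2 * N ^ 2 := by gcongr
    _ = (2 * s + δ / 4 + s ^ 2) * N ^ 2 := by ring
    _ ≤ δ * N ^ 2 := by
      gcongr
      nlinarith

lemma abs_sum_sub_edgeDensity_le {β : Type} [DecidableEq β] (G : SimpleGraph β)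
    [DecidableRel G.Adj] {ε : ℝ} {s t S T : Finset β} (h : G.IsUniform ε s t) (hS : S ⊆ s)
    (hT : T ⊆ t) :
    |∑ x ∈ S, ∑ y ∈ T, (adjIndicator G x y - G.edgeDensity s t)| ≤ ε * s.card * t.card := by
  have hε := h.pos
  have hsum : ∑ x ∈ S, ∑ y ∈ T, (adjIndicator G x y - G.edgeDensity s t)
      = ((G.edgeDensity S T : ℝ) - G.edgeDensity s t) * (S.card * T.card) := by
    have h1 : ∑ x ∈ S, ∑ y ∈ T, adjIndicator G x y = G.edgeDensity S T * (S.card * T.card) := by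
      have h2 : ∑ x ∈ S, ∑ y ∈ T, adjIndicator G x y = (G.interedges S T).card := by
        rw [← sum_product', SimpleGraph.interedges, Rel.interedges, card_filter, Nat.cast_sum]
        refine sum_congr rfl fun e _ => ?_
        simp only [adjIndicator]
        split_ifs <;> simp
      rw [h2, SimpleGraph.edgeDensity_def]
      push_cast
      rcases S.eq_empty_or_nonempty with rfl | hS0
      · simp
      rcases T.eq_empty_or_nonempty with rfl | hT0
      · simp [SimpleGraph.interedges, Rel.interedges]
      have := hS0.card_pos
      have := hT0.card_pos
      field_simp
    simp only [sum_sub_distrib, h1, sum_const, nsmul_eq_mul]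
    ring
  have hcS : (S.card : ℝ) ≤ s.card := by exact_mod_cast card_le_card hS
  have hcT : (T.card : ℝ) ≤ t.card := by exact_mod_cast card_le_card hT
  have h0 : ∀ u v, (0 : ℝ) ≤ G.edgeDensity u v := fun u v => by
    exact_mod_cast G.edgeDensity_nonneg u v
  have h1 : ∀ u v, (G.edgeDensity u v : ℝ) ≤ 1 := fun u v => by
    exact_mod_cast G.edgeDensity_le_one u v
  have habs : |(G.edgeDensity S T : ℝ) - G.edgeDensity s t| ≤ 1 :=
    abs_le.2 ⟨by linarith [h0 S T, h1 s t], by linarith [h1 S T, h0 s t]⟩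
  rw [hsum, abs_mul, abs_of_nonneg (by positivity : (0 : ℝ) ≤ S.card * T.card)]
  by_cases hs : (s.card : ℝ) * ε ≤ S.card
  · by_cases ht : (t.card : ℝ) * ε ≤ T.card
    · have := (h hS hT hs ht).le
      rw [mul_assoc]
      gcongr
    · calc _ ≤ 1 * ((s.card : ℝ) * (t.card * ε)) := by
            gcongr
            exact (not_le.1 ht).le
        _ = _ := by ring
  · calc _ ≤ 1 * ((s.card : ℝ) * ε * t.card) := by
          gcongr
          exact (not_le.1 hs).le
      _ = _ := by ring

lemma exists_uniform_chunks {m : ℕ} (hm : 0 < m) {ε : ℝ} (hε : 0 < ε) (l : ℕ) :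
    ∃ K N₀ : ℕ, ∀ N ≥ N₀, ∀ G : SimpleGraph (Fin N), ∃ k q : ℕ, l ≤ k ∧ k ≤ K ∧ 0 < q ∧
      N ≤ m * k * q + m * k ∧ ∃ (X : Fin k × Fin m → Finset (Fin N))
        (d : Fin k × Fin m → Fin k × Fin m → ℝ)
        (B : Finset ((Fin k × Fin m) × (Fin k × Fin m))),
        (Pairwise fun a b => Disjoint (X a) (X b)) ∧ (∀ a, (X a).card = q) ∧
        (∀ a b, d a b = d b a) ∧ (∀ a b, d a b ∈ Set.Icc (0 : ℝ) 1) ∧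
        (∀ a b, (a, b) ∈ B → (b, a) ∈ B) ∧ (∀ a, (a, a) ∈ B) ∧
        (B.card : ℝ) ≤ ε * ((k : ℝ) * m) ^ 2 ∧
        ∀ a b, (a, b) ∉ B → ∀ S ⊆ X a, ∀ T ⊆ X b,
          |∑ x ∈ S, ∑ y ∈ T, (adjIndicator G x y - d a b)| ≤ ε * (q : ℝ) ^ 2 := by
  classical
  obtain ⟨r, hr⟩ := exists_nat_ge (2 / ε)
  have hm' : (0 : ℝ) < m := by exact_mod_cast hm
  obtain ⟨ε', hε'⟩ : ∃ ε', ε' = ε / (4 * (m : ℝ) ^ 2) := ⟨_, rfl⟩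
  have hε'0 : 0 < ε' := by rw [hε']; positivity
  have hεm : ε' * (4 * (m : ℝ) ^ 2) = ε := by rw [hε']; field_simp
  obtain ⟨l', hl'⟩ : ∃ l', l' = max l (r + 1) := ⟨_, rfl⟩
  obtain ⟨K, hK⟩ : ∃ K, K = SzemerediRegularity.bound ε' l' := ⟨_, rfl⟩
  refine ⟨K, max l' (m * K), fun N hN G => ?_⟩
  obtain ⟨P, hPe, hPl, hPK, hPu⟩ := szemeredi_regularity G hε'0
    (by rw [Fintype.card_fin]; exact (le_max_left _ _).trans hN : l' ≤ Fintype.card (Fin N))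
  rw [← hK] at hPK
  obtain ⟨k, hk⟩ : ∃ k, k = P.parts.card := ⟨_, rfl⟩
  rw [← hk] at hPl hPK
  have hrk : r + 1 ≤ k := (le_max_right _ _).trans (hl' ▸ hPl)
  have hk0 : 0 < k := by omega
  have e : P.parts ≃ Fin k := P.parts.equivFinOfCardEq hk.symm
  obtain ⟨W, hW⟩ : ∃ W : Fin k → Finset (Fin N), W = fun i => (e.symm i).1 := ⟨_, rfl⟩
  have hWmem : ∀ i, W i ∈ P.parts := fun i => by rw [hW]; exact (e.symm i).2
  have hWinj : Function.Injective W := by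
    rw [hW]; exact Subtype.val_injective.comp e.symm.injective
  have hWdisj : ∀ i j, i ≠ j → Disjoint (W i) (W j) := fun i j hij =>
    P.disjoint (hWmem i) (hWmem j) (hWinj.ne hij)
  obtain ⟨q, hq⟩ : ∃ q, q = N / k / m := ⟨_, rfl⟩
  have hmk : m * k ≤ N := (Nat.mul_le_mul_left m hPK).trans ((le_max_right _ _).trans hN)
  have hNk : m ≤ N / k := (Nat.le_div_iff_mul_le hk0).2 hmk
  have hq0 : 0 < q := hq ▸ Nat.div_pos hNk hm
  have hlow : ∀ i, m * q ≤ (W i).card := fun i => by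
    have h1 := hPe.average_le_card_part (hWmem i)
    rw [card_univ, Fintype.card_fin, ← hk] at h1
    exact (hq ▸ Nat.mul_div_le _ _).trans h1
  have hup : N / k + 1 ≤ m * (q + 1) := by
    have := Nat.lt_mul_div_succ (N / k) hm
    rw [← hq] at this
    exact this
  have hcardW : ∀ i, ((W i).card : ℝ) ≤ 2 * m * q := fun i => by
    have h1 := hPe.card_part_le_average_add_one (hWmem i)
    rw [card_univ, Fintype.card_fin, ← hk] at h1
    have h2 : (W i).card ≤ 2 * m * q := by
      have : m * 1 ≤ m * q := Nat.mul_le_mul_left m hq0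
      linarith
    exact_mod_cast h2
  choose Y hYW hYd hYc using fun i => exists_disjoint_subsets_card_eq (W i) m q (hlow i)
  have hdiag : ((univ.filter fun c : Fin k × Fin k =>
      c.1 = c.2 ∨ ¬ G.IsUniform ε' (W c.1) (W c.2)).card : ℝ) ≤ ε * (k : ℝ) ^ 2 := by
    have h1 : (univ.filter fun c : Fin k × Fin k =>
        c.1 = c.2 ∨ ¬ G.IsUniform ε' (W c.1) (W c.2)).card
          ≤ k + (P.nonUniforms G ε').card := by
      have h2 : (univ.filter fun c : Fin k × Fin k =>
          c.1 = c.2 ∨ ¬ G.IsUniform ε' (W c.1) (W c.2)) ⊆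
            (univ.image fun i : Fin k => (i, i)) ∪ univ.filter fun c : Fin k × Fin k =>
              (W c.1, W c.2) ∈ P.nonUniforms G ε' := by
        intro c hc
        rw [mem_filter] at hc
        rw [mem_union, mem_image, mem_filter, Finpartition.mk_mem_nonUniforms]
        by_cases h : c.1 = c.2
        · exact Or.inl ⟨c.1, mem_univ _, Prod.ext rfl h⟩
        · exact Or.inr ⟨mem_univ _, hWmem _, hWmem _, hWinj.ne h, hc.2.resolve_left h⟩
      refine (card_le_card h2).trans ((card_union_le _ _).trans (Nat.add_le_add ?_ ?_))
      · exact card_image_le.trans_eq (by rw [card_univ, Fintype.card_fin])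
      · refine card_le_card_of_injOn (fun c => (W c.1, W c.2)) (fun c hc => ?_) ?_
        · exact (mem_filter.1 hc).2
        · intro c _ c' _ h
          rw [Prod.mk.injEq] at h
          exact Prod.ext (hWinj h.1) (hWinj h.2)
    have h2 : ((P.nonUniforms G ε').card : ℝ) ≤ (k : ℝ) ^ 2 * ε' := by
      refine hPu.trans ?_
      rw [← hk, sq]
      gcongr
      exact_mod_cast Nat.mul_le_mul_left k (Nat.sub_le k 1)
    have h3 : (k : ℝ) ≤ ε / 2 * (k : ℝ) ^ 2 := by
      have h4 : 2 / ε ≤ k := hr.trans (by exact_mod_cast (Nat.le_succ r).trans hrk)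
      rw [div_le_iff₀ hε] at h4
      nlinarith [(Nat.cast_nonneg k : (0 : ℝ) ≤ k)]
    have h4 : ε' ≤ ε / 4 := by
      have h5 : (1 : ℝ) ≤ (m : ℝ) ^ 2 := one_le_pow₀ (by exact_mod_cast hm)
      nlinarith
    have h5 : ((univ.filter fun c : Fin k × Fin k =>
        c.1 = c.2 ∨ ¬ G.IsUniform ε' (W c.1) (W c.2)).card : ℝ)
          ≤ k + (P.nonUniforms G ε').card := by exact_mod_cast h1
    nlinarith [sq_nonneg (k : ℝ)]
  refine ⟨k, q, (le_max_left _ _).trans (hl' ▸ hPl), hPK, hq0, ?_, fun a => Y a.1 a.2,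
    fun a b => G.edgeDensity (W a.1) (W b.1),
    univ.filter fun c => c.1.1 = c.2.1 ∨ ¬ G.IsUniform ε' (W c.1.1) (W c.2.1),
    ?_, fun a => hYc _ _, ?_, ?_, ?_, ?_, ?_, ?_⟩
  · have h1 := Nat.lt_mul_div_succ N hk0
    nlinarith
  · rintro ⟨i, s⟩ ⟨j, t⟩ hab
    by_cases hij : i = j
    · subst hij
      exact hYd i fun h => hab (Prod.ext rfl h)
    · exact (hWdisj i j hij).mono (hYW i s) (hYW j t)
  · intro a b
    exact congrArg Rat.cast (G.edgeDensity_comm _ _)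
  · intro a b
    exact ⟨Rat.cast_nonneg.2 (G.edgeDensity_nonneg _ _),
      (Rat.cast_le.2 (G.edgeDensity_le_one _ _)).trans_eq Rat.cast_one⟩
  · intro a b h
    rw [mem_filter] at h ⊢
    exact ⟨mem_univ _, h.2.imp Eq.symm fun h' h'' => h' h''.symm⟩
  · intro a
    rw [mem_filter]
    exact ⟨mem_univ _, Or.inl rfl⟩
  · have h1 : (univ.filter fun c : (Fin k × Fin m) × (Fin k × Fin m) =>
        c.1.1 = c.2.1 ∨ ¬ G.IsUniform ε' (W c.1.1) (W c.2.1)).card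
        ≤ ((univ.filter fun c : Fin k × Fin k =>
          c.1 = c.2 ∨ ¬ G.IsUniform ε' (W c.1) (W c.2)) ×ˢ
            (univ : Finset (Fin m × Fin m))).card := by
      refine card_le_card_of_injOn (fun c => ((c.1.1, c.2.1), (c.1.2, c.2.2))) ?_ ?_
      · intro c hc
        have := (mem_filter.1 hc).2
        exact mem_product.2 ⟨mem_filter.2 ⟨mem_univ _, this⟩, mem_univ _⟩
      · rintro ⟨⟨a, b⟩, c, d⟩ _ ⟨⟨a', b'⟩, c', d'⟩ _ h
        simp only [Prod.mk.injEq] at h ⊢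
        tauto
    rw [card_product, card_univ, Fintype.card_prod, Fintype.card_fin] at h1
    calc _ ≤ ((univ.filter fun c : Fin k × Fin k =>
          c.1 = c.2 ∨ ¬ G.IsUniform ε' (W c.1) (W c.2)).card : ℝ) * (m * m) := by
          exact_mod_cast h1
      _ ≤ ε * (k : ℝ) ^ 2 * (m * m) := by gcongr
      _ = _ := by ring
  · intro a b hab S hS T hT
    rw [mem_filter, not_and_or, not_or, not_not] at hab
    have hu := (hab.resolve_left fun h => h (mem_univ _)).2
    refine (abs_sum_sub_edgeDensity_le G hu (hS.trans (hYW _ _)) (hT.trans (hYW _ _))).trans ?_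
    calc ε' * (W a.1).card * (W b.1).card ≤ ε' * (2 * m * q) * (2 * m * q) := by
          gcongr
          · exact hcardW _
          · exact hcardW _
      _ = ε' * (4 * (m : ℝ) ^ 2) * (q : ℝ) ^ 2 := by ring
      _ = _ := by rw [hεm]

/-- The density of the pattern `E` between the blocks `X (b i)`, each of size `q`, averaged over
all ways of assigning the blocks to the vertices of the pattern. -/
noncomputable def blockDensity {m : ℕ} {β ι : Type*} (E : Finset (Fin m × Fin m))
    (A : β → β → ℝ) (X : ι → Finset β) (q : ℕ) (b : Fin m → ι) : ℝ :=
  ((q : ℝ) ^ m)⁻¹ * ((m.factorial : ℝ)⁻¹ * ∑ σ : Equiv.Perm (Fin m),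
    ∑ x ∈ Fintype.piFinset fun i => X (b (σ i)), edgeProd E A x)

section BlockDensity

variable {m : ℕ} {β ι : Type*} {E : Finset (Fin m × Fin m)} {A : β → β → ℝ} {X : ι → Finset β}
  {q : ℕ}

lemma blockDensity_comp_perm (τ : Equiv.Perm (Fin m)) (b : Fin m → ι) :
    blockDensity E A X q (b ∘ τ) = blockDensity E A X q b := by
  simp only [blockDensity]
  congr 2
  exact Fintype.sum_equiv (Equiv.mulLeft τ) _ _ fun σ => rfl

lemma inv_factorial_mul_sum_perm (c : ℝ) :
    (m.factorial : ℝ)⁻¹ * ∑ _σ : Equiv.Perm (Fin m), c = c := by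
  have : (m.factorial : ℝ) ≠ 0 := by exact_mod_cast m.factorial_ne_zero
  rw [sum_const, card_univ, Fintype.card_perm, Fintype.card_fin, nsmul_eq_mul]
  field_simp

lemma abs_inv_factorial_mul_sum_perm_le {f : Equiv.Perm (Fin m) → ℝ} {c : ℝ}
    (h : ∀ σ, |f σ| ≤ c) : |(m.factorial : ℝ)⁻¹ * ∑ σ, f σ| ≤ c := by
  rw [abs_mul, abs_of_nonneg (by positivity)]
  calc _ ≤ (m.factorial : ℝ)⁻¹ * ∑ _σ : Equiv.Perm (Fin m), c := by
        gcongr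
        exact (abs_sum_le_sum_abs _ _).trans (sum_le_sum fun σ _ => h σ)
    _ = c := inv_factorial_mul_sum_perm c

lemma blockDensity_mem_Icc (hq : 0 < q) (hA : ∀ x, edgeProd E A x ∈ Set.Icc (0 : ℝ) 1)
    (hX : ∀ a, (X a).card = q) (b : Fin m → ι) : blockDensity E A X q b ∈ Set.Icc (0 : ℝ) 1 := by
  have hq' : (0 : ℝ) < (q : ℝ) ^ m := by positivity
  refine ⟨?_, ?_⟩
  · rw [blockDensity]
    have : ∀ σ : Equiv.Perm (Fin m), (0 : ℝ) ≤
        ∑ x ∈ Fintype.piFinset fun i => X (b (σ i)), edgeProd E A x :=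
      fun σ => sum_nonneg fun x _ => (hA x).1
    have := sum_nonneg fun σ (_ : σ ∈ univ) => this σ
    positivity
  · rw [blockDensity, inv_mul_le_iff₀ hq', mul_one]
    refine (le_abs_self _).trans (abs_inv_factorial_mul_sum_perm_le fun σ => ?_)
    rw [abs_of_nonneg (sum_nonneg fun x _ => (hA x).1)]
    refine (sum_le_card_nsmul _ _ 1 fun x _ => (hA x).2).trans_eq ?_
    simp [Fintype.card_piFinset, hX]

lemma abs_blockDensity_sub_symProd_le [DecidableEq β] (hE : ∀ e ∈ E, e.1 < e.2)
    (hA : ∀ x y, A x y = 0 ∨ A x y = 1) (hq : 0 < q) (hX : ∀ a, (X a).card = q)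
    {d : ι → ι → ℝ} (hd : ∀ a b, d a b ∈ Set.Icc (0 : ℝ) 1) {ε : ℝ} {b : Fin m → ι}
    (hcut : ∀ i j, i ≠ j → ∀ S ⊆ X (b i), ∀ T ⊆ X (b j),
      |∑ x ∈ S, ∑ y ∈ T, (A x y - d (b i) (b j))| ≤ ε * (q : ℝ) ^ 2) :
    |blockDensity E A X q b - symProd E d b| ≤ E.card * ε := by
  have hq' : (0 : ℝ) < (q : ℝ) ^ m := by positivity
  have hsplit : blockDensity E A X q b - symProd E d b = (m.factorial : ℝ)⁻¹ *
      ∑ σ : Equiv.Perm (Fin m), ((q : ℝ) ^ m)⁻¹ *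
        ((∑ x ∈ Fintype.piFinset fun i => X (b (σ i)), edgeProd E A x)
          - edgeProd E d (fun i => b (σ i)) * (q : ℝ) ^ m) := by
    have : ∀ s t : ℝ, ((q : ℝ) ^ m)⁻¹ * (s - t * (q : ℝ) ^ m) = ((q : ℝ) ^ m)⁻¹ * s - t := by
      intro s t; field_simp
    simp only [this, sum_sub_distrib, ← mul_sum, blockDensity, symProd]
    ring
  rw [hsplit]
  refine abs_inv_factorial_mul_sum_perm_le fun σ => ?_
  have h := abs_sum_edgeProd_sub_le hE hA (d := fun e => d (b (σ e.1)) (b (σ e.2)))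
    (fun e => hd _ _) (U := fun i => X (b (σ i))) (fun i => hX _) (q := q) (θ := ε * (q : ℝ) ^ 2)
    (fun e he S hS T hT => hcut _ _ (σ.injective.ne (hE e he).ne) S hS T hT)
  rw [abs_mul, abs_of_pos (inv_pos.2 hq'), inv_mul_le_iff₀ hq']
  have hq2 : (0 : ℝ) < (q : ℝ) ^ 2 := by positivity
  refine le_of_mul_le_mul_left (h.trans_eq ?_) hq2
  ring

lemma sum_piFinset_biUnion [DecidableEq β] [DecidableEq ι]
    (hX : Pairwise fun a b => Disjoint (X a) (X b)) (U : Fin m → Finset ι)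
    (f : (Fin m → β) → ℝ) :
    ∑ b ∈ Fintype.piFinset U, ∑ x ∈ Fintype.piFinset fun i => X (b i), f x
      = ∑ x ∈ Fintype.piFinset fun i => (U i).biUnion X, f x := by
  have h : (Fintype.piFinset fun i => (U i).biUnion X)
      = (Fintype.piFinset U).biUnion fun b => Fintype.piFinset fun i => X (b i) := by
    ext x
    simp only [Fintype.mem_piFinset, mem_biUnion]
    constructor
    · intro hx
      choose b hb hbx using hx
      exact ⟨b, hb, hbx⟩
    · rintro ⟨b, hb, hbx⟩ i
      exact ⟨b i, hb i, hbx i⟩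
  rw [h, sum_biUnion]
  intro b _ b' _ hbb
  obtain ⟨i, hi⟩ := Function.ne_iff.1 hbb
  refine disjoint_left.2 fun x hx hx' => ?_
  exact disjoint_left.1 (hX hi) (Fintype.mem_piFinset.1 hx i) (Fintype.mem_piFinset.1 hx' i)

lemma sum_piFinset_comp_perm [DecidableEq ι] (σ : Equiv.Perm (Fin m)) (U : Fin m → Finset ι)
    (g : (Fin m → ι) → ℝ) :
    ∑ b ∈ Fintype.piFinset U, g (fun i => b (σ i))
      = ∑ b ∈ Fintype.piFinset fun i => U (σ i), g b := by
  refine sum_bij' (fun b _ i => b (σ i)) (fun b _ i => b (σ.symm i)) ?_ ?_ ?_ ?_ ?_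
  · intro b hb
    exact Fintype.mem_piFinset.2 fun i => Fintype.mem_piFinset.1 hb _
  · intro b hb
    refine Fintype.mem_piFinset.2 fun i => ?_
    simpa using Fintype.mem_piFinset.1 hb (σ.symm i)
  · intro b _; simp
  · intro b _; simp
  · intro b _; rfl

end BlockDensity

section SymCount

variable {m : ℕ} {β : Type} [Fintype β] {F : SimpleGraph (Fin m)} {G : SimpleGraph β}

lemma symCount_eq_sum {U : Fin m → Finset β} (hU : Pairwise fun i j => Disjoint (U i) (U j)) :
    symCount F G U = (m.factorial : ℝ)⁻¹ * ∑ σ : Equiv.Perm (Fin m),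
      ∑ x ∈ Fintype.piFinset fun i => U (σ i), edgeProd (edgePairs F) (adjIndicator G) x := by
  rw [symCount]
  congr 1
  exact sum_congr rfl fun σ _ => labCount_eq_sum F G fun i j hij => hU (σ.injective.ne hij)

variable [DecidableEq β]

lemma sum_blockDensity {ι : Type*} [DecidableEq ι] {X : ι → Finset β} {q : ℕ}
    (hX : Pairwise fun a b => Disjoint (X a) (X b)) {U : Fin m → Finset ι}
    (hU : Pairwise fun i j => Disjoint (U i) (U j)) :
    ∑ b ∈ Fintype.piFinset U, blockDensity (edgePairs F) (adjIndicator G) X q b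
      = ((q : ℝ) ^ m)⁻¹ * symCount F G fun i => (U i).biUnion X := by
  have hW : Pairwise fun i j => Disjoint ((U i).biUnion X) ((U j).biUnion X) := by
    intro i j hij
    rw [disjoint_biUnion_left]
    intro a ha
    rw [disjoint_biUnion_right]
    intro b hb
    exact hX fun hab => disjoint_left.1 (hU hij) ha (hab ▸ hb)
  rw [symCount_eq_sum hW]
  simp only [blockDensity, ← mul_sum]
  rw [sum_comm]
  congr 2
  refine sum_congr rfl fun σ _ => ?_
  rw [sum_piFinset_comp_perm σ U fun b => ∑ x ∈ Fintype.piFinset fun i => X (b i),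
    edgeProd (edgePairs F) (adjIndicator G) x, sum_piFinset_biUnion hX]

lemma symCount_sub_mem_Icc {W W' : Fin m → Finset β}
    (hW' : Pairwise fun i j => Disjoint (W' i) (W' j)) (h : ∀ i, W i ⊆ W' i) {c Q : ℕ}
    (hc : ∀ i, (W i).card = c) (hQ : ∀ i, (W' i).card = Q) :
    symCount F G W' - symCount F G W ∈ Set.Icc 0 ((Q : ℝ) ^ m - (c : ℝ) ^ m) := by
  have hW : Pairwise fun i j => Disjoint (W i) (W j) := fun i j hij =>
    (hW' hij).mono (h i) (h j)
  have hterm : ∀ σ : Equiv.Perm (Fin m),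
      (∑ x ∈ Fintype.piFinset fun i => W' (σ i), edgeProd (edgePairs F) (adjIndicator G) x)
        - ∑ x ∈ Fintype.piFinset fun i => W (σ i), edgeProd (edgePairs F) (adjIndicator G) x
        ∈ Set.Icc 0 ((Q : ℝ) ^ m - (c : ℝ) ^ m) := by
    intro σ
    have hsub : (Fintype.piFinset fun i => W (σ i)) ⊆ Fintype.piFinset fun i => W' (σ i) :=
      Fintype.piFinset_subset _ _ fun i => h _
    have hmem := edgeProd_adjIndicator_mem_Icc F G
    rw [← sum_sdiff hsub, add_sub_cancel_right]
    refine ⟨sum_nonneg fun x _ => (hmem x).1, ?_⟩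
    refine (sum_le_card_nsmul _ _ 1 fun x _ => (hmem x).2).trans_eq ?_
    rw [nsmul_eq_mul, mul_one, cast_card_sdiff hsub]
    simp [Fintype.card_piFinset, hc, hQ]
  rw [symCount_eq_sum hW', symCount_eq_sum hW, ← mul_sub, ← sum_sub_distrib]
  refine ⟨mul_nonneg (by positivity) (sum_nonneg fun σ _ => (hterm σ).1), ?_⟩
  refine (le_abs_self _).trans (abs_inv_factorial_mul_sum_perm_le fun σ => ?_)
  rw [abs_of_nonneg (hterm σ).1]
  exact (hterm σ).2

lemma exists_disjoint_supersets_card_eq {W : Fin m → Finset β}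
    (hW : Pairwise fun i j => Disjoint (W i) (W j)) {c Q : ℕ} (hc : ∀ i, (W i).card = c)
    (hcQ : c ≤ Q) (hQ : m * Q ≤ Fintype.card β) :
    ∃ W' : Fin m → Finset β, (Pairwise fun i j => Disjoint (W' i) (W' j)) ∧
      (∀ i, W i ⊆ W' i) ∧ ∀ i, (W' i).card = Q := by
  have hcard : (univ.biUnion W).card = m * c := by
    rw [card_biUnion fun i _ j _ hij => hW hij]
    simp [hc]
  obtain ⟨R, hR, hRd, hRc⟩ := exists_disjoint_subsets_card_eq (univ.biUnion W)ᶜ m (Q - c) (by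
    rw [card_compl, hcard, Nat.mul_sub]
    omega)
  have hRW : ∀ i j, Disjoint (W i) (R j) := fun i j => by
    refine disjoint_left.2 fun x hx hx' => ?_
    exact mem_compl.1 (hR j hx') (mem_biUnion.2 ⟨i, mem_univ _, hx⟩)
  refine ⟨fun i => W i ∪ R i, fun i j hij => ?_, fun i => subset_union_left, fun i => ?_⟩
  · change Disjoint (W i ∪ R i) (W j ∪ R j)
    rw [disjoint_union_left, disjoint_union_right, disjoint_union_right]
    exact ⟨⟨hW hij, hRW i j⟩, (hRW j i).symm, hRd hij⟩
  · rw [card_union_of_disjoint (hRW i i), hc, hRc]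
    omega

lemma abs_sum_blockDensity_sub_le {p : ℝ} (hp0 : 0 ≤ p) (hp1 : p ≤ 1) (hm : 0 < m) {k q : ℕ}
    (hq : 0 < q) {X : Fin k × Fin m → Finset β}
    (hX : Pairwise fun a b => Disjoint (X a) (X b)) (hXq : ∀ a, (X a).card = q)
    (hβ : Fintype.card β ≤ m * k * q + m * k) {ζ : ℝ} (hζ : 0 ≤ ζ)
    (hF : ∀ U : Fin m → Finset β, (Pairwise fun i j => Disjoint (U i) (U j)) →
      (∀ i, (U i).card = ⌊1 / (m : ℝ) * (Fintype.card β : ℝ)⌋₊) →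
      |symCount F G U - p ^ numEdges F * ∏ i, ((U i).card : ℝ)| ≤ ζ * (Fintype.card β : ℝ) ^ m)
    {U : Fin m → Finset (Fin k × Fin m)} (hU : Pairwise fun i j => Disjoint (U i) (U j))
    (hUk : ∀ i, (U i).card = k) :
    |∑ b ∈ Fintype.piFinset U,
        (blockDensity (edgePairs F) (adjIndicator G) X q b - p ^ numEdges F)|
      ≤ ζ * (2 * m * k : ℝ) ^ m + (k : ℝ) ^ m * ((1 + 1 / (q : ℝ)) ^ m - 1) := by
  have hm' : (0 : ℝ) < m := by exact_mod_cast hm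
  have hq' : (0 : ℝ) < q := by exact_mod_cast hq
  have hq1 : (1 : ℝ) ≤ q := by exact_mod_cast hq
  obtain ⟨Q, hQ⟩ : ∃ Q, Q = ⌊1 / (m : ℝ) * (Fintype.card β : ℝ)⌋₊ := ⟨_, rfl⟩
  obtain ⟨W, hW⟩ : ∃ W : Fin m → Finset β, W = fun i => (U i).biUnion X := ⟨_, rfl⟩
  have hWd : Pairwise fun i j => Disjoint (W i) (W j) := by
    intro i j hij
    rw [hW, disjoint_biUnion_left]
    intro a ha
    rw [disjoint_biUnion_right]
    intro b hb
    exact hX fun hab => disjoint_left.1 (hU hij) ha (hab ▸ hb)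
  have hWc : ∀ i, (W i).card = k * q := fun i => by
    rw [hW, card_biUnion fun a _ b _ hab => hX hab]
    simp [hXq, hUk]
  have hmkq : m * (k * q) ≤ Fintype.card β := by
    have : (univ.biUnion W).card = m * (k * q) := by
      rw [card_biUnion fun i _ j _ hij => hWd hij]
      simp [hWc]
    exact this ▸ card_le_univ _
  have hcQ : k * q ≤ Q := by
    rw [hQ]
    refine Nat.le_floor ?_
    rw [one_div, inv_mul_eq_div, le_div_iff₀ hm', mul_comm]
    exact_mod_cast hmkq
  have hmQ' : (m : ℝ) * Q ≤ Fintype.card β := by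
    have h := Nat.floor_le (by positivity : 0 ≤ 1 / (m : ℝ) * (Fintype.card β : ℝ))
    rwa [← hQ, one_div, inv_mul_eq_div, le_div_iff₀ hm', mul_comm] at h
  have hmQ : m * Q ≤ Fintype.card β := by exact_mod_cast hmQ'
  have hQup : (Q : ℝ) ≤ k * q * (1 + 1 / (q : ℝ)) := by
    have h1 : (m : ℝ) * Q ≤ m * (k * q + k) := by
      refine hmQ'.trans ?_
      have : (Fintype.card β : ℝ) ≤ m * k * q + m * k := by exact_mod_cast hβ
      linarith
    refine (le_of_mul_le_mul_left h1 hm').trans_eq ?_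
    field_simp
  obtain ⟨W', hWd', hWW, hWc'⟩ := exists_disjoint_supersets_card_eq hWd hWc hcQ hmQ
  have h1 := hF W' hWd' fun i => (hWc' i).trans hQ
  have h2 := symCount_sub_mem_Icc (F := F) (G := G) hWd' hWW hWc hWc'
  simp only [hWc', prod_const, card_univ, Fintype.card_fin] at h1
  have hpe0 : 0 ≤ p ^ numEdges F := pow_nonneg hp0 _
  have hpe1 : p ^ numEdges F ≤ 1 := pow_le_one₀ hp0 hp1
  have hN : (Fintype.card β : ℝ) ≤ 2 * m * k * q := by
    have h3 : (Fintype.card β : ℝ) ≤ m * k * q + m * k := by exact_mod_cast hβ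
    nlinarith [mul_le_mul_of_nonneg_left hq1 (by positivity : (0 : ℝ) ≤ m * k)]
  have hQm : (Q : ℝ) ^ m - ((k * q : ℕ) : ℝ) ^ m
      ≤ (q : ℝ) ^ m * ((k : ℝ) ^ m * ((1 + 1 / (q : ℝ)) ^ m - 1)) := by
    have : (Q : ℝ) ^ m ≤ (k * q * (1 + 1 / (q : ℝ))) ^ m := by gcongr
    refine (sub_le_sub_right this _).trans_eq ?_
    push_cast
    rw [mul_pow, mul_pow]
    ring
  have hNm : ζ * (Fintype.card β : ℝ) ^ m ≤ (q : ℝ) ^ m * (ζ * (2 * m * k : ℝ) ^ m) := by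
    calc _ ≤ ζ * (2 * m * k * q : ℝ) ^ m := by gcongr
      _ = _ := by rw [mul_pow _ (q : ℝ)]; ring
  have hsum : ∑ b ∈ Fintype.piFinset U,
        (blockDensity (edgePairs F) (adjIndicator G) X q b - p ^ numEdges F)
      = ((q : ℝ) ^ m)⁻¹ * (symCount F G W - p ^ numEdges F * ((k * q : ℕ) : ℝ) ^ m) := by
    rw [sum_sub_distrib, sum_blockDensity hX hU, ← hW, sum_const, Fintype.card_piFinset]
    simp only [hUk, prod_const, card_univ, Fintype.card_fin]
    rw [nsmul_eq_mul]
    push_cast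
    rw [mul_pow]
    field_simp
  rw [hsum, abs_mul, abs_of_pos (by positivity), inv_mul_le_iff₀ (by positivity), mul_add]
  have hD : 0 ≤ (Q : ℝ) ^ m - ((k * q : ℕ) : ℝ) ^ m := h2.1.trans h2.2
  have h3 : 0 ≤ p ^ numEdges F * ((Q : ℝ) ^ m - ((k * q : ℕ) : ℝ) ^ m) := mul_nonneg hpe0 hD
  have h4 : p ^ numEdges F * ((Q : ℝ) ^ m - ((k * q : ℕ) : ℝ) ^ m)
      ≤ (Q : ℝ) ^ m - ((k * q : ℕ) : ℝ) ^ m := mul_le_of_le_one_left hD hpe1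
  rw [mul_sub] at h3 h4
  obtain ⟨h5, h6⟩ := abs_le.1 h1
  obtain ⟨h7, h8⟩ := h2
  rw [abs_le]
  constructor <;> linarith

end SymCount

lemma abs_sum_sum_le_of_abs_le_one {β : Type*} {D : β → β → ℝ} (hD : ∀ x y, |D x y| ≤ 1)
    (S T : Finset β) : |∑ x ∈ S, ∑ y ∈ T, D x y| ≤ S.card * T.card := by
  refine (abs_sum_le_sum_abs _ _).trans ?_
  refine (sum_le_card_nsmul _ _ (T.card : ℝ) fun x _ => ?_).trans_eq (nsmul_eq_mul _ _)
  refine (abs_sum_le_sum_abs _ _).trans ?_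
  exact (sum_le_card_nsmul _ _ 1 fun y _ => hD x y).trans_eq (by rw [nsmul_eq_mul, mul_one])

lemma abs_sum_sum_le_of_blocks {β ι : Type*} [Fintype β] [DecidableEq β] [Fintype ι]
    [DecidableEq ι] {A : β → β → ℝ} {p : ℝ} (hA : ∀ x y, |A x y - p| ≤ 1) {X : ι → Finset β}
    {q r : ℕ} (hX : Pairwise fun a b => Disjoint (X a) (X b)) (hXq : ∀ a, (X a).card = q)
    (hβ : Fintype.card β ≤ Fintype.card ι * q + r) {d : ι → ι → ℝ} {B : Finset (ι × ι)} {ε δ : ℝ}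
    (hε : 0 ≤ ε) (hδ : 0 ≤ δ) (hB : (B.card : ℝ) ≤ ε * (Fintype.card ι : ℝ) ^ 2)
    (hcut : ∀ a b, (a, b) ∉ B → ∀ S ⊆ X a, ∀ T ⊆ X b,
      |∑ x ∈ S, ∑ y ∈ T, (A x y - d a b)| ≤ ε * (q : ℝ) ^ 2)
    (hfar : ∀ Far : Finset (ι × ι), (∀ e ∈ Far, δ < |d e.1 e.2 - p|) →
      (Far.card : ℝ) ≤ δ * (Fintype.card ι : ℝ) ^ 2) (S T : Finset β) :
    |∑ x ∈ S, ∑ y ∈ T, (A x y - p)|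
      ≤ 2 * (ε + δ) * (Fintype.card β : ℝ) ^ 2 + 2 * r * Fintype.card β := by
  classical
  obtain ⟨Y, hY⟩ : ∃ Y, Y = univ.biUnion X := ⟨_, rfl⟩
  have hYc : Y.card = Fintype.card ι * q := by
    rw [hY, card_biUnion fun a _ b _ hab => hX hab]
    simp [hXq]
  have hYle : Fintype.card ι * q ≤ Fintype.card β := hYc ▸ card_le_univ _
  have hYle' : (Fintype.card ι : ℝ) * q ≤ Fintype.card β := by exact_mod_cast hYle
  have hrest : ∀ R : Finset β, ((R \ Y).card : ℝ) ≤ r := fun R => by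
    have h1 : (R \ Y).card ≤ Yᶜ.card :=
      card_le_card fun x hx => mem_compl.2 (Finset.mem_sdiff.1 hx).2
    rw [card_compl, hYc] at h1
    exact_mod_cast h1.trans (by omega)
  have hcardle : ∀ R : Finset β, (R.card : ℝ) ≤ Fintype.card β := fun R => by
    exact_mod_cast card_le_univ R
  have hsplit : ∑ x ∈ S, ∑ y ∈ T, (A x y - p)
      = ∑ x ∈ S \ Y, ∑ y ∈ T, (A x y - p) + ∑ x ∈ S ∩ Y, ∑ y ∈ T \ Y, (A x y - p)
        + ∑ x ∈ S ∩ Y, ∑ y ∈ T ∩ Y, (A x y - p) := by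
    rw [add_assoc, ← sum_add_distrib, add_comm]
    simp_rw [add_comm (∑ y ∈ T \ Y, _), sum_inter_add_sum_sdiff]
  have hblock : ∀ a b, |∑ x ∈ S ∩ X a, ∑ y ∈ T ∩ X b, (A x y - p)|
      ≤ (ε + δ) * (q : ℝ) ^ 2 + ((if (a, b) ∈ B then 1 else 0)
        + if δ < |d a b - p| then 1 else 0) * (q : ℝ) ^ 2 := by
    intro a b
    have hq2 : (0 : ℝ) ≤ (q : ℝ) ^ 2 := by positivity
    have hSa : ((S ∩ X a).card : ℝ) ≤ q := by
      exact_mod_cast (card_le_card inter_subset_right).trans_eq (hXq a)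
    have hTb : ((T ∩ X b).card : ℝ) ≤ q := by
      exact_mod_cast (card_le_card inter_subset_right).trans_eq (hXq b)
    have hST : ((S ∩ X a).card : ℝ) * (T ∩ X b).card ≤ (q : ℝ) ^ 2 := by
      rw [sq]; gcongr
    have htriv := (abs_sum_sum_le_of_abs_le_one hA (S ∩ X a) (T ∩ X b)).trans hST
    have hnn : 0 ≤ (ε + δ) * (q : ℝ) ^ 2 := by positivity
    by_cases h1 : (a, b) ∈ B
    · rw [if_pos h1]
      split_ifs <;> nlinarith
    by_cases h2 : δ < |d a b - p|
    · rw [if_pos h2, if_neg h1]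
      linarith
    rw [if_neg h1, if_neg h2]
    have h3 := hcut a b h1 _ (inter_subset_right (s₁ := S)) _ (inter_subset_right (s₁ := T))
    have h4 : ∑ x ∈ S ∩ X a, ∑ y ∈ T ∩ X b, (A x y - p)
        = ∑ x ∈ S ∩ X a, ∑ y ∈ T ∩ X b, (A x y - d a b)
          + (d a b - p) * ((S ∩ X a).card * (T ∩ X b).card) := by
      simp only [sum_sub_distrib, sum_const, nsmul_eq_mul]
      ring
    rw [h4]
    refine (abs_add_le _ _).trans ?_
    rw [abs_mul, abs_of_nonneg (by positivity : (0 : ℝ) ≤ (S ∩ X a).card * (T ∩ X b).card)]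
    have h5 : |d a b - p| * ((S ∩ X a).card * (T ∩ X b).card) ≤ δ * (q : ℝ) ^ 2 := by
      have := not_lt.1 h2
      gcongr
    linarith
  have hmain : |∑ x ∈ S ∩ Y, ∑ y ∈ T ∩ Y, (A x y - p)|
      ≤ 2 * (ε + δ) * (Fintype.card β : ℝ) ^ 2 := by
    have hpart : ∀ (R : Finset β) (f : β → ℝ), ∑ x ∈ R ∩ Y, f x = ∑ a, ∑ x ∈ R ∩ X a, f x := by
      intro R f
      rw [hY, inter_biUnion, sum_biUnion]
      intro a _ b _ hab
      exact (hX hab).mono inter_subset_right inter_subset_right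
    have hexp : ∑ x ∈ S ∩ Y, ∑ y ∈ T ∩ Y, (A x y - p)
        = ∑ e : ι × ι, ∑ x ∈ S ∩ X e.1, ∑ y ∈ T ∩ X e.2, (A x y - p) := by
      rw [hpart, Fintype.sum_prod_type]
      refine sum_congr rfl fun a _ => ?_
      exact (sum_congr rfl fun x _ => hpart T fun y => A x y - p).trans sum_comm
    have hF := hfar (univ.filter fun e => δ < |d e.1 e.2 - p|) fun e he => (mem_filter.1 he).2
    rw [hexp]
    calc _ ≤ ∑ e : ι × ι, ((ε + δ) * (q : ℝ) ^ 2 + ((if (e.1, e.2) ∈ B then 1 else 0)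
          + if δ < |d e.1 e.2 - p| then 1 else 0) * (q : ℝ) ^ 2) :=
          (abs_sum_le_sum_abs _ _).trans (sum_le_sum fun e _ => hblock _ _)
      _ = (ε + δ) * (Fintype.card ι * q : ℝ) ^ 2
          + (B.card + (univ.filter fun e : ι × ι => δ < |d e.1 e.2 - p|).card) * (q : ℝ) ^ 2 := by
          rw [sum_add_distrib, ← sum_mul (f := fun e : ι × ι => (if (e.1, e.2) ∈ B then (1 : ℝ)
            else 0) + if δ < |d e.1 e.2 - p| then 1 else 0), sum_add_distrib, sum_const, card_univ,
            Fintype.card_prod, sum_boole, sum_boole, nsmul_eq_mul]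
          simp only [Prod.mk.eta, filter_mem_eq_inter, univ_inter]
          push_cast
          ring
      _ ≤ (ε + δ) * (Fintype.card ι * q : ℝ) ^ 2
          + (ε * (Fintype.card ι : ℝ) ^ 2 + δ * (Fintype.card ι : ℝ) ^ 2) * (q : ℝ) ^ 2 := by
          gcongr
      _ = 2 * (ε + δ) * (Fintype.card ι * q : ℝ) ^ 2 := by ring
      _ ≤ _ := by gcongr
  have h1 := abs_sum_sum_le_of_abs_le_one hA (S \ Y) T
  have h2 := abs_sum_sum_le_of_abs_le_one hA (S ∩ Y) (T \ Y)
  have h3 : ((S \ Y).card : ℝ) * T.card ≤ r * Fintype.card β := by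
    exact mul_le_mul (hrest S) (hcardle T) (by positivity) (by positivity)
  have h4 : ((S ∩ Y).card : ℝ) * (T \ Y).card ≤ Fintype.card β * r := by
    exact mul_le_mul (hcardle _) (hrest T) (by positivity) (by positivity)
  rw [hsplit]
  refine (abs_add_three _ _ _).trans ?_
  linarith

lemma exists_balanced_stability_const (n K : ℕ) : ∃ C : ℝ, 0 < C ∧ ∀ k, 3 ≤ k → k ≤ K →
    ∀ (μ : (Fin (n + 2) → Fin k × Fin (n + 2)) → ℝ) (θ : ℝ), 0 ≤ θ →
      (∀ (σ : Equiv.Perm (Fin (n + 2))) x, μ (x ∘ σ) = μ x) →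
      (∀ U : Fin (n + 2) → Finset (Fin k × Fin (n + 2)),
        (Pairwise fun i j => Disjoint (U i) (U j)) → (∀ i, (U i).card = k) →
        |∑ x ∈ Fintype.piFinset U, μ x| ≤ θ) →
      ∃ h : Fin k × Fin (n + 2) → ℝ, ∑ a, h a = 0 ∧
        ∀ x, Function.Injective x → |μ x - ∑ i, h (x i)| ≤ C * θ := by
  induction K with
  | zero => exact ⟨1, one_pos, fun k h3 h0 => absurd h0 (by omega)⟩
  | succ K ih =>
    obtain ⟨C, hC, h⟩ := ih
    by_cases hK : 3 ≤ K + 1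
    · obtain ⟨C', hC', h'⟩ := exists_additive_near_of_balanced_sum_le
        (ι := Fin (K + 1) × Fin (n + 2)) (n := n) (k := K + 1)
        (by rw [Fintype.card_prod, Fintype.card_fin, Fintype.card_fin, mul_comm]) hK
      refine ⟨C + C', by positivity, fun k h3 hk μ θ hθ hμ hsum => ?_⟩
      rcases Nat.lt_or_ge K k with hlt | hle
      · obtain rfl : k = K + 1 := by omega
        obtain ⟨g, hg, hgx⟩ := h' μ θ hθ hμ hsum
        exact ⟨g, hg, fun x hx => (hgx x hx).trans
          (mul_le_mul_of_nonneg_right (by linarith) hθ)⟩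
      · obtain ⟨g, hg, hgx⟩ := h k h3 hle μ θ hθ hμ hsum
        exact ⟨g, hg, fun x hx => (hgx x hx).trans
          (mul_le_mul_of_nonneg_right (by linarith) hθ)⟩
    · exact ⟨C, hC, fun k h3 hk => absurd h3 (by omega)⟩

lemma abs_le_of_abs_sum_injective_le {ι : Type*} [Fintype ι] [DecidableEq ι] {m : ℕ} (hm : 0 < m)
    (hcard : m + 1 ≤ Fintype.card ι) {h : ι → ℝ} (h0 : ∑ a, h a = 0) {c : ℝ}
    (hsum : ∀ x : Fin m → ι, Function.Injective x → |∑ i, h (x i)| ≤ c) (a : ι) :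
    |h a| ≤ 2 * c := by
  have hdiff : ∀ a b, h a - h b ≤ 2 * c := by
    intro a b
    have hc : m - 1 ≤ (univ \ {a, b} : Finset ι).card := by
      have := le_card_sdiff ({a, b} : Finset ι) univ
      have h2 : ({a, b} : Finset ι).card ≤ 2 := card_le_two
      rw [card_univ] at this
      omega
    obtain ⟨n, rfl⟩ : ∃ n, m = n + 1 := ⟨m - 1, by omega⟩
    obtain ⟨S, hS, hSc⟩ := exists_subset_card_eq hc
    rw [Nat.add_sub_cancel] at hSc
    obtain ⟨y, hy⟩ : ∃ y : Fin n → ι, y = fun i => ((S.equivFinOfCardEq hSc).symm i : ι) :=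
      ⟨_, rfl⟩
    have hyinj : Function.Injective y := by
      rw [hy]
      exact Subtype.val_injective.comp (S.equivFinOfCardEq hSc).symm.injective
    have hyS : ∀ i, y i ∉ ({a, b} : Finset ι) := fun i => by
      rw [hy]
      exact (Finset.mem_sdiff.1 (hS ((S.equivFinOfCardEq hSc).symm i).2)).2
    have hcons : ∀ z, z = a ∨ z = b → |h z + ∑ i, h (y i)| ≤ c := by
      intro z hz
      have hinj : Function.Injective (Fin.cons z y : Fin (n + 1) → ι) := by
        rw [Fin.cons_injective_iff]
        refine ⟨?_, hyinj⟩
        rintro ⟨i, rfl⟩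
        exact hyS i (by simpa using hz)
      have := hsum _ hinj
      rwa [Fin.sum_univ_succ, Fin.cons_zero, sum_congr rfl fun i _ => by rw [Fin.cons_succ]] at this
    have h1 := (abs_le.1 (hcons a (Or.inl rfl))).2
    have h2 := (abs_le.1 (hcons b (Or.inr rfl))).1
    linarith
  have hpos : (0 : ℝ) < Fintype.card ι := by
    exact_mod_cast (by omega : 0 < Fintype.card ι)
  have hup : (Fintype.card ι : ℝ) * h a ≤ Fintype.card ι * (2 * c) := by
    have := sum_le_sum fun b (_ : b ∈ univ) => hdiff a b
    simpa [sum_sub_distrib, h0] using this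
  have hlow : (Fintype.card ι : ℝ) * (-h a) ≤ Fintype.card ι * (2 * c) := by
    have := sum_le_sum fun b (_ : b ∈ univ) => hdiff b a
    simpa [sum_sub_distrib, h0] using this
  exact abs_le.2 ⟨by linarith [le_of_mul_le_mul_left hlow hpos],
    le_of_mul_le_mul_left hup hpos⟩

lemma eventually_one_add_inv_pow_sub_one_le (m : ℕ) (c : ℝ) {θ : ℝ} (hθ : 0 < θ) :
    ∀ᶠ q : ℕ in atTop, c * ((1 + 1 / (q : ℝ)) ^ m - 1) ≤ θ := by
  have h : Tendsto (fun q : ℕ => c * ((1 + 1 / (q : ℝ)) ^ m - 1)) atTop (nhds 0) := by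
    have h1 := ((tendsto_one_div_atTop_nhds_zero_nat (𝕜 := ℝ)).const_add 1).pow m
    have h2 := (h1.sub_const 1).const_mul c
    simpa using h2
  exact (h.eventually (gt_mem_nhds hθ)).mono fun q hq => hq.le

theorem SatisfiesPt.cutUniform {m : ℕ} {F : SimpleGraph (Fin m)} (hF : 1 < numEdges F) {p : ℝ}
    (hp0 : 0 < p) (hp1 : p ≤ 1) {V : ℕ → ℕ} {G : ∀ n, SimpleGraph (Fin (V n))}
    (hV : Tendsto V atTop atTop) (h : SatisfiesPt F p (fun _ => 1 / (m : ℝ)) V G) :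
    CutUniform p V G := by
  classical
  intro δ' hδ'
  have hEcard : 1 < (edgePairs F).card := by rwa [card_edgePairs]
  have hElt := lt_of_mem_edgePairs F
  obtain ⟨n', rfl⟩ : ∃ n', m = n' + 2 := by
    obtain ⟨e, he⟩ := card_pos.1 (zero_lt_one.trans hEcard)
    have h1 := hElt e he
    rw [Fin.lt_def] at h1
    exact ⟨m - 2, by have := e.2.isLt; omega⟩
  have hm0 : 0 < n' + 2 := by omega
  obtain ⟨δ, hδ⟩ : ∃ δ, δ = min 1 (δ' / 8) := ⟨_, rfl⟩
  have hδ0 : 0 < δ := hδ ▸ lt_min one_pos (by positivity)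
  have hδ1 : δ ≤ 1 := hδ ▸ min_le_left _ _
  have hδ8 : δ ≤ δ' / 8 := hδ ▸ min_le_right _ _
  obtain ⟨ε₀, hε₀, η₀, hη₀, hfar⟩ := exists_most_weights_close hm0 hElt hEcard hp0 hδ0 hδ1
    (C := ((n' + 2 : ℕ) : ℝ) * 4) (by positivity)
  obtain ⟨ε, hε⟩ : ∃ ε, ε = min (min ε₀ δ) (η₀ / (2 * (edgePairs F).card)) := ⟨_, rfl⟩
  have hE0 : (0 : ℝ) < (edgePairs F).card := by exact_mod_cast zero_lt_one.trans hEcard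
  have hεpos : 0 < ε := hε ▸ lt_min (lt_min hε₀ hδ0) (by positivity)
  have hεε₀ : ε ≤ ε₀ := hε ▸ (min_le_left _ _).trans (min_le_left _ _)
  have hεδ : ε ≤ δ := hε ▸ (min_le_left _ _).trans (min_le_right _ _)
  have hεη : (edgePairs F).card * ε ≤ η₀ / 2 := by
    have h1 : ε ≤ η₀ / (2 * (edgePairs F).card) := hε ▸ min_le_right _ _
    rw [le_div_iff₀ (by positivity)] at h1
    linarith
  obtain ⟨η, hη⟩ : ∃ η, η = min 1 (η₀ / 2) := ⟨_, rfl⟩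
  have hη0 : 0 < η := hη ▸ lt_min one_pos (by positivity)
  have hη1 : η ≤ 1 := hη ▸ min_le_left _ _
  have hη2 : η ≤ η₀ / 2 := hη ▸ min_le_right _ _
  obtain ⟨K, N₀, hchunks⟩ := exists_uniform_chunks hm0 hεpos 3
  obtain ⟨C, hC, hstab⟩ := exists_balanced_stability_const n' K
  obtain ⟨θ, hθ⟩ : ∃ θ, θ = η / C := ⟨_, rfl⟩
  have hθ0 : 0 < θ := hθ ▸ div_pos hη0 hC
  have hCθ : C * θ = η := by rw [hθ]; field_simp
  obtain ⟨q₀, hq₀⟩ := eventually_atTop.1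
    (eventually_one_add_inv_pow_sub_one_le (n' + 2) ((K : ℝ) ^ (n' + 2)) (half_pos hθ0))
  obtain ⟨ζ, hζ, hP⟩ := h
  have hζev : ∀ᶠ n in atTop, |ζ n| * (2 * (n' + 2 : ℕ) * K : ℝ) ^ (n' + 2) ≤ θ / 2 := by
    have h1 : Tendsto (fun n => |ζ n| * (2 * (n' + 2 : ℕ) * K : ℝ) ^ (n' + 2)) atTop (nhds 0) := by
      simpa using hζ.abs.mul_const ((2 * (n' + 2 : ℕ) * K : ℝ) ^ (n' + 2))
    exact (h1.eventually (gt_mem_nhds (half_pos hθ0))).mono fun n hn => hn.le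
  have hVev : ∀ᶠ n in atTop, 4 * ((n' + 2 : ℕ) * K : ℝ) / δ' ≤ V n :=
    (tendsto_natCast_atTop_atTop.comp hV).eventually (eventually_ge_atTop _)
  filter_upwards [hζev, hVev, hV.eventually (eventually_ge_atTop N₀),
    hV.eventually (eventually_gt_atTop ((n' + 2) * K * q₀ + (n' + 2) * K))]
    with n hζn hVn hVN₀ hVq S T
  obtain ⟨k, q, hk3, hkK, hq0, hN, X, d, B, hX, hXq, hdsymm, hd01, hBsymm, hBrefl, hBcard, hcut⟩ :=
    hchunks (V n) hVN₀ (G n)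
  have hkK' : (k : ℝ) ≤ K := by exact_mod_cast hkK
  have hq₀q : q₀ ≤ q := by
    by_contra hlt
    have h1 : (n' + 2) * k * q ≤ (n' + 2) * K * q₀ := by
      gcongr
      omega
    have h2 : (n' + 2) * k ≤ (n' + 2) * K := by gcongr
    omega
  have hι : Fintype.card (Fin k × Fin (n' + 2)) = k * (n' + 2) := by simp
  have hι' : (Fintype.card (Fin k × Fin (n' + 2)) : ℝ) = k * (n' + 2 : ℕ) := by
    rw [hι, Nat.cast_mul]
  have hpe0 : 0 ≤ p ^ numEdges F := pow_nonneg hp0.le _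
  have hpe1 : p ^ numEdges F ≤ 1 := pow_le_one₀ hp0.le hp1
  obtain ⟨g, hg0, hg⟩ := hstab k hk3 hkK
    (fun b => blockDensity (edgePairs F) (adjIndicator (G n)) X q b - p ^ numEdges F) θ hθ0.le
    (fun σ b => by rw [blockDensity_comp_perm]) (fun U hU hUk => by
      refine (abs_sum_blockDensity_sub_le hp0.le hp1 hm0 hq0 hX hXq
        (by rwa [Fintype.card_fin]) (abs_nonneg (ζ n)) (fun W hW hWc => ?_) hU hUk).trans ?_
      · rw [Fintype.card_fin] at hWc ⊢
        exact (hP n W hW hWc).trans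
          (mul_le_mul_of_nonneg_right (le_abs_self _) (by positivity))
      · have h1 : |ζ n| * (2 * (n' + 2 : ℕ) * k : ℝ) ^ (n' + 2)
            ≤ |ζ n| * (2 * (n' + 2 : ℕ) * K : ℝ) ^ (n' + 2) := by gcongr
        have h2 : (0 : ℝ) ≤ (1 + 1 / (q : ℝ)) ^ (n' + 2) - 1 :=
          sub_nonneg.2 (one_le_pow₀ (le_add_of_nonneg_right (by positivity)))
        have h3 : (k : ℝ) ^ (n' + 2) * ((1 + 1 / (q : ℝ)) ^ (n' + 2) - 1)
            ≤ (K : ℝ) ^ (n' + 2) * ((1 + 1 / (q : ℝ)) ^ (n' + 2) - 1) := by gcongr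
        linarith [hq₀ q hq₀q])
  rw [hCθ] at hg
  have hμ := fun b : Fin (n' + 2) → Fin k × Fin (n' + 2) =>
    blockDensity_mem_Icc hq0 (edgeProd_adjIndicator_mem_Icc F (G n)) hXq b
  have hgabs : ∀ a, |g a| ≤ 4 := by
    intro a
    refine (abs_le_of_abs_sum_injective_le hm0 ?_ hg0 (c := 2) (fun x hx => ?_) a).trans_eq
      (by norm_num)
    · rw [hι]
      nlinarith
    · have h1 := abs_le.1 (hg x hx)
      have h2 := hμ x
      exact abs_le.2 ⟨by linarith [h2.1, h2.2], by linarith [h2.1, h2.2]⟩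
  have hmne : ((n' + 2 : ℕ) : ℝ) ≠ 0 := by positivity
  have hfar' := hfar (Fin k × Fin (n' + 2)) (fun a b => (a, b) ∈ B) d
    (fun a => ((n' + 2 : ℕ) : ℝ) * g a) hBsymm hBrefl ?_ hdsymm hd01
    (by rw [← mul_sum, hg0, mul_zero]) (fun a => by
      rw [abs_mul, Nat.abs_cast]
      exact mul_le_mul_of_nonneg_left (hgabs a) (by positivity)) ?_
  · have hA : ∀ x y, |adjIndicator (G n) x y - p| ≤ 1 := by
      intro x y
      rcases adjIndicator_zero_or_one (G n) x y with h1 | h1 <;> rw [h1, abs_le] <;>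
        constructor <;> linarith
    have hfinal := abs_sum_sum_le_of_blocks hA hX hXq (r := (n' + 2) * k)
      (by rw [Fintype.card_fin, hι]; linarith) hεpos.le hδ0.le (by rwa [hι']) hcut hfar' S T
    rw [Fintype.card_fin] at hfinal
    refine hfinal.trans ?_
    have h1 : 2 * (ε + δ) * (V n : ℝ) ^ 2 ≤ δ' / 2 * (V n : ℝ) ^ 2 := by
      gcongr
      linarith
    have h2 : 2 * (((n' + 2) * k : ℕ) : ℝ) * V n ≤ δ' / 2 * (V n : ℝ) ^ 2 := by
      rw [div_le_iff₀ hδ'] at hVn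
      have h3 : (((n' + 2) * k : ℕ) : ℝ) ≤ (n' + 2 : ℕ) * K := by
        rw [Nat.cast_mul]
        gcongr
      nlinarith [(Nat.cast_nonneg (V n) : (0 : ℝ) ≤ V n)]
    linarith
  · refine le_trans ?_ ((hBcard.trans_eq ?_).trans
      (mul_le_mul_of_nonneg_right hεε₀ (sq_nonneg (Fintype.card (Fin k × Fin (n' + 2)) : ℝ))))
    · simp only [Prod.mk.eta, filter_mem_eq_inter, univ_inter]
      exact le_rfl
    · rw [hι']
  · intro b hb
    have hbinj : Function.Injective b := by
      intro i j hij
      by_contra hne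
      exact hb i j hne (hij ▸ hBrefl _)
    have h1 := abs_blockDensity_sub_symProd_le hElt (adjIndicator_zero_or_one (G n)) hq0 hXq hd01
      (b := b) fun i j hij => hcut _ _ (hb i j hij)
    have h2 := hg b hbinj
    rw [← mul_sum, ← mul_assoc, inv_mul_cancel₀ hmne, one_mul, card_edgePairs]
    obtain ⟨h3, h4⟩ := abs_le.1 h1
    obtain ⟨h5, h6⟩ := abs_le.1 h2
    exact abs_le.2 ⟨by linarith, by linarith⟩

/-- **Theorem (T=).** Let `e(F) > 1`, `m = |F|`, `0 < p ≤ 1`. If `F` is regular, a star,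
or disconnected, then `P(F;1/m,…,1/m)` (for any labelling) and the weaker
`P̃(F;1/m,…,1/m)` are `p`-quasi-random properties. -/
theorem stmt2 {m : ℕ} (F : SimpleGraph (Fin m)) (hF : 1 < numEdges F)
    (p : ℝ) (hp0 : 0 < p) (hp1 : p ≤ 1)
    (hFclass : IsRegularGraph F ∨ IsStar F ∨ ¬ F.Connected) :
    ∀ (V : ℕ → ℕ) (G : ∀ n, SimpleGraph (Fin (V n))), Tendsto V atTop atTop →
      ((SatisfiesPu F p (fun _ => 1 / (m : ℝ)) V G ↔ IsQuasirandom p V G) ∧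
        (SatisfiesPt F p (fun _ => 1 / (m : ℝ)) V G ↔ IsQuasirandom p V G)) := by
  intro V G hV
  have hm : 0 < m := by
    rw [← card_edgePairs] at hF
    obtain ⟨e, -⟩ := card_pos.1 (zero_lt_one.trans hF)
    exact e.1.pos
  have hPu : IsQuasirandom p V G → SatisfiesPu F p (fun _ => 1 / (m : ℝ)) V G := fun h σ =>
    (h.cutUniform hV).satisfiesP _ hp0.le hp1 hm hV
  have hPt : SatisfiesPt F p (fun _ => 1 / (m : ℝ)) V G → IsQuasirandom p V G := fun h =>
    (h.cutUniform hF hp0 hp1 hV).isQuasirandom hp0.le hp1 hV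
  exact ⟨⟨fun h => hPt h.satisfiesPt, hPu⟩, ⟨hPt, fun h => (hPu h).satisfiesPt⟩⟩
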